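/- Let (R, m) be a Noetherian complete local ring and let I be an ideal of R. Then I ∈ 𝓘(R) if and only if mAss_R R = 𝔄(I,R) ∪ 𝔅(I,R) ∪ 𝔇(I,R). -/

import Mathlib

universe u

open CategoryTheory

/-- An `R`-module `L` is `I`-cofinite if `Supp L ⊆ V(I)` and `Ext^i_R(R/I, L)` is a finitely
generated `R`-module for all `i ≥ 0`. -/
def IsCofinite {R : Type u} [CommRing R] (I : Ideal R) (L : ModuleCat.{u} R) : Prop :=
  Module.support R L ⊆ PrimeSpectrum.zeroLocus (I : Set R) ∧
    ∀ i : ℕ, Module.Finite R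
      (((Ext R (ModuleCat.{u} R) i).obj (Opposite.op (ModuleCat.of R (R ⧸ I)))).obj L)

/-- `I ∈ 𝓘(R)`: for every finitely generated `R`-module `M`, the local cohomology modules
`H^i_I(M)` are `I`-cofinite for all `i ≥ 0`. -/
def MemCofiniteClass (R : Type u) [CommRing R] (I : Ideal R) : Prop :=
  ∀ M : ModuleCat.{u} R, Module.Finite R M →
    ∀ i : ℕ, IsCofinite I ((localCohomology I i).obj M)

/-- The cohomological dimension `cd(I, M)`: the supremum (in `WithBot ℕ∞`, so that the
supremum of the empty set is `⊥ = -∞`) of the set of indices `i` with `H^i_I(M) ≠ 0`. -/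
noncomputable def cohomologicalDim {R : Type u} [CommRing R] (I : Ideal R)
    (M : ModuleCat.{u} R) : WithBot ℕ∞ :=
  sSup ((fun i : ℕ => ((i : ℕ∞) : WithBot ℕ∞)) ''
    {i : ℕ | Nontrivial ((localCohomology I i).obj M)})

/-- `mAss_R R`: the set of minimal elements of `Ass_R R` with respect to inclusion. -/
def minimalAssociatedPrimes (R : Type u) [CommRing R] : Set (Ideal R) :=
  {p ∈ associatedPrimes R R | ∀ q ∈ associatedPrimes R R, q ≤ p → q = p}

/-- `𝔄(I,R) = { p ∈ mAss_R R : I + p = R or p ⊇ I }`. -/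
def frakA {R : Type u} [CommRing R] (I : Ideal R) : Set (Ideal R) :=
  {p ∈ minimalAssociatedPrimes R | I + p = ⊤ ∨ I ≤ p}

/-- `𝔅(I,R) = { p ∈ mAss_R R : cd(I, R/p) = 1 }`. -/
noncomputable def frakB {R : Type u} [CommRing R] (I : Ideal R) : Set (Ideal R) :=
  {p ∈ minimalAssociatedPrimes R | cohomologicalDim I (ModuleCat.of R (R ⧸ p)) = 1}

/-- `𝔇(I,R) = { p ∈ mAss_R R : 0 ≤ dim R/(I + p) ≤ 1 }`. -/
def frakD {R : Type u} [CommRing R] (I : Ideal R) : Set (Ideal R) :=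
  {p ∈ minimalAssociatedPrimes R |
    0 ≤ ringKrullDim (R ⧸ (I + p)) ∧ ringKrullDim (R ⧸ (I + p)) ≤ 1}


namespace CLC
variable {R : Type u} [CommRing R]

lemma extMk_smul {X : ModuleCat.{u} R} (P : ProjectiveResolution X) {Y : ModuleCat.{u} R} {n : ℕ}
    (f : P.complex.X n ⟶ Y) (hf : P.complex.d (n+1) n ≫ f = 0) (r : R) :
    P.extMk (r • f) (n+1) rfl (by simp [hf]) = r • P.extMk f (n+1) rfl hf := by
  rw [Abelian.Ext.smul_eq_comp_mk₀, P.extMk_comp_mk₀]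
  simp

/-- cocycles of `Hom(P,Y)` in degree n -/
def zsub {X : ModuleCat.{u} R} (P : ProjectiveResolution X) (Y : ModuleCat.{u} R) (n : ℕ) :
    Submodule R (P.complex.X n ⟶ Y) where
  carrier := {f | P.complex.d (n+1) n ≫ f = 0}
  add_mem' := by intro a b ha hb; simp_all
  zero_mem' := by simp
  smul_mem' := by intro r a ha; simp_all

lemma mem_zsub {X : ModuleCat.{u} R} {P : ProjectiveResolution X} {Y : ModuleCat.{u} R} {n : ℕ}
  {f} : f ∈ zsub P Y n ↔ P.complex.d (n+1) n ≫ f = 0 := Iff.rfl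

noncomputable def zExt {X : ModuleCat.{u} R} (P : ProjectiveResolution X) (Y : ModuleCat.{u} R)
    (n : ℕ) : zsub P Y n →ₗ[R] Abelian.Ext X Y n where
  toFun f := P.extMk f.1 (n+1) rfl (mem_zsub.1 f.2)
  map_add' f g := (P.add_extMk f.1 g.1 (n+1) rfl (mem_zsub.1 f.2) (mem_zsub.1 g.2)).symm
  map_smul' r f := (extMk_smul P f.1 (mem_zsub.1 f.2) r)

lemma zExt_apply {X : ModuleCat.{u} R} (P : ProjectiveResolution X) (Y : ModuleCat.{u} R)
    (n : ℕ) (f) : zExt P Y n f = P.extMk f.1 (n+1) rfl (mem_zsub.1 f.2) := rfl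

lemma zExt_surj {X : ModuleCat.{u} R} (P : ProjectiveResolution X) (Y : ModuleCat.{u} R)
    (n : ℕ) : Function.Surjective (zExt P Y n) := fun α => by
  obtain ⟨f, hf, h⟩ := P.extMk_surjective α (n+1) rfl
  exact ⟨⟨f, hf⟩, h⟩

lemma extMk_zero_iff {X : ModuleCat.{u} R} (P : ProjectiveResolution X) {Y : ModuleCat.{u} R}
    (f : P.complex.X 0 ⟶ Y) (hf : P.complex.d 1 0 ≫ f = 0) :
    P.extMk f 1 rfl hf = 0 ↔ f = 0 := by
  constructor
  · intro h
    rw [← P.extEquivCohomologyClass.apply_eq_iff_eq,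
      P.extEquivCohomologyClass_extMk, P.extEquivCohomologyClass_zero,
      CochainComplex.HomComplex.CohomologyClass.mk_eq_zero_iff,
      CochainComplex.HomComplex.Cocycle.toSingleMk_mem_coboundaries_iff _ _ _ _ _ (1) (by simp)] at h
    obtain ⟨g, hg⟩ := h
    have hz : Limits.IsZero (P.cochainComplex.X 1) :=
      P.cochainComplex.isZero_of_isStrictlyLE 0 1 (by lia)
    rw [hz.eq_of_src g 0, Limits.comp_zero] at hg
    rw [← cancel_epi (P.cochainComplexXIso (-(0:ℕ)) 0 rfl).hom, ← hg]; simp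
  · rintro rfl; simp

noncomputable def cycZ {X : ModuleCat.{u} R} (P : ProjectiveResolution X) (Y : ModuleCat.{u} R)
    (n : ℕ) : (P.complex.linearYonedaObj R Y).cycles n →ₗ[R] zsub P Y n :=
  LinearMap.codRestrict (zsub P Y n) (((P.complex.linearYonedaObj R Y).iCycles n).hom)
   (fun z => mem_zsub.2 (congrArg (fun f => f.hom z) ((P.complex.linearYonedaObj R Y).iCycles_d n (n+1)) :))

lemma cycZ_bij {X : ModuleCat.{u} R} (P : ProjectiveResolution X) (Y : ModuleCat.{u} R)
    (n : ℕ) : Function.Bijective (cycZ P Y n) := by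
  constructor
  · intro a b hab
    have h2 : ((P.complex.linearYonedaObj R Y).iCycles n).hom a
      = ((P.complex.linearYonedaObj R Y).iCycles n).hom b := congrArg Subtype.val hab
    exact (ModuleCat.mono_iff_injective _).1 (inferInstance : Mono ((P.complex.linearYonedaObj R Y).iCycles n)) h2
  · rintro ⟨f, hf⟩
    let k : ModuleCat.of R R ⟶ (P.complex.linearYonedaObj R Y).X n :=
      ModuleCat.ofHom (LinearMap.toSpanSingleton R (P.complex.X n ⟶ Y) f)
    have hk : k ≫ (P.complex.linearYonedaObj R Y).d n (n+1) = 0 := by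
      ext
      change P.complex.d (n+1) n ≫ ((1:R) • f) = 0
      rw [one_smul]; exact mem_zsub.1 hf
    refine ⟨((P.complex.linearYonedaObj R Y).liftCycles k (n+1) (by simp) hk) (1:R), ?_⟩
    apply Subtype.ext
    have := congrArg (fun g => g.hom (1:R)) ((P.complex.linearYonedaObj R Y).liftCycles_i k (n+1) (by simp) hk)
    refine this.trans ?_
    exact one_smul R f

lemma zExt_ker {X : ModuleCat.{u} R} (P : ProjectiveResolution X) (Y : ModuleCat.{u} R)
    (n : ℕ) (z : (P.complex.linearYonedaObj R Y).cycles n) : zExt P Y n (cycZ P Y n z) = 0 ↔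
      (P.complex.linearYonedaObj R Y).homologyπ n z = 0 := by
  have hex : ∀ m, (ComplexShape.up ℕ).prev n = m → ((P.complex.linearYonedaObj R Y).homologyπ n z = 0 ↔
      ∃ w, (P.complex.linearYonedaObj R Y).toCycles m n w = z) := by
    intro m hm
    have hex : (ShortComplex.mk ((P.complex.linearYonedaObj R Y).toCycles m n) ((P.complex.linearYonedaObj R Y).homologyπ n) (by simp)).Exact :=
      ShortComplex.exact_of_g_is_cokernel _ ((P.complex.linearYonedaObj R Y).homologyIsCokernel _ n hm)
    rw [ShortComplex.moduleCat_exact_iff] at hex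
    refine ⟨hex z, ?_⟩
    rintro ⟨w, rfl⟩
    exact congrArg (fun f => f.hom w) ((P.complex.linearYonedaObj R Y).toCycles_comp_homologyπ m n)
  have hk : ∀ m (g : P.complex.X m ⟶ Y), ((cycZ P Y n ((P.complex.linearYonedaObj R Y).toCycles m n g)).1 : P.complex.X n ⟶ Y) = P.complex.d n m ≫ g :=
    fun m g => congrArg (fun f => f.hom g) ((P.complex.linearYonedaObj R Y).toCycles_i m n)
  rcases n with _ | n
  · rw [hex 0 (by simp), zExt_apply, extMk_zero_iff]
    constructor
    · intro h
      refine ⟨0, ?_⟩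
      rw [map_zero]
      apply (cycZ_bij P Y 0).1
      rw [map_zero]; exact Subtype.ext h.symm
    · rintro ⟨w, rfl⟩
      exact (hk 0 w).trans (by rw [P.complex.shape 0 0 (by simp)]; exact Limits.zero_comp)
  · rw [hex n (by simp), zExt_apply, P.extMk_eq_zero_iff _ _ _ _ n rfl]
    constructor
    · rintro ⟨g, hg⟩
      refine ⟨g, ?_⟩
      apply (cycZ_bij P Y (n+1)).1
      apply Subtype.ext
      rw [hk, hg]
    · rintro ⟨w, rfl⟩
      exact ⟨w, (hk n w).symm⟩

lemma homologyπ_surj {X : ModuleCat.{u} R} (P : ProjectiveResolution X) (Y : ModuleCat.{u} R)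
    (n : ℕ) : Function.Surjective ((P.complex.linearYonedaObj R Y).homologyπ n) :=
  (ModuleCat.epi_iff_surjective _).1 inferInstance

lemma exists_homExt {X : ModuleCat.{u} R} (P : ProjectiveResolution X) (Y : ModuleCat.{u} R)
    (n : ℕ) : ∃ e : (P.complex.linearYonedaObj R Y).homology n ≃ₗ[R] Abelian.Ext X Y n,
    ∀ z, e ((P.complex.linearYonedaObj R Y).homologyπ n z) = zExt P Y n (cycZ P Y n z) := by
  have hle : LinearMap.ker ((P.complex.linearYonedaObj R Y).homologyπ n).hom ≤
     LinearMap.ker (zExt P Y n ∘ₗ cycZ P Y n) := fun z hz => (zExt_ker P Y n z).2 hz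
  let e1 := LinearMap.quotKerEquivOfSurjective ((P.complex.linearYonedaObj R Y).homologyπ n).hom (homologyπ_surj P Y n)
  have hs : Function.Surjective (zExt P Y n ∘ₗ cycZ P Y n) := (zExt_surj P Y n).comp (cycZ_bij P Y n).2
  let e2 := LinearMap.quotKerEquivOfSurjective (zExt P Y n ∘ₗ cycZ P Y n) hs
  have hk : LinearMap.ker ((P.complex.linearYonedaObj R Y).homologyπ n).hom =
     LinearMap.ker (zExt P Y n ∘ₗ cycZ P Y n) := by ext z; exact (zExt_ker P Y n z).symm
  refine ⟨e1.symm ≪≫ₗ Submodule.quotEquivOfEq _ _ hk ≪≫ₗ e2, ?_⟩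
  intro z
  have : e1.symm (((P.complex.linearYonedaObj R Y).homologyπ n).hom z) = Submodule.Quotient.mk z := by
    rw [LinearEquiv.symm_apply_eq]; rfl
  change e2 (Submodule.quotEquivOfEq _ _ hk (e1.symm (((P.complex.linearYonedaObj R Y).homologyπ n).hom z))) = _
  rw [this]; rfl

end CLC

namespace CLC
variable {R : Type u} [CommRing R]

lemma homologyUnop_nat {V : Type*} [Category V] [Abelian V] {ι : Type*} {c : ComplexShape ι}
    {K L : HomologicalComplex Vᵒᵖ c} (φ : K ⟶ L) (i : ι) :
    (HomologicalComplex.homologyUnop L i).inv ≫ HomologicalComplex.homologyMap ((HomologicalComplex.unopFunctor _ _).map φ.op) i =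
     (HomologicalComplex.homologyMap φ i).unop ≫ (HomologicalComplex.homologyUnop K i).inv := by
  have h2 := HomologicalComplex.homologyOp_hom_naturality ((HomologicalComplex.unopFunctor _ _).map φ.op) i
  have h3 : (HomologicalComplex.homologyUnop L i).hom ≫ (HomologicalComplex.homologyMap φ i).unop =
      HomologicalComplex.homologyMap ((HomologicalComplex.unopFunctor _ _).map φ.op) i ≫
       (HomologicalComplex.homologyUnop K i).hom := congrArg Quiver.Hom.unop h2
  exact (Iso.inv_comp_eq _).2 (((Iso.comp_inv_eq _).2 h3).symm.trans (Category.assoc _ _ _))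

noncomputable def lyMap {X X' : ModuleCat.{u} R} {P : ProjectiveResolution X}
    {P' : ProjectiveResolution X'} (φ : P'.complex ⟶ P.complex) (Y : ModuleCat.{u} R) :
    P.complex.linearYonedaObj R Y ⟶ P'.complex.linearYonedaObj R Y :=
  (HomologicalComplex.unopFunctor _ _).map
    ((((linearYoneda R (ModuleCat.{u} R)).obj Y).rightOp.mapHomologicalComplex _).map φ).op

lemma isoExt_nat {X X' : ModuleCat.{u} R} (g : X' ⟶ X) (P : ProjectiveResolution X)
    (P' : ProjectiveResolution X') (φ : P'.complex ⟶ P.complex)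
    (comm : φ.f 0 ≫ P.π.f 0 = P'.π.f 0 ≫ g) (Y : ModuleCat.{u} R) (n : ℕ) :
    ((Ext R (ModuleCat.{u} R) n).map g.op).app Y ≫ (P'.isoExt n Y).hom =
     (P.isoExt n Y).hom ≫ HomologicalComplex.homologyMap (lyMap φ Y) n := by
  have h1 := ProjectiveResolution.isoLeftDerivedObj_inv_naturality g P' P φ comm
    ((linearYoneda R (ModuleCat.{u} R)).obj Y).rightOp n
  have h1' := congrArg Quiver.Hom.unop h1
  rw [unop_comp, unop_comp] at h1'
  have h2 := homologyUnop_nat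
    ((((linearYoneda R (ModuleCat.{u} R)).obj Y).rightOp.mapHomologicalComplex _).map φ) n
  refine Eq.trans ?_ (congrArg (fun t => (P.isoLeftDerivedObj ((linearYoneda R (ModuleCat.{u} R)).obj Y).rightOp n).inv.unop ≫ t) h2.symm)
  refine Eq.trans (Category.assoc _ _ _).symm (Eq.trans ?_ (Category.assoc _ _ _))
  exact congrArg (fun t => t ≫ (HomologicalComplex.homologyUnop _ n).inv) h1'

lemma exists_extEquiv (X Y : ModuleCat.{u} R) (n : ℕ) :
    Nonempty (((Ext R (ModuleCat.{u} R) n).obj (Opposite.op X)).obj Y ≃ₗ[R] Abelian.Ext X Y n) := by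
  obtain ⟨P⟩ := (inferInstance : HasProjectiveResolution X)
  obtain ⟨P⟩ := P
  obtain ⟨e, _⟩ := exists_homExt P Y n
  exact ⟨(P.isoExt n Y).toLinearEquiv ≪≫ₗ e⟩

lemma exists_extEquiv_nat (Y : ModuleCat.{u} R) (n : ℕ) :
    ∃ e : ∀ X : ModuleCat.{u} R,
      ((Ext R (ModuleCat.{u} R) n).obj (Opposite.op X)).obj Y ≃ₗ[R] Abelian.Ext X Y n,
    ∀ (X X' : ModuleCat.{u} R) (g : X' ⟶ X) (z),
      e X' (((Ext R (ModuleCat.{u} R) n).map g.op).app Y z) =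
        (Abelian.Ext.mk₀ g).comp (e X z) (zero_add n) := by
  choose e he using fun X : ModuleCat.{u} R => exists_homExt (projectiveResolution X) Y n
  refine ⟨fun X => ((projectiveResolution X).isoExt n Y).toLinearEquiv ≪≫ₗ e X, ?_⟩
  intro X X' g z
  let P := projectiveResolution X
  let P' := projectiveResolution X'
  let φ := ProjectiveResolution.lift g P' P
  have hφ := ProjectiveResolution.lift_commutes g P' P
  have hφ0 := ProjectiveResolution.lift_commutes_zero g P' P
  have h1 := congrArg (fun f => f.hom z) (isoExt_nat g P P' φ hφ0 Y n)
  obtain ⟨w, hw⟩ := homologyπ_surj P Y n ((P.isoExt n Y).hom z)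
  have h2 : (HomologicalComplex.homologyMap (lyMap φ Y) n) ((P.isoExt n Y).hom z) =
     (P'.complex.linearYonedaObj R Y).homologyπ n (HomologicalComplex.cyclesMap (lyMap φ Y) n w) := by
    rw [← hw]
    exact congrArg (fun f => f.hom w) (HomologicalComplex.homologyπ_naturality (lyMap φ Y) n)
  change e X' ((P'.isoExt n Y).hom _) = (Abelian.Ext.mk₀ g).comp (e X ((P.isoExt n Y).hom z)) _
  refine (congrArg (e X') (h1.trans h2)).trans ?_
  refine (he X' _).trans ?_
  rw [← hw]
  refine Eq.trans ?_ (congrArg (fun t => (Abelian.Ext.mk₀ g).comp t (zero_add n)) (he X w).symm)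
  rw [zExt_apply, zExt_apply, P.mk₀_comp_extMk _ _ _ _ ⟨φ, hφ0⟩]
  congr 1
  exact congrArg (fun f => f.hom w) (HomologicalComplex.cyclesMap_i (lyMap φ Y) n)
end CLC

set_option linter.all false
namespace CLC
section
variable (R : Type u) [CommRing R]

/-- Ext modules. -/
def EX (X M : Type u) [AddCommGroup X] [Module R X] [AddCommGroup M] [Module R M] (i : ℕ) :
    Type u := Abelian.Ext (ModuleCat.of R X) (ModuleCat.of R M) i

variable (X X' X'' M N L : Type u) [AddCommGroup X] [Module R X] [AddCommGroup M] [Module R M]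
   [AddCommGroup X'] [Module R X'] [AddCommGroup X''] [Module R X''] [AddCommGroup N] [Module R N]
   [AddCommGroup L] [Module R L] (i : ℕ)

noncomputable instance : AddCommGroup (EX R X M i) :=
  inferInstanceAs (AddCommGroup (Abelian.Ext (ModuleCat.of R X) (ModuleCat.of R M) i))
noncomputable instance : Module R (EX R X M i) :=
  inferInstanceAs (Module R (Abelian.Ext (ModuleCat.of R X) (ModuleCat.of R M) i))
end
namespace EX
variable {R : Type u} [CommRing R]
variable {X X' X'' M N L : Type u} [AddCommGroup X] [Module R X] [AddCommGroup M] [Module R M]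
   [AddCommGroup X'] [Module R X'] [AddCommGroup X''] [Module R X''] [AddCommGroup N] [Module R N]
   [AddCommGroup L] [Module R L]

lemma finite [IsNoetherianRing R] [Module.Finite R X] [Module.Finite R M] (i : ℕ) :
    Module.Finite R (EX R X M i) :=
  inferInstanceAs (Module.Finite R (Abelian.Ext (ModuleCat.of R X) (ModuleCat.of R M) i))

/-- functoriality in the second variable -/
noncomputable def map (X : Type u) [AddCommGroup X] [Module R X] (i : ℕ) (f : M →ₗ[R] N) :
    EX R X M i →ₗ[R] EX R X N i where
  toFun x := Abelian.Ext.comp x (Abelian.Ext.mk₀ (ModuleCat.ofHom f)) (add_zero i)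
  map_add' x y := Abelian.Ext.add_comp _ _ _ _
  map_smul' r x := Abelian.Ext.smul_comp _ _ _ _

/-- functoriality in the first variable -/
noncomputable def pre (M : Type u) [AddCommGroup M] [Module R M] (i : ℕ) (g : X' →ₗ[R] X) :
    EX R X M i →ₗ[R] EX R X' M i where
  toFun x := (Abelian.Ext.mk₀ (ModuleCat.ofHom g)).comp x (zero_add i)
  map_add' x y := Abelian.Ext.comp_add _ _ _ _
  map_smul' r x := Abelian.Ext.comp_smul _ _ _ _

lemma map_id (i : ℕ) (x : EX R X M i) : map X i (LinearMap.id : M →ₗ[R] M) x = x :=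
  Abelian.Ext.comp_mk₀_id _

lemma map_comp (i : ℕ) (f : M →ₗ[R] N) (g : N →ₗ[R] L) (x : EX R X M i) :
    map X i (g ∘ₗ f) x = map X i g (map X i f x) := by
  change Abelian.Ext.comp x (Abelian.Ext.mk₀ (ModuleCat.ofHom f ≫ ModuleCat.ofHom g)) (add_zero i) =
    Abelian.Ext.comp (Abelian.Ext.comp x _ (add_zero i)) _ (add_zero i)
  rw [← Abelian.Ext.mk₀_comp_mk₀]
  exact (Abelian.Ext.comp_assoc _ _ _ _ _ (by simp)).symm

lemma pre_id (i : ℕ) (x : EX R X M i) : pre M i (LinearMap.id : X →ₗ[R] X) x = x :=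
  Abelian.Ext.mk₀_id_comp _

lemma pre_comp (i : ℕ) (f : X'' →ₗ[R] X') (g : X' →ₗ[R] X) (x : EX R X M i) :
    pre M i (g ∘ₗ f) x = pre M i f (pre M i g x) := by
  change (Abelian.Ext.mk₀ (ModuleCat.ofHom f ≫ ModuleCat.ofHom g)).comp x (zero_add i) =
    (Abelian.Ext.mk₀ _).comp ((Abelian.Ext.mk₀ _).comp x (zero_add i)) (zero_add i)
  rw [← Abelian.Ext.mk₀_comp_mk₀]
  exact (Abelian.Ext.comp_assoc _ _ _ _ _ (by simp))

lemma map_pre (i : ℕ) (f : M →ₗ[R] N) (g : X' →ₗ[R] X) (x : EX R X M i) :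
    map X' i f (pre M i g x) = pre N i g (map X i f x) := by
  exact Abelian.Ext.comp_assoc (Abelian.Ext.mk₀ _) x (Abelian.Ext.mk₀ _) (zero_add i) (add_zero i) (by simp)

lemma map_add (i : ℕ) (f g : M →ₗ[R] N) (x : EX R X M i) :
    map X i (f + g) x = map X i f x + map X i g x := by
  change Abelian.Ext.comp x (Abelian.Ext.mk₀ (ModuleCat.ofHom f + ModuleCat.ofHom g)) (add_zero i) = _
  rw [Abelian.Ext.mk₀_add]; exact Abelian.Ext.comp_add _ _ _ _

lemma map_smul (i : ℕ) (r : R) (f : M →ₗ[R] N) (x : EX R X M i) :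
    map X i (r • f) x = r • map X i f x := by
  change Abelian.Ext.comp x (Abelian.Ext.mk₀ (r • ModuleCat.ofHom f)) (add_zero i) = _
  rw [Abelian.Ext.mk₀_smul]; exact Abelian.Ext.comp_smul _ _ _ _

lemma pre_add (i : ℕ) (f g : X' →ₗ[R] X) (x : EX R X M i) :
    pre M i (f + g) x = pre M i f x + pre M i g x := by
  change (Abelian.Ext.mk₀ (ModuleCat.ofHom f + ModuleCat.ofHom g)).comp x (zero_add i) = _
  rw [Abelian.Ext.mk₀_add]; exact Abelian.Ext.add_comp _ _ _ _

lemma pre_smul (i : ℕ) (r : R) (f : X' →ₗ[R] X) (x : EX R X M i) :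
    pre M i (r • f) x = r • pre M i f x := by
  change (Abelian.Ext.mk₀ (r • ModuleCat.ofHom f)).comp x (zero_add i) = _
  rw [Abelian.Ext.mk₀_smul]; exact Abelian.Ext.smul_comp _ _ _ _

lemma map_zero (i : ℕ) (x : EX R X M i) : map X i (0 : M →ₗ[R] N) x = 0 := by
  have := map_smul i (0 : R) (0 : M →ₗ[R] N) x
  rwa [zero_smul, zero_smul] at this

lemma pre_zero (i : ℕ) (x : EX R X M i) : pre M i (0 : X' →ₗ[R] X) x = 0 := by
  have := pre_smul i (0 : R) (0 : X' →ₗ[R] X) x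
  rwa [zero_smul, zero_smul] at this

/-- Ext^0 = Hom -/
noncomputable def hom₀ (X M : Type u) [AddCommGroup X] [Module R X] [AddCommGroup M] [Module R M] :
    EX R X M 0 ≃ₗ[R] (X →ₗ[R] M) :=
  (Abelian.Ext.linearEquiv₀ (R := R) (X := ModuleCat.of R X) (Y := ModuleCat.of R M)) ≪≫ₗ
    ModuleCat.homLinearEquiv

lemma hom₀_symm (f : X →ₗ[R] M) : (hom₀ X M).symm f = Abelian.Ext.mk₀ (ModuleCat.ofHom f) := rfl

lemma hom₀_map (f : M →ₗ[R] N) (x : EX R X M 0) : hom₀ X N (map X 0 f x) = f ∘ₗ hom₀ X M x := by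
  obtain ⟨y, rfl⟩ := (hom₀ X M).symm.surjective x
  rw [← (hom₀ X N).eq_symm_apply, LinearEquiv.apply_symm_apply, hom₀_symm, hom₀_symm]
  exact Abelian.Ext.mk₀_comp_mk₀ _ _

lemma hom₀_pre (g : X' →ₗ[R] X) (x : EX R X M 0) : hom₀ X' M (pre M 0 g x) = hom₀ X M x ∘ₗ g := by
  obtain ⟨y, rfl⟩ := (hom₀ X M).symm.surjective x
  rw [← (hom₀ X' M).eq_symm_apply, LinearEquiv.apply_symm_apply, hom₀_symm, hom₀_symm]
  exact Abelian.Ext.mk₀_comp_mk₀ _ _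

lemma subsingleton_inj [Module.Injective R M] (i : ℕ) : Subsingleton (EX R X M (i+1)) := by
  have : Injective (ModuleCat.of R M) := (Module.injective_iff_injective_object R M).1 inferInstance
  exact Abelian.Ext.subsingleton_of_injective _ _ _

lemma subsingleton_proj [Module.Projective R X] (i : ℕ) : Subsingleton (EX R X M (i+1)) := by
  have : Projective (ModuleCat.of R X) := (IsProjective.iff_projective X).1 inferInstance
  exact ⟨fun x y => (Abelian.Ext.eq_zero_of_projective x).trans (Abelian.Ext.eq_zero_of_projective y).symm⟩

lemma shortExact {f : M →ₗ[R] N} {g : N →ₗ[R] L} (hf : Function.Injective f)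
    (hg : Function.Surjective g) (h : Function.Exact f g) :
    ∃ w, (ShortComplex.mk (ModuleCat.ofHom f) (ModuleCat.ofHom g) w).ShortExact := by
  refine ⟨by ext x; exact h.apply_apply_eq_zero x, ?_⟩
  have := (ModuleCat.mono_iff_injective (ModuleCat.ofHom f)).2 hf
  have := (ModuleCat.epi_iff_surjective (ModuleCat.ofHom g)).2 hg
  refine ⟨?_⟩
  · rw [ShortComplex.ShortExact.moduleCat_exact_iff_function_exact]; exact h

/-- covariant LES, natural in `X` -/
lemma les {f : M →ₗ[R] N} {g : N →ₗ[R] L} (hf : Function.Injective f)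
    (hg : Function.Surjective g) (h : Function.Exact f g) :
    ∃ δ : ∀ (X : Type u) [AddCommGroup X] [Module R X] (i : ℕ),
      EX R X L i →ₗ[R] EX R X M (i+1),
      (∀ (X X' : Type u) [AddCommGroup X] [Module R X] [AddCommGroup X'] [Module R X'] (i : ℕ)
        (k : X' →ₗ[R] X) (x : EX R X L i), δ X' i (pre L i k x) = pre M (i+1) k (δ X i x)) ∧
      ∀ (X : Type u) [AddCommGroup X] [Module R X] (i : ℕ),
        Function.Exact (map X i f) (map X i g) ∧ Function.Exact (map X i g) (δ X i) ∧
        Function.Exact (δ X i) (map X (i+1) f) := by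
  obtain ⟨w, hS⟩ := shortExact hf hg h
  refine ⟨fun X _ _ i => 
   { toFun x := Abelian.Ext.comp x hS.extClass rfl
     map_add' x y := Abelian.Ext.add_comp _ _ _ _
     map_smul' r x := Abelian.Ext.smul_comp _ _ _ _ }, ?_, ?_⟩
  · intro X X' _ _ _ _ i k x
    exact Abelian.Ext.comp_assoc (Abelian.Ext.mk₀ _) x hS.extClass (zero_add i) rfl (by simp)
  · intro X _ _ i
    refine ⟨fun y => ⟨fun hy => ?_, ?_⟩, fun y => ⟨fun hy => ?_, ?_⟩, fun y => ⟨fun hy => ?_, ?_⟩⟩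
    · exact Abelian.Ext.covariant_sequence_exact₂ _ hS y hy
    · rintro ⟨x, rfl⟩
      rw [← map_comp, show g ∘ₗ f = 0 by ext x; exact h.apply_apply_eq_zero x, map_zero]
    · exact Abelian.Ext.covariant_sequence_exact₃ _ hS y rfl hy
    · rintro ⟨x, rfl⟩
      refine (Abelian.Ext.comp_assoc_of_second_deg_zero x (Abelian.Ext.mk₀ (ModuleCat.ofHom g))
        hS.extClass rfl).trans ?_
      exact (congrArg (fun t => Abelian.Ext.comp x t rfl) hS.comp_extClass).trans
        (Abelian.Ext.comp_zero _ _ _ _ _)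
    · exact Abelian.Ext.covariant_sequence_exact₁ _ hS y hy rfl
    · rintro ⟨x, rfl⟩
      refine (Abelian.Ext.comp_assoc_of_third_deg_zero x hS.extClass
        (Abelian.Ext.mk₀ (ModuleCat.ofHom f)) rfl).trans ?_
      exact (congrArg (fun t => Abelian.Ext.comp x t rfl) hS.extClass_comp).trans
        (Abelian.Ext.comp_zero _ _ _ _ _)

/-- contravariant LES -/
lemma les' {f : X →ₗ[R] X'} {g : X' →ₗ[R] X''} (hf : Function.Injective f)
    (hg : Function.Surjective g) (h : Function.Exact f g) (M : Type u) [AddCommGroup M] [Module R M]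
    (i : ℕ) : ∃ δ : EX R X M i →ₗ[R] EX R X'' M (i+1),
        Function.Exact (pre M i g) (pre M i f) ∧ Function.Exact (pre M i f) δ ∧
        Function.Exact δ (pre M (i+1) g) := by
  obtain ⟨w, hS⟩ := shortExact hf hg h
  refine ⟨{ toFun x := hS.extClass.comp x (add_comm 1 i)
            map_add' x y := Abelian.Ext.comp_add _ _ _ _
            map_smul' r x := Abelian.Ext.comp_smul _ _ _ _ }, ?_⟩
  refine ⟨fun y => ⟨fun hy => ?_, ?_⟩, fun y => ⟨fun hy => ?_, ?_⟩, fun y => ⟨fun hy => ?_, ?_⟩⟩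
  · exact Abelian.Ext.contravariant_sequence_exact₂ hS _ y hy
  · rintro ⟨x, rfl⟩
    rw [← pre_comp, show g ∘ₗ f = 0 by ext x; exact h.apply_apply_eq_zero x, pre_zero]
  · exact Abelian.Ext.contravariant_sequence_exact₁ hS _ y (add_comm 1 i) hy
  · rintro ⟨x, rfl⟩
    exact ShortComplex.ShortExact.extClass_comp_assoc hS x (h := add_comm 1 i)
  · exact Abelian.Ext.contravariant_sequence_exact₃ hS _ y hy (add_comm 1 i)
  · rintro ⟨x, rfl⟩
    exact ShortComplex.ShortExact.comp_extClass_assoc hS x (add_comm 1 i)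
end EX
end CLC

set_option linter.all false
namespace CLC
section
variable {R : Type u} [CommRing R]

/-- transition map `R/I^m → R/I^n` -/
def qq (I : Ideal R) (n m : ℕ) (h : n ≤ m) : (R ⧸ I ^ m) →ₗ[R] (R ⧸ I ^ n) :=
  Submodule.mapQ _ _ LinearMap.id (Ideal.pow_le_pow_right h)

lemma qq_mk (I : Ideal R) (n m : ℕ) (h : n ≤ m) (r : R) :
   qq I n m h (Ideal.Quotient.mk _ r) = Ideal.Quotient.mk _ r := rfl

lemma qq_id (I : Ideal R) (n : ℕ) (h : n ≤ n) : qq I n n h = LinearMap.id := by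
  ext; rfl

lemma qq_comp (I : Ideal R) (n m k : ℕ) (h : n ≤ m) (h' : m ≤ k) :
    qq I n m h ∘ₗ qq I m k h' = qq I n k (h.trans h') := by
  ext; rfl

instance (I : Ideal R) (M : Type u) [AddCommGroup M] [Module R M] (i : ℕ) :
    DirectedSystem (fun n : ℕ => EX R (R ⧸ I ^ n) M i) (fun n m h => EX.pre M i (qq I n m h)) where
  map_self := by intro n x; rw [qq_id, EX.pre_id]
  map_map := by intro n m k h h' x; rw [← EX.pre_comp, qq_comp]

/-- local cohomology -/
def LC (I : Ideal R) (i : ℕ) (M : Type u) [AddCommGroup M] [Module R M] : Type u :=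
  Module.DirectLimit (fun n : ℕ => EX R (R ⧸ I ^ n) M i) (fun n m h => EX.pre M i (qq I n m h))

variable (I : Ideal R) (i : ℕ) {M N L : Type u} [AddCommGroup M] [Module R M]
   [AddCommGroup N] [Module R N] [AddCommGroup L] [Module R L]

noncomputable instance : AddCommGroup (LC I i M) := 
  inferInstanceAs (AddCommGroup (Module.DirectLimit (fun n : ℕ => EX R (R ⧸ I ^ n) M i) (fun n m h => EX.pre M i (qq I n m h))))
noncomputable instance : Module R (LC I i M) := 
  inferInstanceAs (Module R (Module.DirectLimit (fun n : ℕ => EX R (R ⧸ I ^ n) M i) (fun n m h => EX.pre M i (qq I n m h))))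

namespace LC

noncomputable def of (M : Type u) [AddCommGroup M] [Module R M] (n : ℕ) :
    EX R (R ⧸ I ^ n) M i →ₗ[R] LC I i M := 
  Module.DirectLimit.of R ℕ (fun n : ℕ => EX R (R ⧸ I ^ n) M i) (fun n m h => EX.pre M i (qq I n m h)) n

variable {I i}
lemma of_pre {n m : ℕ} (h : n ≤ m) (x) : of I i M m (EX.pre M i (qq I n m h) x) = of I i M n x :=
  Module.DirectLimit.of_f (R := R) (ι := ℕ) (G := fun n : ℕ => EX R (R ⧸ I ^ n) M i) (f := fun n m h => EX.pre M i (qq I n m h))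

lemma exists_of (z : LC I i M) : ∃ n x, of I i M n x = z := Module.DirectLimit.exists_of z

lemma of_eq_zero {n : ℕ} {x} (h : of I i M n x = 0) : ∃ m, ∃ h : n ≤ m, EX.pre M i (qq I n m h) x = 0 := by
  obtain ⟨m, h, h'⟩ := Module.DirectLimit.of.zero_exact (R := R) (ι := ℕ) (G := fun n : ℕ => EX R (R ⧸ I ^ n) M i) (f := fun n m h => EX.pre M i (qq I n m h)) h
  exact ⟨m, h, h'⟩

lemma exists_lift {P : Type u} [AddCommGroup P] [Module R P]
    (g : ∀ n, EX R (R ⧸ I ^ n) M i →ₗ[R] P)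
    (Hg : ∀ n m h x, g m (EX.pre M i (qq I n m h) x) = g n x) :
    ∃ F : LC I i M →ₗ[R] P, ∀ n x, F (of I i M n x) = g n x :=
  ⟨Module.DirectLimit.lift R ℕ (fun n : ℕ => EX R (R ⧸ I ^ n) M i) (fun n m h => EX.pre M i (qq I n m h)) g Hg, fun n x => Module.DirectLimit.lift_of _ _ _⟩

variable (I i)
noncomputable def map (f : M →ₗ[R] N) : LC I i M →ₗ[R] LC I i N :=
  (exists_lift (fun n => of I i N n ∘ₗ EX.map _ i f) (fun n m h x => by
    simp only [LinearMap.comp_apply]; rw [EX.map_pre, of_pre])).choose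

variable {I i}
lemma map_of (f : M →ₗ[R] N) (n x) : map I i f (of I i M n x) = of I i N n (EX.map _ i f x) :=
  (exists_lift (fun n => of I i N n ∘ₗ EX.map _ i f) (fun n m h x => by
    simp only [LinearMap.comp_apply]; rw [EX.map_pre, of_pre])).choose_spec n x

lemma map_id (x : LC I i M) : map I i (LinearMap.id : M →ₗ[R] M) x = x := by
  obtain ⟨n, x, rfl⟩ := exists_of x
  rw [map_of, EX.map_id]
lemma map_comp (f : M →ₗ[R] N) (g : N →ₗ[R] L) (x : LC I i M) :
    map I i (g ∘ₗ f) x = map I i g (map I i f x) := by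
  obtain ⟨n, x, rfl⟩ := exists_of x
  rw [map_of, EX.map_comp, map_of, map_of]
lemma map_add (f g : M →ₗ[R] N) (x : LC I i M) : map I i (f + g) x = map I i f x + map I i g x := by
  obtain ⟨n, x, rfl⟩ := exists_of x
  rw [map_of, map_of, map_of, EX.map_add, _root_.map_add]
lemma map_smul (r : R) (f : M →ₗ[R] N) (x : LC I i M) : map I i (r • f) x = r • map I i f x := by
  obtain ⟨n, x, rfl⟩ := exists_of x
  rw [map_of, map_of, EX.map_smul, _root_.map_smul]
lemma map_zero (x : LC I i M) : map I i (0 : M →ₗ[R] N) x = 0 := by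
  obtain ⟨n, x, rfl⟩ := exists_of x
  rw [map_of, EX.map_zero, _root_.map_zero]

lemma les {f : M →ₗ[R] N} {g : N →ₗ[R] L} (hf : Function.Injective f)
    (hg : Function.Surjective g) (h : Function.Exact f g) (I : Ideal R) (i : ℕ) :
    ∃ δ : LC I i L →ₗ[R] LC I (i+1) M,
        Function.Exact (map I i f) (map I i g) ∧ Function.Exact (map I i g) δ ∧
        Function.Exact δ (map I (i+1) f) := by
  obtain ⟨d, hd, hex⟩ := EX.les hf hg h
  obtain ⟨δ, hδ⟩ := exists_lift (I := I) (i := i) (M := L) 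
    (fun n => of I (i+1) M n ∘ₗ d (R ⧸ I ^ n) i) (by
      intro n m h x
      simp only [LinearMap.comp_apply]; rw [hd, of_pre])
  simp only [LinearMap.comp_apply] at hδ
  refine ⟨δ, fun y => ?_, fun y => ?_, fun y => ?_⟩
  · constructor
    · intro hy
      obtain ⟨n, y, rfl⟩ := exists_of y
      rw [map_of] at hy
      obtain ⟨m, hm, hy⟩ := of_eq_zero hy
      rw [← EX.map_pre] at hy
      obtain ⟨x, hx⟩ := ((hex _ i).1 _).1 hy
      refine ⟨of I i M m x, ?_⟩
      rw [map_of, hx, of_pre]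
    · rintro ⟨x, rfl⟩
      rw [← map_comp, show g ∘ₗ f = 0 by ext x; exact h.apply_apply_eq_zero x, map_zero]
  · constructor
    · intro hy
      obtain ⟨n, y, rfl⟩ := exists_of y
      rw [hδ] at hy
      obtain ⟨m, hm, hy⟩ := of_eq_zero hy
      rw [← hd] at hy
      obtain ⟨x, hx⟩ := ((hex _ i).2.1 _).1 hy
      refine ⟨of I i N m x, ?_⟩
      rw [map_of, hx, of_pre]
    · rintro ⟨x, rfl⟩
      obtain ⟨n, x, rfl⟩ := exists_of x
      rw [map_of, hδ, (hex _ i).2.1.apply_apply_eq_zero, _root_.map_zero]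
  · constructor
    · intro hy
      obtain ⟨n, y, rfl⟩ := exists_of y
      rw [map_of] at hy
      obtain ⟨m, hm, hy⟩ := of_eq_zero hy
      rw [← EX.map_pre] at hy
      obtain ⟨x, hx⟩ := ((hex _ i).2.2 _).1 hy
      refine ⟨of I i L m x, ?_⟩
      rw [hδ, hx, of_pre]
    · rintro ⟨x, rfl⟩
      obtain ⟨n, x, rfl⟩ := exists_of x
      rw [hδ, map_of, (hex _ i).2.2.apply_apply_eq_zero, _root_.map_zero]

lemma subsingleton_inj (I : Ideal R) [Module.Injective R M] (i : ℕ) : Subsingleton (LC I (i+1) M) := by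
  refine subsingleton_of_forall_eq 0 fun z => ?_
  obtain ⟨n, x, rfl⟩ := exists_of z
  have := EX.subsingleton_inj (R := R) (X := R ⧸ I ^ n) (M := M) i
  rw [Subsingleton.elim x 0, _root_.map_zero]
end LC

/-- I-torsion submodule -/
def Gam (I : Ideal R) (M : Type u) [AddCommGroup M] [Module R M] : Submodule R M where
  carrier := {x | ∃ n : ℕ, ∀ a ∈ I ^ n, a • x = 0}
  zero_mem' := ⟨0, by simp⟩
  add_mem' := by
    rintro x y ⟨n, hn⟩ ⟨m, hm⟩
    refine ⟨max n m, fun a ha => ?_⟩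
    rw [smul_add, hn a (Ideal.pow_le_pow_right (le_max_left _ _) ha),
      hm a (Ideal.pow_le_pow_right (le_max_right _ _) ha), add_zero]
  smul_mem' := by
    rintro r x ⟨n, hn⟩
    exact ⟨n, fun a ha => by rw [smul_comm, hn a ha, smul_zero]⟩

lemma mem_Gam {I : Ideal R} {x : M} : x ∈ Gam I M ↔ ∃ n : ℕ, ∀ a ∈ I ^ n, a • x = 0 := Iff.rfl

namespace LC
lemma exists_zero (I : Ideal R) (M : Type u) [AddCommGroup M] [Module R M] :
    ∃ e : LC I 0 M →ₗ[R] M, ∀ n x, e (of I 0 M n x) = EX.hom₀ _ M x 1 := by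
  refine exists_lift (fun n => LinearMap.applyₗ (1 : R ⧸ I ^ n) ∘ₗ (EX.hom₀ (R ⧸ I ^ n) M).toLinearMap) ?_
  intro n m h x
  simp only [LinearMap.comp_apply, LinearEquiv.coe_coe, LinearMap.applyₗ_apply_apply]
  rw [EX.hom₀_pre]; rfl

noncomputable def ez (I : Ideal R) (M : Type u) [AddCommGroup M] [Module R M] : LC I 0 M →ₗ[R] M :=
  (exists_zero I M).choose
lemma ez_of (n x) : ez I M (of I 0 M n x) = EX.hom₀ _ M x 1 := (exists_zero I M).choose_spec n x

lemma ez_map (f : M →ₗ[R] N) (x) : ez I N (map I 0 f x) = f (ez I M x) := by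
  obtain ⟨n, x, rfl⟩ := exists_of x
  rw [map_of, ez_of, ez_of, EX.hom₀_map]; rfl

lemma ez_inj : Function.Injective (ez I M) := by
  rw [injective_iff_map_eq_zero]
  intro z hz
  obtain ⟨n, x, rfl⟩ := exists_of z
  rw [ez_of] at hz
  have : EX.hom₀ _ M x = 0 := by
    ext; simpa using hz
  rw [LinearEquiv.map_eq_zero_iff] at this
  rw [this, _root_.map_zero]

lemma ez_range : LinearMap.range (ez I M) = Gam I M := by
  ext y
  constructor
  · rintro ⟨z, rfl⟩
    obtain ⟨n, x, rfl⟩ := exists_of z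
    rw [ez_of]
    refine ⟨n, fun a ha => ?_⟩
    rw [← _root_.map_smul]
    have : a • (1 : R ⧸ I ^ n) = 0 := by
      refine (Submodule.Quotient.mk_eq_zero (I ^ n) (x := a • (1 : R))).2 ?_
      simpa using ha
    rw [this, _root_.map_zero]
  · rintro ⟨n, hn⟩
    let f : (R ⧸ I ^ n) →ₗ[R] M := Submodule.liftQ _ (LinearMap.toSpanSingleton R M y) (fun a ha => by
      simpa using hn a ha)
    refine ⟨of I 0 M n ((EX.hom₀ _ M).symm f), ?_⟩
    rw [ez_of, LinearEquiv.apply_symm_apply]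
    exact (Submodule.liftQ_apply _ (LinearMap.toSpanSingleton R M y) (1 : R)).trans (by simp)
end LC
end
end CLC

set_option linter.all false
namespace CLC
variable {R : Type u} [CommRing R]

lemma lc_equiv (I : Ideal R) (i : ℕ) (M : ModuleCat.{u} R) :
    Nonempty ((localCohomology I i).obj M ≃ₗ[R] LC I i M) := by
  obtain ⟨e, he⟩ := exists_extEquiv_nat M i
  let F := localCohomology.diagram (localCohomology.idealPowersDiagram I) i
  have hcl : Limits.HasColimit F := localCohomology.hasColimitDiagram.{u,0} _ _
  let c := ((evaluation _ _).obj M).mapCocone (Limits.colimit.cocone F)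
  have hc : Limits.IsColimit c := Limits.isColimitOfPreserves _ (Limits.colimit.isColimit F)
  let cn : ∀ n : ℕ, ((Ext R (ModuleCat.{u} R) i).obj (Opposite.op (ModuleCat.of R (R ⧸ I ^ n)))).obj M
     →ₗ[R] (localCohomology I i).obj M := fun n => (c.ι.app (Opposite.op (Opposite.op n))).hom
  have hcn : ∀ n m (h : n ≤ m) x, cn m (((Ext R (ModuleCat.{u} R) i).map 
      (ModuleCat.ofHom (qq I n m h)).op).app M x) = cn n x := by
    intro n m h x
    exact congrArg (fun f => f.hom x) (c.w (homOfLE h).op.op)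
  let en : ∀ n : ℕ, ((Ext R (ModuleCat.{u} R) i).obj (Opposite.op (ModuleCat.of R (R ⧸ I ^ n)))).obj M
     ≃ₗ[R] EX R (R ⧸ I ^ n) M i := fun n => e (ModuleCat.of R (R ⧸ I ^ n))
  obtain ⟨φ, hφ⟩ := LC.exists_lift (I := I) (i := i) (M := M)
    (fun n => cn n ∘ₗ (en n).symm.toLinearMap) (by
      intro n m h x
      simp only [LinearMap.comp_apply, LinearEquiv.coe_coe]
      obtain ⟨y, rfl⟩ := (en n).surjective x
      have h1 := he _ _ (ModuleCat.ofHom (qq I n m h)) y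
      have h2 : EX.pre M i (qq I n m h) (en n y) = en m _ := h1.symm
      rw [h2]
      refine (congrArg (cn m) (LinearEquiv.symm_apply_apply _ _)).trans ?_
      refine (hcn n m h y).trans ?_
      exact congrArg (cn n) (LinearEquiv.symm_apply_apply _ _).symm)
  let d : Limits.Cocone (F ⋙ (evaluation _ _).obj M) :=
    { pt := ModuleCat.of R (LC I i M)
      ι := 
       { app n := ModuleCat.ofHom (LC.of I i M n.unop.unop ∘ₗ (e (ModuleCat.of R (R ⧸ I ^ n.unop.unop))).toLinearMap)
         naturality := by
          intro n m h
          ext x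
          obtain ⟨n⟩ := n
          obtain ⟨n⟩ := n
          obtain ⟨m⟩ := m
          obtain ⟨m⟩ := m
          have hnm : n ≤ m := h.unop.unop.down.down
          have h1 := he _ _ (ModuleCat.ofHom (qq I n m hnm)) x
          exact (congrArg (LC.of I i M m) h1).trans (LC.of_pre hnm _) } }
  let ψ : (localCohomology I i).obj M →ₗ[R] LC I i M := (hc.desc d).hom
  have hψ : ∀ n x, ψ (cn n x) = LC.of I i M n (e _ x) := fun n x => 
    congrArg (fun f => f.hom x) (hc.fac d (Opposite.op (Opposite.op n)))
  refine ⟨LinearEquiv.ofLinear ψ φ ?_ ?_⟩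
  · ext z
    obtain ⟨n, x, rfl⟩ := LC.exists_of z
    change ψ (φ _) = _
    rw [hφ]
    refine (hψ n _).trans ?_
    exact congrArg (LC.of I i M n) (LinearEquiv.apply_symm_apply _ _)
  · have : ModuleCat.ofHom (φ ∘ₗ ψ) = 𝟙 c.pt := by
      refine hc.hom_ext ?_
      rintro ⟨⟨n⟩⟩
      ext x
      change φ (ψ (cn n x)) = cn n x
      exact (congrArg φ (hψ n x)).trans ((hφ n _).trans (congrArg (cn n) (LinearEquiv.symm_apply_apply _ _)))
    exact congrArg ModuleCat.Hom.hom this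
end CLC

set_option linter.all false
namespace CLC
section D1
variable {R : Type u} [CommRing R]

section gen
variable {A B C : Type*} [AddCommGroup A] [Module R A] [AddCommGroup B] [Module R B] [AddCommGroup C] [Module R C]
lemma fin_exact [IsNoetherianRing R] {f : A →ₗ[R] B} {g : B →ₗ[R] C} (h : Function.Exact f g)
    (hA : Module.Finite R A) (hC : Module.Finite R C) : Module.Finite R B := by
  have : IsNoetherian R B := isNoetherian_of_range_eq_ker f g (LinearMap.exact_iff.1 h).symm
  infer_instance
lemma sub_exact {f : A →ₗ[R] B} {g : B →ₗ[R] C} (h : Function.Exact f g)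
    (hA : Subsingleton A) (hC : Subsingleton C) : Subsingleton B := by
  refine subsingleton_of_forall_eq 0 fun b => ?_
  obtain ⟨a, rfl⟩ := (h b).1 (Subsingleton.elim _ _)
  rw [Subsingleton.elim a 0, map_zero]
lemma inj_exact {f : A →ₗ[R] B} {g : B →ₗ[R] C} (h : Function.Exact f g)
    (hA : Subsingleton A) : Function.Injective g := by
  refine (injective_iff_map_eq_zero g).2 fun b hb => ?_
  obtain ⟨a, rfl⟩ := (h b).1 hb
  rw [Subsingleton.elim a 0, map_zero]
lemma surj_exact {f : A →ₗ[R] B} {g : B →ₗ[R] C} (h : Function.Exact f g)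
    (hC : Subsingleton C) : Function.Surjective f := fun b => (h b).1 (Subsingleton.elim _ _)
lemma fin_inj [IsNoetherianRing R] {f : A →ₗ[R] B} (h : Function.Injective f)
    (hA : Module.Finite R B) : Module.Finite R A := Module.Finite.of_injective f h
lemma fin_surj {f : A →ₗ[R] B} (h : Function.Surjective f)
    (hA : Module.Finite R A) : Module.Finite R B := Module.Finite.of_surjective f h
lemma fin_sub [Subsingleton A] : Module.Finite R A := inferInstance
end gen

variable {X X' X'' M N L : Type u} [AddCommGroup X] [Module R X] [AddCommGroup M] [Module R M]
   [AddCommGroup X'] [Module R X'] [AddCommGroup X''] [Module R X''] [AddCommGroup N] [Module R N]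
   [AddCommGroup L] [Module R L]

/-- short exact sequences of modules -/
structure SES (f : M →ₗ[R] N) (g : N →ₗ[R] L) : Prop where
  inj : Function.Injective f
  surj : Function.Surjective g
  exact : Function.Exact f g

lemma SES.sub (N : Submodule R M) : SES N.subtype N.mkQ :=
  ⟨N.subtype_injective, N.mkQ_surjective, LinearMap.exact_subtype_mkQ N⟩
lemma SES.ker {g : M →ₗ[R] N} (hg : Function.Surjective g) : SES (LinearMap.ker g).subtype g :=
  ⟨Submodule.subtype_injective _, hg, LinearMap.exact_subtype_ker_map g⟩
lemma SES.coker {f : M →ₗ[R] N} (hf : Function.Injective f) : SES f (LinearMap.range f).mkQ :=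
  ⟨hf, Submodule.mkQ_surjective _, LinearMap.exact_map_mkQ_range f⟩
/-- kernel and range -/
lemma SES.kerRange (f : M →ₗ[R] N) : SES (LinearMap.ker f).subtype f.rangeRestrict := by
  have := SES.ker (LinearMap.surjective_rangeRestrict f)
  refine ⟨Submodule.subtype_injective _, LinearMap.surjective_rangeRestrict f, fun x => ?_⟩
  rw [← LinearMap.mem_ker, LinearMap.ker_rangeRestrict]; simp

namespace EX
noncomputable def congr (X : Type u) [AddCommGroup X] [Module R X] (i : ℕ) (e : M ≃ₗ[R] N) :
    EX R X M i ≃ₗ[R] EX R X N i :=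
  LinearEquiv.ofLinear (map X i e.toLinearMap) (map X i e.symm.toLinearMap)
    (by ext x; simp only [LinearMap.comp_apply]; rw [← map_comp]; simp [map_id])
    (by ext x; simp only [LinearMap.comp_apply]; rw [← map_comp]; simp [map_id])
noncomputable def congr' (M : Type u) [AddCommGroup M] [Module R M] (i : ℕ) (e : X ≃ₗ[R] X') :
    EX R X M i ≃ₗ[R] EX R X' M i :=
  LinearEquiv.ofLinear (pre M i e.symm.toLinearMap) (pre M i e.toLinearMap)
    (by ext x; simp only [LinearMap.comp_apply]; rw [← pre_comp]; simp [pre_id])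
    (by ext x; simp only [LinearMap.comp_apply]; rw [← pre_comp]; simp [pre_id])
lemma sub_of_sub [Subsingleton M] (i : ℕ) : Subsingleton (EX R X M i) := by
  refine subsingleton_of_forall_eq 0 fun x => ?_
  have := map_id i x
  rw [← this, show (LinearMap.id : M →ₗ[R] M) = 0 from Subsingleton.elim _ _, map_zero]
lemma sub_of_sub' [Subsingleton X] (i : ℕ) : Subsingleton (EX R X M i) := by
  refine subsingleton_of_forall_eq 0 fun x => ?_
  have := pre_id i x
  rw [← this, show (LinearMap.id : X →ₗ[R] X) = 0 from Subsingleton.elim _ _, pre_zero]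
lemma map0_inj {f : M →ₗ[R] N} (hf : Function.Injective f) : Function.Injective (map X 0 f) := by
  intro a b hab
  apply (hom₀ X M).injective
  have := congrArg (hom₀ X N) hab
  rw [hom₀_map, hom₀_map] at this
  ext x; exact hf (LinearMap.congr_fun this x)
lemma pre0_inj {f : X →ₗ[R] X'} (hf : Function.Surjective f) : Function.Injective (pre M 0 f) := by
  intro a b hab
  apply (hom₀ X' M).injective
  have := congrArg (hom₀ X M) hab
  rw [hom₀_pre, hom₀_pre] at this
  ext x; obtain ⟨y, rfl⟩ := hf x; exact (LinearMap.congr_fun this y)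
/-- scalars acting through the first argument -/
lemma smul_eq_pre (r : R) (i : ℕ) (x : EX R X M i) : r • x = pre M i (r • LinearMap.id) x := by
  rw [pre_smul, pre_id]
lemma smul_eq_map (r : R) (i : ℕ) (x : EX R X M i) : r • x = map X i (r • LinearMap.id) x := by
  rw [map_smul, map_id]
lemma smul_eq_zero_left {r : R} (h : ∀ x : X, r • x = 0) (i : ℕ) (x : EX R X M i) : r • x = 0 := by
  rw [smul_eq_pre, show (r • LinearMap.id : X →ₗ[R] X) = 0 from by ext x; exact h x, pre_zero]
lemma smul_eq_zero_right {r : R} (h : ∀ x : M, r • x = 0) (i : ℕ) (x : EX R X M i) : r • x = 0 := by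
  rw [smul_eq_map, show (r • LinearMap.id : M →ₗ[R] M) = 0 from by ext x; exact h x, map_zero]
end EX

namespace SES
variable {f : M →ₗ[R] N} {g : N →ₗ[R] L} (X)
lemma exδ (s : SES f g) : ∃ δ : ∀ i, EX R X L i →ₗ[R] EX R X M (i+1), ∀ i, 
     Function.Exact (EX.map X i f) (EX.map X i g) ∧ Function.Exact (EX.map X i g) (δ i) ∧
      Function.Exact (δ i) (EX.map X (i+1) f) := by
  obtain ⟨δ, _, h⟩ := EX.les s.inj s.surj s.exact
  exact ⟨fun i => δ X i, fun i => h X i⟩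
lemma fin_mid (s : SES f g) [IsNoetherianRing R] (i : ℕ) (h1 : Module.Finite R (EX R X M i)) (h2 : Module.Finite R (EX R X L i)) :
    Module.Finite R (EX R X N i) := by
  obtain ⟨δ, h⟩ := s.exδ X
  exact fin_exact (h i).1 h1 h2
lemma fin_right (s : SES f g) [IsNoetherianRing R] (i : ℕ) (h1 : Module.Finite R (EX R X N i)) (h2 : Module.Finite R (EX R X M (i+1))) :
    Module.Finite R (EX R X L i) := by
  obtain ⟨δ, h⟩ := s.exδ X
  exact fin_exact (h i).2.1 h1 h2
lemma fin_left (s : SES f g) [IsNoetherianRing R] (i : ℕ) (h1 : Module.Finite R (EX R X L i)) (h2 : Module.Finite R (EX R X N (i+1))) :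
    Module.Finite R (EX R X M (i+1)) := by
  obtain ⟨δ, h⟩ := s.exδ X
  exact fin_exact (h i).2.2 h1 h2
lemma fin_left0 (s : SES f g) [IsNoetherianRing R] (h2 : Module.Finite R (EX R X N 0)) :
    Module.Finite R (EX R X M 0) := fin_inj (EX.map0_inj s.inj) h2
lemma fin_left_all (s : SES f g) [IsNoetherianRing R] (h1 : ∀ i, Module.Finite R (EX R X L i)) (h2 : ∀ i, Module.Finite R (EX R X N i)) :
   ∀ i, Module.Finite R (EX R X M i)
  | 0 => s.fin_left0 X (h2 0)
  | i+1 => s.fin_left X i (h1 i) (h2 _)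
end SES

namespace LC
variable (I : Ideal R) (i : ℕ)
noncomputable def congr (e : M ≃ₗ[R] N) :
    LC I i M ≃ₗ[R] LC I i N :=
  LinearEquiv.ofLinear (map I i e.toLinearMap) (map I i e.symm.toLinearMap)
    (by ext x; simp only [LinearMap.comp_apply]; rw [← map_comp]; simp [map_id])
    (by ext x; simp only [LinearMap.comp_apply]; rw [← map_comp]; simp [map_id])
lemma sub_of_sub [Subsingleton M] : Subsingleton (LC I i M) := by
  refine subsingleton_of_forall_eq 0 fun x => ?_
  have := map_id x
  rw [← this, show (LinearMap.id : M →ₗ[R] M) = 0 from Subsingleton.elim _ _, map_zero]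
lemma smul_eq_map (r : R) (x : LC I i M) : r • x = map I i (r • LinearMap.id) x := by
  rw [map_smul, map_id]
lemma smul_eq_zero {r : R} (h : ∀ x : M, r • x = 0) (x : LC I i M) : r • x = 0 := by
  rw [smul_eq_map, show (r • LinearMap.id : M →ₗ[R] M) = 0 from by ext x; exact h x, map_zero]
lemma torsion (x : LC I i M) : x ∈ Gam I (LC I i M) := by
  obtain ⟨n, x, rfl⟩ := exists_of x
  refine ⟨n, fun a ha => ?_⟩
  rw [← _root_.map_smul, EX.smul_eq_zero_left _ i x, _root_.map_zero]
  intro y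
  obtain ⟨r, rfl⟩ := Ideal.Quotient.mk_surjective y
  change Ideal.Quotient.mk (I^n) (a * r) = 0
  exact Ideal.Quotient.eq_zero_iff_mem.2 (Ideal.mul_mem_right _ _ ha)
lemma map0_inj {f : M →ₗ[R] N} (hf : Function.Injective f) : Function.Injective (map I 0 f) := by
  intro a b hab
  apply ez_inj (I := I)
  have := congrArg (ez I N) hab
  rw [ez_map, ez_map] at this
  exact hf this
variable (M) in
noncomputable def equiv0 : LC I 0 M ≃ₗ[R] Gam I M :=
  (LinearEquiv.ofInjective (ez I M) (ez_inj I)).trans (LinearEquiv.ofEq _ _ (ez_range I))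
end LC

namespace SES
variable {f : M →ₗ[R] N} {g : N →ₗ[R] L} (I : Ideal R)
lemma lcδ (s : SES f g) (i : ℕ) : ∃ δ : LC I i L →ₗ[R] LC I (i+1) M,
     Function.Exact (LC.map I i f) (LC.map I i g) ∧ Function.Exact (LC.map I i g) δ ∧
      Function.Exact δ (LC.map I (i+1) f) := LC.les s.inj s.surj s.exact I i
lemma sub_mid (s : SES f g) (i : ℕ) (h1 : Subsingleton (LC I i M)) (h2 : Subsingleton (LC I i L)) :
    Subsingleton (LC I i N) := by
  obtain ⟨δ, h⟩ := s.lcδ I i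
  exact sub_exact h.1 h1 h2
lemma sub_right (s : SES f g) (i : ℕ) (h1 : Subsingleton (LC I i N)) (h2 : Subsingleton (LC I (i+1) M)) :
    Subsingleton (LC I i L) := by
  obtain ⟨δ, h⟩ := s.lcδ I i
  exact sub_exact h.2.1 h1 h2
lemma sub_left (s : SES f g) (i : ℕ) (h1 : Subsingleton (LC I i L)) (h2 : Subsingleton (LC I (i+1) N)) :
    Subsingleton (LC I (i+1) M) := by
  obtain ⟨δ, h⟩ := s.lcδ I i
  exact sub_exact h.2.2 h1 h2
/-- H(g) surjective if next H of M vanishes -/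
lemma lc_surj (s : SES f g) (i : ℕ) (h2 : Subsingleton (LC I (i+1) M)) : Function.Surjective (LC.map I i g) := by
  obtain ⟨δ, h⟩ := s.lcδ I i
  exact surj_exact h.2.1 h2
lemma lc_surj' (s : SES f g) (i : ℕ) (h2 : Subsingleton (LC I i L)) : Function.Surjective (LC.map I i f) := by
  obtain ⟨δ, h⟩ := s.lcδ I i
  exact surj_exact h.1 h2
lemma lc_inj (s : SES f g) (i : ℕ) (h2 : Subsingleton (LC I i L)) : Function.Injective (LC.map I (i+1) f) := by
  obtain ⟨δ, h⟩ := s.lcδ I i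
  exact inj_exact h.2.2 h2
lemma lc_inj' (s : SES f g) (i : ℕ) (h2 : Subsingleton (LC I i M)) : Function.Injective (LC.map I i g) := by
  obtain ⟨δ, h⟩ := s.lcδ I i
  exact inj_exact h.1 h2
end SES

lemma exists_inj (M : Type u) [AddCommGroup M] [Module R M] :
    ∃ (E : Type u) (_ : AddCommGroup E) (_ : Module R E) (f : M →ₗ[R] E),
      Module.Injective R E ∧ Function.Injective f := by
  refine ⟨((Injective.under (ModuleCat.of R M) : ModuleCat.{u} R) : Type u), inferInstance, inferInstance,
    (Injective.ι (ModuleCat.of R M)).hom, ?_, ?_⟩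
  · exact (Module.injective_iff_injective_object R _).2 (Injective.injective_under (ModuleCat.of R M))
  · exact (ModuleCat.mono_iff_injective _).1 inferInstance

/-- cofinite modules -/
def Cof (I : Ideal R) (M : Type u) [AddCommGroup M] [Module R M] : Prop :=
  (∀ x : M, x ∈ Gam I M) ∧ ∀ i, Module.Finite R (EX R (R ⧸ I) M i)

lemma tors_of_inj {I : Ideal R} {f : M →ₗ[R] N} (hf : Function.Injective f) (h : ∀ x : N, x ∈ Gam I N) (x : M) :
    x ∈ Gam I M := by
  obtain ⟨n, hn⟩ := h (f x)
  exact ⟨n, fun a ha => hf (by rw [map_smul, hn a ha, map_zero])⟩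
lemma tors_of_surj {I : Ideal R} {f : M →ₗ[R] N} (hf : Function.Surjective f) (h : ∀ x : M, x ∈ Gam I M) (x : N) :
    x ∈ Gam I N := by
  obtain ⟨x, rfl⟩ := hf x
  obtain ⟨n, hn⟩ := h x
  exact ⟨n, fun a ha => by rw [← map_smul, hn a ha, map_zero]⟩
lemma Cof.congr {I : Ideal R} (e : M ≃ₗ[R] N) (h : Cof I M) : Cof I N := by
  refine ⟨tors_of_surj (f := e.toLinearMap) e.surjective h.1, fun i => ?_⟩
  have := h.2 i
  exact Module.Finite.equiv (EX.congr (R ⧸ I) i e)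
lemma Cof.of_sub {I : Ideal R} (h : Subsingleton M) : Cof I M := by
  refine ⟨fun x => by rw [Subsingleton.elim x 0]; exact zero_mem _, fun i => ?_⟩
  have := EX.sub_of_sub (R := R) (X := R ⧸ I) (M := M) i
  infer_instance
lemma Cof.of_fin [IsNoetherianRing R] {I : Ideal R} (h : Module.Finite R M) (h' : ∀ x : M, x ∈ Gam I M) : Cof I M :=
  ⟨h', fun i => EX.finite i⟩

/-- torsion f.g. modules are killed by a power -/
lemma exists_pow_smul [Module.Finite R M] {I : Ideal R} (h : ∀ x : M, x ∈ Gam I M) :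
    ∃ n : ℕ, ∀ a ∈ I ^ n, ∀ x : M, a • x = 0 := by
  obtain ⟨s, hs⟩ := Module.Finite.fg_top (R := R) (M := M)
  choose n hn using fun x : M => h x
  refine ⟨s.sup n, fun a ha x => ?_⟩
  have hx : x ∈ Submodule.span R (s : Set M) := by rw [hs]; trivial
  induction hx using Submodule.span_induction with
  | mem y hy => exact hn y a (Ideal.pow_le_pow_right (Finset.le_sup hy) ha)
  | zero => simp
  | add y z _ _ h1 h2 => rw [smul_add, h1, h2, add_zero]
  | smul r y _ h1 => rw [smul_comm, h1, smul_zero]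

lemma support_iff_tors [IsNoetherianRing R] (I : Ideal R) :
    Module.support R M ⊆ PrimeSpectrum.zeroLocus (I : Set R) ↔ ∀ x : M, x ∈ Gam I M := by
  constructor
  · intro h x
    have h1 : I ≤ (R ∙ x).annihilator.radical := by
      rw [Ideal.radical_eq_sInf]
      refine le_sInf fun p hp => ?_
      have := hp.2
      exact h (Module.mem_support_iff_exists_annihilator.2 ⟨x, hp.1⟩ : (⟨p, hp.2⟩ : PrimeSpectrum R) ∈ _)
    obtain ⟨n, hn⟩ := Ideal.exists_pow_le_of_le_radical_of_fg h1 (IsNoetherian.noetherian I)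
    refine ⟨n, fun a ha => ?_⟩
    exact (Submodule.mem_annihilator_span_singleton x a).1 (hn ha)
  · intro h p hp
    obtain ⟨x, hx⟩ := Module.mem_support_iff_exists_annihilator.1 hp
    obtain ⟨n, hn⟩ := h x
    refine p.2.le_of_pow_le (n := n) (fun a ha => hx ?_)
    exact (Submodule.mem_annihilator_span_singleton x a).2 (hn a ha)
end D1
end CLC

set_option linter.all false
namespace CLC
section D2
variable {R : Type u} [CommRing R] 
variable {X X' X'' M N L : Type u} [AddCommGroup X] [Module R X] [AddCommGroup M] [Module R M]
   [AddCommGroup X'] [Module R X'] [AddCommGroup X''] [Module R X''] [AddCommGroup N] [Module R N]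
   [AddCommGroup L] [Module R L]

lemma Gam_torsion (I : Ideal R) (x : Gam I M) : x ∈ Gam I (Gam I M) := by
  obtain ⟨n, hn⟩ := x.2
  exact ⟨n, fun a ha => Subtype.ext (hn a ha)⟩

lemma artin_rees [IsNoetherianRing R] (I J : Ideal R) (n : ℕ) : ∃ m, I ^ m ⊓ J ≤ I ^ n * J := by
  obtain ⟨k, hk⟩ := Ideal.exists_pow_inf_eq_pow_smul (M := R) I J
  refine ⟨n + k, ?_⟩
  have := hk (n+k) (by omega)
  simp only [smul_eq_mul, Ideal.mul_top, Nat.add_sub_cancel] at this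
  rw [this]
  exact Ideal.mul_mono_right inf_le_right

lemma Gam_injective [IsNoetherianRing R] (I : Ideal R) [hE : Module.Injective R M] : Module.Injective R (Gam I M) := by
  apply Module.Baer.injective
  intro J g
  obtain ⟨n, hn⟩ : ∃ n : ℕ, ∀ a ∈ I ^ n, ∀ x : J, a • g x = 0 := by
    have : Module.Finite R (LinearMap.range g) := inferInstance
    obtain ⟨n, hn⟩ := exists_pow_smul (M := LinearMap.range g) (I := I) (tors_of_inj (Submodule.subtype_injective _) (Gam_torsion I))
    exact ⟨n, fun a ha x => congrArg Subtype.val (hn a ha ⟨g x, x, rfl⟩)⟩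
  obtain ⟨m, hm⟩ := artin_rees I J n
  let φ : J →ₗ[R] (R ⧸ I ^ m) := (Submodule.mkQ (I ^ m)) ∘ₗ J.subtype
  have hker : LinearMap.ker φ ≤ LinearMap.ker ((Gam I M).subtype ∘ₗ g) := by
    intro x hx
    have hx' : (x : R) ∈ I ^ m := (Submodule.Quotient.mk_eq_zero _).1 hx
    have h2 := hm ⟨hx', x.2⟩
    have key : ∀ y ∈ I ^ n * J, ∃ hy : y ∈ J, g ⟨y, hy⟩ = 0 := by
      intro y hy
      refine Submodule.mul_induction_on hy ?_ ?_
      · intro a ha b hb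
        exact ⟨J.mul_mem_left a hb, (g.map_smul a ⟨b, hb⟩).trans (hn a ha _)⟩
      · rintro a b ⟨ha, ha'⟩ ⟨hb, hb'⟩
        exact ⟨J.add_mem ha hb, (g.map_add ⟨a, ha⟩ ⟨b, hb⟩).trans (by rw [ha', hb', add_zero])⟩
    obtain ⟨_, this⟩ := key x h2
    rw [LinearMap.mem_ker, LinearMap.comp_apply, this, map_zero]
  obtain ⟨h, hh⟩ := hE.out ((LinearMap.ker φ).liftQ φ le_rfl)
    (LinearMap.ker_eq_bot.1 (Submodule.ker_liftQ_eq_bot _ _ _ le_rfl)) ((LinearMap.ker φ).liftQ _ hker)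
  have h1 : h (Submodule.mkQ _ 1) ∈ Gam I M := by
    refine ⟨m, fun a ha => ?_⟩
    rw [← map_smul, ← map_smul, smul_eq_mul, mul_one, Submodule.mkQ_apply, (Submodule.Quotient.mk_eq_zero _).2 ha, map_zero]
  refine ⟨LinearMap.toSpanSingleton R _ ⟨h (Submodule.mkQ _ 1), h1⟩, fun x hx => ?_⟩
  have := hh (Submodule.mkQ _ ⟨x, hx⟩)
  rw [Submodule.mkQ_apply, Submodule.liftQ_apply, Submodule.liftQ_apply] at this
  apply Subtype.ext
  refine Eq.trans ?_ this
  rw [LinearMap.toSpanSingleton_apply]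
  change x • h (Submodule.mkQ _ 1) = h (Submodule.mkQ _ x)
  rw [← map_smul, ← map_smul, smul_eq_mul, mul_one]

lemma Gam_eq_bot_iff (I : Ideal R) : Gam I M = ⊥ ↔ Subsingleton (LC I 0 M) := by
  rw [(LC.equiv0 M I).toEquiv.subsingleton_congr, Submodule.subsingleton_iff_eq_bot]

lemma Gam_eq_top {I : Ideal R} (h : ∀ x : M, x ∈ Gam I M) : Gam I M = ⊤ := eq_top_iff.2 fun x _ => h x

lemma ez_surj {I : Ideal R} (h : ∀ x : M, x ∈ Gam I M) : Function.Surjective (LC.ez I M) := by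
  rw [← LinearMap.range_eq_top, LC.ez_range, Gam_eq_top h]

lemma Gam_quot [IsNoetherianRing R] (I : Ideal R) : Gam I (M ⧸ Gam I M) = ⊥ := by
  rw [eq_bot_iff]
  intro x hx
  obtain ⟨x, rfl⟩ := Submodule.mkQ_surjective _ x
  obtain ⟨n, hn⟩ := hx
  -- the module I^n x
  let P : Submodule R M := Submodule.map (LinearMap.toSpanSingleton R M x) (I ^ n)
  have hP : P ≤ Gam I M := by
    rintro _ ⟨a, ha, rfl⟩
    have := hn a ha
    rw [← map_smul, Submodule.mkQ_apply, Submodule.Quotient.mk_eq_zero] at this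
    exact this
  have hfin : Module.Finite R P := Module.Finite.iff_fg.2 ((IsNoetherian.noetherian (I^n)).map _)
  obtain ⟨k, hk⟩ := exists_pow_smul (M := P) (I := I) (tors_of_inj (f := Submodule.inclusion hP)
     (Submodule.inclusion_injective hP) (Gam_torsion I))
  refine (Submodule.mem_bot R).2 ((Submodule.Quotient.mk_eq_zero _).2 ⟨k + n, fun a ha => ?_⟩)
  rw [pow_add] at ha
  refine Submodule.mul_induction_on ha ?_ ?_
  · intro a ha b hb
    rw [mul_smul]
    exact congrArg Subtype.val (hk a ha ⟨b • x, b, hb, rfl⟩)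
  · intro a b ha hb
    rw [add_smul, ha, hb, add_zero]

lemma LC.tors_vanish [IsNoetherianRing R] (I : Ideal R) (i : ℕ) :
    ∀ (M : Type u) [AddCommGroup M] [Module R M] (h : ∀ x : M, x ∈ Gam I M), Subsingleton (LC I (i+1) M) := by
  induction i with
  | zero =>
    intro M _ _ h
    obtain ⟨E, _, _, f, hE, hf⟩ := exists_inj (R := R) M
    have hG : Module.Injective R (Gam I E) := Gam_injective I
    have hr : ∀ x, f x ∈ Gam I E := fun x => by
      obtain ⟨n, hn⟩ := h x
      exact ⟨n, fun a ha => by rw [← _root_.map_smul, hn a ha, _root_.map_zero]⟩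
    have s := SES.coker (f := f.codRestrict (Gam I E) hr) (fun a b hab => hf (congrArg Subtype.val hab))
    obtain ⟨δ, h1, h2, h3⟩ := s.lcδ I 0
    have hsur : Function.Surjective (LC.map I 0 (LinearMap.range (f.codRestrict (Gam I E) hr)).mkQ) := by
      intro y
      obtain ⟨z, hz⟩ := Submodule.mkQ_surjective _ (LC.ez I _ y)
      obtain ⟨w, rfl⟩ := ez_surj (Gam_torsion I) z
      exact ⟨w, LC.ez_inj I (by rw [LC.ez_map, hz])⟩
    have := LC.subsingleton_inj (M := Gam I E) I 0
    have hδ : Function.Injective (LC.map I (0+1) (f.codRestrict (Gam I E) hr)) := by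
      refine (injective_iff_map_eq_zero _).2 fun b hb => ?_
      obtain ⟨a, rfl⟩ := (h3 b).1 hb
      exact (h2 a).2 (hsur a)
    exact hδ.subsingleton
  | succ i ih =>
    intro M _ _ h
    obtain ⟨E, _, _, f, hE, hf⟩ := exists_inj (R := R) M
    have hG : Module.Injective R (Gam I E) := Gam_injective I
    have hr : ∀ x, f x ∈ Gam I E := fun x => by
      obtain ⟨n, hn⟩ := h x
      exact ⟨n, fun a ha => by rw [← _root_.map_smul, hn a ha, _root_.map_zero]⟩
    have s := SES.coker (f := f.codRestrict (Gam I E) hr) (fun a b hab => hf (congrArg Subtype.val hab))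
    exact s.sub_left I (i+1) (ih _ (tors_of_surj (Submodule.mkQ_surjective _) (Gam_torsion I)))
      (LC.subsingleton_inj I _)

/-- `H^{i+1}(M) ≅ H^{i+1}(N)` for surjections with torsion kernel -/
lemma SES.lc_bij_of_tors [IsNoetherianRing R] {f : M →ₗ[R] N} {g : N →ₗ[R] L} (s : SES f g) (I : Ideal R)
    (h : ∀ x : M, x ∈ Gam I M) (i : ℕ) : Function.Bijective (LC.map I (i+1) g) :=
  ⟨s.lc_inj' I _ (LC.tors_vanish I i M h), s.lc_surj I _ (LC.tors_vanish I (i+1) M h)⟩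

lemma exists_inj' [IsNoetherianRing R] (I : Ideal R) (hX : Gam I X = ⊥) :
    ∃ (E : Type u) (_ : AddCommGroup E) (_ : Module R E) (f : X →ₗ[R] E),
      Module.Injective R E ∧ Function.Injective f ∧ Gam I E = ⊥ := by
  obtain ⟨E, _, _, f, hE, hf⟩ := exists_inj (R := R) X
  have hG : Module.Injective R (Gam I E) := Gam_injective I
  obtain ⟨r, hr⟩ := hG.out (Gam I E).subtype (Submodule.subtype_injective _) LinearMap.id
  refine ⟨E ⧸ Gam I E, inferInstance, inferInstance, (Gam I E).mkQ ∘ₗ f, ?_, ?_, Gam_quot I⟩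
  · constructor
    intro A B _ _ _ _ i hi g
    let σ : (E ⧸ Gam I E) →ₗ[R] E := (Gam I E).liftQ (LinearMap.id - (Gam I E).subtype ∘ₗ r) (by
      intro x hx
      have := hr ⟨x, hx⟩
      simp only [LinearMap.id_apply, Submodule.subtype_apply] at this
      rw [LinearMap.mem_ker, LinearMap.sub_apply, LinearMap.comp_apply, this]; simp)
    obtain ⟨h, hh⟩ := hE.out i hi (σ ∘ₗ g)
    refine ⟨(Gam I E).mkQ ∘ₗ h, fun x => ?_⟩
    rw [LinearMap.comp_apply, hh, LinearMap.comp_apply]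
    obtain ⟨y, hy⟩ := Submodule.mkQ_surjective _ (g x)
    rw [← hy, Submodule.mkQ_apply (Gam I E) y, Submodule.liftQ_apply]
    simp [σ]
  · refine (injective_iff_map_eq_zero _).2 fun b hb => ?_
    rw [LinearMap.comp_apply, Submodule.mkQ_apply, Submodule.Quotient.mk_eq_zero] at hb
    obtain ⟨n, hn⟩ := hb
    have : b ∈ Gam I X := ⟨n, fun a ha => hf (by rw [map_smul, hn a ha, map_zero])⟩
    rwa [hX] at this

lemma EX.hom_sub {I : Ideal R} (hX : Gam I X = ⊥) : Subsingleton (EX R (R ⧸ I) X 0) := by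
  rw [(EX.hom₀ (R ⧸ I) X).toEquiv.subsingleton_congr]
  refine subsingleton_of_forall_eq 0 fun f => ?_
  ext
  have : f (Ideal.Quotient.mk I 1) ∈ Gam I X := ⟨1, fun a ha => by
    rw [pow_one] at ha
    rw [← _root_.map_smul]
    have : a • (Ideal.Quotient.mk I 1 : R ⧸ I) = 0 := by
      change Ideal.Quotient.mk I (a * 1) = 0
      rw [mul_one]; exact Ideal.Quotient.eq_zero_iff_mem.2 ha
    rw [this, _root_.map_zero]⟩
  rw [hX] at this
  exact this

lemma shift [IsNoetherianRing R] (I : Ideal R) (hX : Gam I X = ⊥) :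
    ∃ (Y : Type u) (_ : AddCommGroup Y) (_ : Module R Y),
      (∀ i, Nonempty (LC I i Y ≃ₗ[R] LC I (i+1) X)) ∧
      ∀ i, Nonempty (EX R (R ⧸ I) Y i ≃ₗ[R] EX R (R ⧸ I) X (i+1)) := by
  obtain ⟨E, _, _, f, hE, hf, hG⟩ := exists_inj' I hX
  have s := SES.coker hf
  refine ⟨E ⧸ LinearMap.range f, inferInstance, inferInstance, fun i => ?_, fun i => ?_⟩
  · obtain ⟨δ, h1, h2, h3⟩ := s.lcδ I i
    have hi : ∀ i, Subsingleton (LC I i E) := fun i => by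
      cases i with
      | zero => exact (Gam_eq_bot_iff I).1 hG
      | succ i => exact LC.subsingleton_inj I i
    exact ⟨LinearEquiv.ofBijective δ ⟨inj_exact h2 (hi _), surj_exact h3 (hi _)⟩⟩
  · obtain ⟨δ, h⟩ := s.exδ (R ⧸ I)
    obtain ⟨h1, h2, h3⟩ := h i
    have hi : ∀ i, Subsingleton (EX R (R ⧸ I) E i) := fun i => by
      cases i with
      | zero => exact EX.hom_sub hG
      | succ i => exact EX.subsingleton_inj i
    exact ⟨LinearEquiv.ofBijective (δ i) ⟨inj_exact h2 (hi _), surj_exact h3 (hi _)⟩⟩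
end D2
end CLC

set_option linter.all false
namespace CLC
section D3
variable {R : Type u} [CommRing R] 
variable {X X' X'' M N L : Type u} [AddCommGroup X] [Module R X] [AddCommGroup M] [Module R M]
   [AddCommGroup X'] [Module R X'] [AddCommGroup X''] [Module R X''] [AddCommGroup N] [Module R N]
   [AddCommGroup L] [Module R L]

/-- multiplication by `x` -/
def ml (x : R) (X : Type u) [AddCommGroup X] [Module R X] : X →ₗ[R] X := x • LinearMap.id
lemma ml_apply (x : R) (y : X) : ml x X y = x • y := rfl

lemma EX.fin_congr {X X' M N : Type u} [AddCommGroup X] [Module R X] [AddCommGroup M] [Module R M]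
   [AddCommGroup X'] [Module R X'] [AddCommGroup N] [Module R N] {i j : ℕ} (e : Nonempty (EX R X M i ≃ₗ[R] EX R X' N j)) (h : Module.Finite R (EX R X M i)) :
   Module.Finite R (EX R X' N j) := Module.Finite.equiv e.some

lemma lemC [IsNoetherianRing R] {I : Ideal R} {x : R} (hx : x ∈ I)
    (h1 : ∀ i, Module.Finite R (EX R (R ⧸ I) (LinearMap.ker (ml x X)) i))
    (h2 : ∀ i, Module.Finite R (EX R (R ⧸ I) (X ⧸ LinearMap.range (ml x X)) i)) (i : ℕ) :
    Module.Finite R (EX R (R ⧸ I) X i) := by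
  have s1 := SES.kerRange (ml x X)
  have s2 := SES.sub (LinearMap.range (ml x X))
  obtain ⟨δ, h⟩ := s2.exδ (R ⧸ I)
  obtain ⟨δ', h'⟩ := s1.exδ (R ⧸ I)
  have hker : Module.Finite R (LinearMap.ker (EX.map (R ⧸ I) i (LinearMap.range (ml x X)).subtype)) := by
    cases i with
    | zero =>
      rw [LinearMap.ker_eq_bot.2 (EX.map0_inj s2.inj)]
      infer_instance
    | succ i =>
      rw [LinearMap.exact_iff.1 (h i).2.2]
      have := h2 i
      infer_instance
  have hzero : ∀ y, EX.map (R ⧸ I) i (ml x X).rangeRestrict y ∈ 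
      LinearMap.ker (EX.map (R ⧸ I) i (LinearMap.range (ml x X)).subtype) := by
    intro y
    rw [LinearMap.mem_ker, ← EX.map_comp]
    have : (LinearMap.range (ml x X)).subtype ∘ₗ (ml x X).rangeRestrict = x • LinearMap.id := by ext; rfl
    rw [this, ← EX.smul_eq_map]
    refine EX.smul_eq_zero_left ?_ i y
    intro y
    obtain ⟨r, rfl⟩ := Ideal.Quotient.mk_surjective y
    change Ideal.Quotient.mk I (x * r) = 0
    exact Ideal.Quotient.eq_zero_iff_mem.2 (Ideal.mul_mem_right _ _ hx)
  refine fin_exact (f := EX.map (R ⧸ I) i (LinearMap.ker (ml x X)).subtype)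
    (g := (EX.map (R ⧸ I) i (ml x X).rangeRestrict).codRestrict _ hzero) ?_ (h1 i) hker
  intro y
  rw [← (h' i).1 y]
  exact Subtype.ext_iff

lemma shift2 [IsNoetherianRing R] (I : Ideal R) (X : Type u) [AddCommGroup X] [Module R X] :
    ∃ (Y : Type u) (_ : AddCommGroup Y) (_ : Module R Y),
      (∀ i, Nonempty (LC I i Y ≃ₗ[R] LC I (i+1) X)) ∧
      ((∀ i, Module.Finite R (EX R (R ⧸ I) (LC I 0 X) i)) → (∀ i, Module.Finite R (EX R (R ⧸ I) X i)) → 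
        ∀ i, Module.Finite R (EX R (R ⧸ I) Y i)) ∧
      ((∀ i, Module.Finite R (EX R (R ⧸ I) (LC I 0 X) i)) → (∀ i, Module.Finite R (EX R (R ⧸ I) Y i)) → 
        ∀ i, Module.Finite R (EX R (R ⧸ I) X i)) ∧
      ((∀ i, Module.Finite R (EX R (R ⧸ I) X i)) → (∀ i, Module.Finite R (EX R (R ⧸ I) Y i)) → 
        ∀ i, Module.Finite R (EX R (R ⧸ I) (LC I 0 X) i)) := by
  obtain ⟨Y, i1, i2, h1, h2⟩ := shift (X := X ⧸ Gam I X) I (Gam_quot I)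
  have s := SES.sub (Gam I X)
  have hq0 := EX.hom_sub (Gam_quot (M := X) I)
  have e0 : ∀ i, Nonempty (EX R (R ⧸ I) (LC I 0 X) i ≃ₗ[R] EX R (R ⧸ I) (Gam I X) i) :=
    fun i => ⟨EX.congr (R ⧸ I) i (LC.equiv0 X I)⟩
  have e0' : ∀ i, Nonempty (EX R (R ⧸ I) (Gam I X) i ≃ₗ[R] EX R (R ⧸ I) (LC I 0 X) i) := fun i => ⟨(e0 i).some.symm⟩
  have hQ : (∀ i, Module.Finite R (EX R (R ⧸ I) Y i)) → ∀ i, Module.Finite R (EX R (R ⧸ I) (X ⧸ Gam I X) i) := by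
    intro h i
    cases i with
    | zero => infer_instance
    | succ i => exact EX.fin_congr (h2 i) (h i)
  refine ⟨Y, i1, i2, fun i => ?_, fun hg hx i => ?_, fun hg hy i => ?_, fun hx hy i => ?_⟩
  · exact ⟨(h1 i).some.trans (LinearEquiv.ofBijective _ (s.lc_bij_of_tors I (Gam_torsion I) i)).symm⟩
  · exact EX.fin_congr ⟨(h2 i).some.symm⟩ (s.fin_right _ _ (hx _) (EX.fin_congr (e0 _) (hg _)))
  · exact s.fin_mid _ i (EX.fin_congr (e0 i) (hg i)) (hQ hy i)
  · exact EX.fin_congr (e0' i) (s.fin_left_all _ (hQ hy) hx i)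

lemma lemA [IsNoetherianRing R] (I : Ideal R) (t : ℕ) : ∀ (X : Type u) [AddCommGroup X] [Module R X],
    (∀ i, Module.Finite R (EX R (R ⧸ I) X i)) → (∀ i < t, Cof I (LC I i X)) → 
      Module.Finite R (EX R (R ⧸ I) (LC I t X) 0) ∧ Module.Finite R (EX R (R ⧸ I) (LC I t X) 1) := by
  induction t with
  | zero =>
    intro X _ _ hX _
    have s := SES.sub (Gam I X)
    have hq0 := EX.hom_sub (Gam_quot (M := X) I)
    have e0' : ∀ i, Nonempty (EX R (R ⧸ I) (Gam I X) i ≃ₗ[R] EX R (R ⧸ I) (LC I 0 X) i) := 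
      fun i => ⟨(EX.congr (R ⧸ I) i (LC.equiv0 X I)).symm⟩
    exact ⟨EX.fin_congr (e0' _) (s.fin_left0 _ (hX 0)), EX.fin_congr (e0' _) (s.fin_left _ 0 inferInstance (hX 1))⟩
  | succ t ih =>
    intro X _ _ hX hc
    obtain ⟨Y, i1, i2, h1, h2, -, -⟩ := shift2 I X
    obtain ⟨ha, hb⟩ := ih Y (h2 (hc 0 (by omega)).2 hX) (fun i hi => (hc (i+1) (by omega)).congr (h1 i).some.symm)
    exact ⟨EX.fin_congr ⟨EX.congr _ _ (h1 t).some⟩ ha, EX.fin_congr ⟨EX.congr _ _ (h1 t).some⟩ hb⟩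

lemma ext_zero_of_lc_zero [IsNoetherianRing R] (I : Ideal R) (i : ℕ) : ∀ (X : Type u) [AddCommGroup X] [Module R X],
    (∀ j, Subsingleton (LC I j X)) → Subsingleton (EX R (R ⧸ I) X i) := by
  induction i with
  | zero => intro X _ _ h; exact EX.hom_sub ((Gam_eq_bot_iff I).2 (h 0))
  | succ i ih =>
    intro X _ _ h
    obtain ⟨Y, _, _, h1, h2⟩ := shift (X := X) I ((Gam_eq_bot_iff I).2 (h 0))
    have := ih Y fun j => by have := h (j+1); exact (h1 j).some.toEquiv.subsingleton
    exact (h2 i).some.symm.toEquiv.subsingleton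

lemma lemD0 [IsNoetherianRing R] (I : Ideal R) (n : ℕ) : ∀ (X : Type u) [AddCommGroup X] [Module R X],
    (∀ j ≥ n, Subsingleton (LC I j X)) → (∀ j, Cof I (LC I j X)) → ∀ i, Module.Finite R (EX R (R ⧸ I) X i) := by
  induction n with
  | zero => 
    intro X _ _ h _ i
    have := ext_zero_of_lc_zero I i X fun j => h j (by omega)
    infer_instance
  | succ n ih =>
    intro X _ _ h hc
    obtain ⟨Y, _, _, h1, -, h2, -⟩ := shift2 I X
    refine h2 (hc 0).2 (ih Y ?_ ?_)
    · intro j hj; have := h (j+1) (by omega); exact (h1 j).some.toEquiv.subsingleton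
    · intro j; exact (hc (j+1)).congr (h1 j).some.symm

lemma lemD [IsNoetherianRing R] (I : Ideal R) (t : ℕ) : ∀ (n : ℕ) (X : Type u) [AddCommGroup X] [Module R X],
    (∀ i, Module.Finite R (EX R (R ⧸ I) X i)) → 
    (∀ j ≥ n, Subsingleton (LC I j X)) → (∀ j, j ≠ t → Cof I (LC I j X)) → Cof I (LC I t X) := by
  induction t with
  | zero => 
    intro n X _ _ hX h hc
    obtain ⟨Y, _, _, h1, -, -, h2⟩ := shift2 I X
    refine ⟨LC.torsion I 0, h2 hX (lemD0 I n Y ?_ ?_)⟩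
    · intro j hj; have := h (j+1) (by omega); exact (h1 j).some.toEquiv.subsingleton
    · intro j; exact (hc (j+1) (by omega)).congr (h1 j).some.symm
  | succ t ih =>
    intro n X _ _ hX h hc
    obtain ⟨Y, _, _, h1, h2, -, -⟩ := shift2 I X
    refine Cof.congr (h1 t).some (ih n Y (h2 (hc 0 (by omega)).2 hX) ?_ ?_)
    · intro j hj; have := h (j+1) (by omega); exact (h1 j).some.toEquiv.subsingleton
    · intro j hj; exact (hc (j+1) (by omega)).congr (h1 j).some.symm
end D3
end CLC

set_option linter.all false
namespace CLC
section D4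
variable {R : Type u} [CommRing R] 
variable {X Y M N L : Type u} [AddCommGroup X] [Module R X] [AddCommGroup M] [Module R M]
   [AddCommGroup Y] [Module R Y] [AddCommGroup N] [Module R N]
   [AddCommGroup L] [Module R L]

/-- elements killed by `s` -/
def kl (s : Set R) (X : Type u) [AddCommGroup X] [Module R X] : Submodule R X where
  carrier := {x | ∀ a ∈ s, a • x = 0}
  zero_mem' := by simp
  add_mem' := by intro a b ha hb c hc; rw [smul_add, ha c hc, hb c hc, add_zero]
  smul_mem' := by intro r x hx a ha; rw [smul_comm, hx a ha, smul_zero]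
lemma mem_kl {s : Set R} {x : X} : x ∈ kl s X ↔ ∀ a ∈ s, a • x = 0 := Iff.rfl
lemma kl_span (s : Set R) : kl (Ideal.span s : Set R) X = kl s X := by
  ext x
  constructor
  · intro h a ha; exact h a (Ideal.subset_span ha)
  · intro h a ha
    induction ha using Submodule.span_induction with
    | mem y hy => exact h y hy
    | zero => simp
    | add y z _ _ h1 h2 => rw [add_smul, h1, h2, add_zero]
    | smul r y _ h1 => rw [smul_eq_mul, mul_smul, h1, smul_zero]
lemma kl_mono {s t : Set R} (h : s ⊆ t) : kl t X ≤ kl s X := fun x hx a ha => hx a (h ha)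

lemma art_of_ker (x : R) (hX : ∀ y : X, ∃ n : ℕ, x ^ n • y = 0) [IsArtinian R (LinearMap.ker (ml x X))] :
    IsArtinian R X := by
  rw [← monotone_stabilizes_iff_artinian]
  intro B
  have hB : ∀ i j, i ≤ j → (OrderDual.ofDual (B j) : Submodule R X) ≤ OrderDual.ofDual (B i) := fun i j h => B.monotone h
  let U : ℕ → ℕ → Submodule R (LinearMap.ker (ml x X)) := fun j n =>
    ((OrderDual.ofDual (B j) : Submodule R X) ⊓ LinearMap.ker (ml (x^(n+1)) X)).map (ml (x^n) X) |>.comap (LinearMap.ker (ml x X)).subtype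
  have hU : ∀ j n y, y ∈ U j n ↔ ∃ b ∈ (OrderDual.ofDual (B j) : Submodule R X), x^(n+1) • b = 0 ∧ x ^ n • b = (y:X) := by
    intro j n y
    constructor
    · rintro ⟨b, ⟨h1, h2⟩, h3⟩; exact ⟨b, h1, h2, h3⟩
    · rintro ⟨b, h1, h2, h3⟩; exact ⟨b, ⟨h1, h2⟩, h3⟩
  have hUj : ∀ i j n, i ≤ j → U j n ≤ U i n := by
    intro i j n hij y hy
    rw [hU] at hy ⊢
    obtain ⟨b, h1, h2, h3⟩ := hy
    exact ⟨b, hB i j hij h1, h2, h3⟩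
  have hUn1 : ∀ j n, U j (n+1) ≤ U j n := by
    intro j n y hy
    rw [hU] at hy ⊢
    obtain ⟨b, h1, h2, h3⟩ := hy
    refine ⟨x • b, Submodule.smul_mem _ _ h1, ?_, ?_⟩
    · rw [smul_smul, ← pow_succ]; exact h2
    · rw [smul_smul, ← pow_succ]; exact h3
  have hUn : ∀ j n m, n ≤ m → U j m ≤ U j n := fun j n m h => antitone_nat_of_succ_le (hUn1 j) h
  obtain ⟨k, hk⟩ := IsArtinian.monotone_stabilizes (R := R) (M := LinearMap.ker (ml x X))
    ⟨fun k => OrderDual.toDual (U k k), fun a b h => (hUj a b b h).trans (hUn a a b h)⟩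
  have hk' : ∀ m, k ≤ m → U k k = U m m := hk
  choose c hc using fun n => IsArtinian.monotone_stabilizes (R := R) (M := LinearMap.ker (ml x X))
    ⟨fun j => OrderDual.toDual (U j n), fun a b h => (hUj a b n h)⟩
  have hc' : ∀ n m, c n ≤ m → U (c n) n = U m n := hc
  let J := max k ((Finset.range k).sup c)
  have key : ∀ j ≥ J, ∀ n, U J n ≤ U j n := by
    intro j hj n
    by_cases hn : n < k
    · have h1 : c n ≤ J := le_max_of_le_right (Finset.le_sup (f := c) (Finset.mem_range.2 hn))
      rw [← hc' n J h1, ← hc' n j (h1.trans hj)]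
    · have h1 : k ≤ J := le_max_left _ _
      calc U J n ≤ U k n := hUj _ _ _ h1
        _ ≤ U k k := hUn _ _ _ (by omega)
        _ = U (max j n) (max j n) := hk' _ (by have := hj.trans' h1; omega)
        _ ≤ U j (max j n) := hUj _ _ _ (le_max_left _ _)
        _ ≤ U j n := hUn _ _ _ (le_max_right _ _)
  refine ⟨J, fun j hj => ?_⟩
  refine le_antisymm (B.monotone hj) ?_
  change (OrderDual.ofDual (B J) : Submodule R X) ≤ OrderDual.ofDual (B j)
  have : ∀ n : ℕ, ∀ b ∈ (OrderDual.ofDual (B J) : Submodule R X), x ^ n • b = 0 → b ∈ (OrderDual.ofDual (B j) : Submodule R X) := by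
    intro n
    induction n with
    | zero => intro b _ hb; rw [pow_zero, one_smul] at hb; rw [hb]; exact zero_mem _
    | succ n ih =>
      intro b hb hb0
      have h1 : (⟨x ^ n • b, by rw [LinearMap.mem_ker, ml_apply, smul_smul, ← pow_succ']; exact hb0⟩ : LinearMap.ker (ml x X)) ∈ U J n :=
        (hU _ _ _).2 ⟨b, hb, hb0, rfl⟩
      obtain ⟨b', h2, h3, h4⟩ := (hU _ _ _).1 (key j hj n h1)
      have h5 := ih (b - b') (Submodule.sub_mem _ hb (hB _ _ hj h2)) (by rw [smul_sub, h4]; exact sub_self _)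
      have := Submodule.add_mem _ h5 h2
      rwa [sub_add_cancel] at this
  intro b hb
  obtain ⟨n, hn⟩ := hX b
  exact this n b hb hn

lemma art_of_kl (s : Finset R) (hX : ∀ x ∈ s, ∀ y : X, ∃ n : ℕ, x ^ n • y = 0) (h : IsArtinian R (kl (s : Set R) X)) :
    IsArtinian R X := by
  classical
  induction s using Finset.induction_on with
  | empty =>
    have : kl ((∅ : Finset R) : Set R) X = ⊤ := by
      rw [eq_top_iff]; intro x _; rw [mem_kl]; simp
    rw [this] at h
    exact isArtinian_of_linearEquiv Submodule.topEquiv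
  | insert a s ha ih =>
    apply ih (fun x hx => hX x (by simp [hx]))
    have : IsArtinian R (LinearMap.ker (ml a (kl (s : Set R) X))) := by
      let f : LinearMap.ker (ml a (kl (s : Set R) X)) →ₗ[R] kl ((insert a s : Finset R) : Set R) X :=
        LinearMap.codRestrict _ ((kl (s : Set R) X).subtype ∘ₗ Submodule.subtype _) (by
          intro y b hb
          rw [Finset.coe_insert] at hb
          rcases hb with rfl | hb
          · exact congrArg Subtype.val y.2
          · exact y.1.2 b hb)
      exact isArtinian_of_injective f (fun p q hpq => by have h3 := congrArg Subtype.val hpq; exact Subtype.ext (Subtype.ext h3))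
    refine art_of_ker a fun y => ?_
    obtain ⟨n, hn⟩ := hX a (by simp) y
    exact ⟨n, Subtype.ext hn⟩

lemma art_of_kl_ideal [IsNoetherianRing R] (I : Ideal R) (hX : ∀ y : X, y ∈ Gam I X) (h : IsArtinian R (kl (I : Set R) X)) :
    IsArtinian R X := by
  obtain ⟨s, rfl⟩ := IsNoetherian.noetherian I
  have h' : IsArtinian R (kl (s : Set R) X) := by rw [← kl_span]; exact h
  refine art_of_kl s (fun x hx y => ?_) h'
  obtain ⟨n, hn⟩ := hX y
  exact ⟨n, hn _ (Ideal.pow_mem_pow (Ideal.subset_span hx) n)⟩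

lemma fin_kl_pow [IsNoetherianRing R] (I : Ideal R) (h : Module.Finite R (kl (I : Set R) X)) (k : ℕ) :
    Module.Finite R (kl ((I ^ k : Ideal R) : Set R) X) := by
  induction k with
  | zero =>
    have : kl ((I ^ 0 : Ideal R) : Set R) X = ⊥ := by
      rw [eq_bot_iff]; intro x hx
      have := hx 1 (by simp)
      simpa using this
    rw [this]; infer_instance
  | succ k ih =>
    obtain ⟨s, hs⟩ := IsNoetherian.noetherian I
    let f : kl ((I ^ (k+1) : Ideal R) : Set R) X →ₗ[R] (s → kl ((I ^ k : Ideal R) : Set R) X) :=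
      LinearMap.pi fun a => LinearMap.codRestrict _ (ml (a : R) X ∘ₗ Submodule.subtype _) (by
        intro y b hb
        have := y.2 (b * a) (by 
          rw [pow_succ]
          exact Ideal.mul_mem_mul hb (hs ▸ Ideal.subset_span a.2))
        rw [mul_smul] at this
        exact this)
    have h1 : Function.Exact (LinearMap.ker f).subtype f := LinearMap.exact_subtype_ker_map f
    refine fin_exact h1 ?_ inferInstance
    let g : LinearMap.ker f →ₗ[R] kl (I : Set R) X := LinearMap.codRestrict _ (Submodule.subtype _ ∘ₗ Submodule.subtype _) (by
      intro y
      have hks : kl (I : Set R) X = kl (s : Set R) X := by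
        rw [← hs]; exact kl_span _
      rw [hks]
      intro a ha
      have := congrFun y.2 ⟨a, ha⟩
      exact congrArg Subtype.val this)
    exact fin_inj (f := g) (fun p q hpq => by have h3 := congrArg Subtype.val hpq; exact Subtype.ext (Subtype.ext h3)) h

/-- `0 :_A I` f.g. and `I^k A = 0` implies f.g. -/
lemma fin_of_kl_of_pow [IsNoetherianRing R] (I : Ideal R) (h : Module.Finite R (kl (I : Set R) X)) {k : ℕ}
    (hk : ∀ a ∈ I ^ k, ∀ x : X, a • x = 0) : Module.Finite R X := by
  have := fin_kl_pow I h k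
  have h2 : kl ((I ^ k : Ideal R) : Set R) X = ⊤ := by
    rw [eq_top_iff]; intro x _ a ha; exact hk a ha x
  rw [h2] at this
  exact Module.Finite.equiv Submodule.topEquiv

noncomputable def homEquiv (I : Ideal R) (X : Type u) [AddCommGroup X] [Module R X] : 
    EX R (R ⧸ I) X 0 ≃ₗ[R] kl (I : Set R) X :=
  (EX.hom₀ (R ⧸ I) X).trans
   (LinearEquiv.ofBijective (LinearMap.codRestrict (kl (I : Set R) X) (LinearMap.applyₗ (1 : R ⧸ I)) (by
      intro f a ha
      rw [LinearMap.applyₗ_apply_apply, ← map_smul]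
      have : a • (1 : R ⧸ I) = 0 := by
        change Ideal.Quotient.mk I (a * 1) = 0
        rw [mul_one]; exact Ideal.Quotient.eq_zero_iff_mem.2 ha
      rw [this, map_zero])) (by
    constructor
    · intro f g hfg
      ext
      exact congrArg Subtype.val hfg
    · intro y
      refine ⟨(Submodule.liftQ I (LinearMap.toSpanSingleton R X y) fun a ha => y.2 a ha), Subtype.ext ?_⟩
      change (1 : R) • (y : X) = y
      rw [one_smul]))

lemma fin_kl_iff (I : Ideal R) : Module.Finite R (kl (I : Set R) X) ↔ Module.Finite R (EX R (R ⧸ I) X 0) :=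
  Module.Finite.equiv_iff (homEquiv I X).symm

/-- Attached-primes lemma -/
lemma lemAV [IsNoetherianRing R] (I : Ideal R) [IsArtinian R X] (h : Module.Finite R (kl (I : Set R) X)) :
    ∃ S : Finset (Ideal R), (∀ p ∈ S, p.IsPrime ∧ ¬ I ≤ p) ∧ ∀ x ∈ I, (∀ p ∈ S, x ∉ p) →
      Module.Finite R (X ⧸ LinearMap.range (ml x X)) := by
  classical
  suffices H : ∀ B : Submodule R X, ∃ S : Finset (Ideal R), (∀ p ∈ S, p.IsPrime ∧ ¬ I ≤ p) ∧ ∀ x ∈ I, (∀ p ∈ S, x ∉ p) →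
      ∃ F : Submodule R X, F.FG ∧ B ≤ F ⊔ B.map (ml x X) by
    obtain ⟨S, h1, h2⟩ := H ⊤
    refine ⟨S, h1, fun x hx hxS => ?_⟩
    obtain ⟨F, hF, hle⟩ := h2 x hx hxS
    have : Module.Finite R F := Module.Finite.iff_fg.2 hF
    refine Module.Finite.of_surjective ((LinearMap.range (ml x X)).mkQ ∘ₗ F.subtype) ?_
    intro y
    obtain ⟨y, rfl⟩ := Submodule.mkQ_surjective _ y
    obtain ⟨f, hf, z, hz, rfl⟩ := Submodule.mem_sup.1 (hle (trivial : y ∈ ⊤))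
    refine ⟨⟨f, hf⟩, ?_⟩
    rw [map_add]
    obtain ⟨w, _, rfl⟩ := hz
    have : (LinearMap.range (ml x X)).mkQ (ml x X w) = 0 := (Submodule.Quotient.mk_eq_zero _).2 ⟨w, rfl⟩
    rw [this, add_zero]; rfl
  refine IsArtinian.induction (R := R) (M := X) fun B ih => ?_
  by_cases hB0 : B = ⊥
  · exact ⟨∅, by simp, fun x hx _ => ⟨⊥, Submodule.fg_bot, by simp [hB0]⟩⟩
  by_cases hdec : ∃ C1 C2 : Submodule R X, C1 < B ∧ C2 < B ∧ B ≤ C1 ⊔ C2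
  · obtain ⟨C1, C2, h1, h2, h3⟩ := hdec
    obtain ⟨S1, hS1, hx1⟩ := ih C1 h1
    obtain ⟨S2, hS2, hx2⟩ := ih C2 h2
    refine ⟨S1 ∪ S2, ?_, fun x hx hxS => ?_⟩
    · intro p hp
      rcases Finset.mem_union.1 hp with hp | hp
      exacts [hS1 p hp, hS2 p hp]
    · obtain ⟨F1, hF1, hl1⟩ := hx1 x hx (fun p hp => hxS p (Finset.mem_union_left _ hp))
      obtain ⟨F2, hF2, hl2⟩ := hx2 x hx (fun p hp => hxS p (Finset.mem_union_right _ hp))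
      refine ⟨F1 ⊔ F2, hF1.sup hF2, h3.trans (sup_le (hl1.trans ?_) (hl2.trans ?_))⟩
      · exact sup_le_sup le_sup_left (Submodule.map_mono h1.le)
      · exact sup_le_sup le_sup_right (Submodule.map_mono h2.le)
  -- B is sum-irreducible
  have hdich : ∀ r : R, B ≤ B.map (ml r X) ∨ ∃ n : ℕ, ∀ b ∈ B, r ^ n • b = 0 := by
    intro r
    have hmapB : ∀ n : ℕ, B.map (ml (r^n) X) ≤ B := by
      rintro n _ ⟨b, hb, rfl⟩; exact B.smul_mem _ hb
    have hanti : ∀ a b : ℕ, a ≤ b → B.map (ml (r^b) X) ≤ B.map (ml (r^a) X) := by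
      rintro a b hab _ ⟨y, hy, rfl⟩
      refine ⟨r^(b-a) • y, B.smul_mem _ hy, ?_⟩
      rw [ml_apply, ml_apply, smul_smul, ← pow_add, Nat.add_sub_cancel' hab]
    obtain ⟨n, hn⟩ := IsArtinian.monotone_stabilizes (R := R) (M := X)
      ⟨fun n => OrderDual.toDual (B.map (ml (r^n) X)), hanti⟩
    have hn' : ∀ m, n ≤ m → B.map (ml (r^n) X) = B.map (ml (r^m) X) := hn
    have hsum : B ≤ B.map (ml (r^n) X) ⊔ (B ⊓ LinearMap.ker (ml (r^n) X)) := by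
      intro b hb
      have : r^n • b ∈ B.map (ml (r^(n+n)) X) := by rw [← hn' (n+n) (by omega)]; exact ⟨b, hb, rfl⟩
      obtain ⟨c, hc, hcb⟩ := this
      rw [ml_apply, pow_add, mul_smul] at hcb
      refine Submodule.mem_sup.2 ⟨r^n • c, ⟨c, hc, rfl⟩, b - r^n • c, ⟨B.sub_mem hb (B.smul_mem _ hc), ?_⟩, by abel⟩
      rw [SetLike.mem_coe, LinearMap.mem_ker, ml_apply, smul_sub, hcb, sub_self]
    by_cases h1 : B ≤ B.map (ml (r^n) X)
    · left
      by_cases hn0 : n = 0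
      · have : B.map (ml (r^0) X) = B.map (ml (r^1) X) := by have := hn' 1 (by omega); rwa [hn0] at this
        rw [hn0, this, pow_one] at h1; exact h1
      · have := h1.trans (hanti 1 n (by omega)); rwa [pow_one] at this
    · right
      by_cases h2 : B ≤ B ⊓ LinearMap.ker (ml (r^n) X)
      · exact ⟨n, fun b hb => (h2 hb).2⟩
      · exact absurd ⟨_, _, lt_of_le_not_ge (hmapB n) h1, lt_of_le_not_ge inf_le_left h2, hsum⟩ hdec
  let p : Ideal R := B.annihilator.radical
  have hp : ∀ r, r ∈ p ↔ ∃ n : ℕ, ∀ b ∈ B, r ^ n • b = 0 := by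
    intro r
    simp only [p, Ideal.mem_radical_iff, Submodule.mem_annihilator]
  have hprime : p.IsPrime := by
    refine ⟨?_, ?_⟩
    · intro htop
      obtain ⟨n, hn⟩ := (hp 1).1 (htop ▸ trivial)
      apply hB0; rw [eq_bot_iff]; intro b hb
      have := hn b hb
      simpa using this
    · intro r s hrs
      by_contra hcon
      push Not at hcon
      have hr := (hdich r).resolve_right (fun h => hcon.1 ((hp r).2 h))
      have hs := (hdich s).resolve_right (fun h => hcon.2 ((hp s).2 h))
      obtain ⟨n, hn⟩ := (hp _).1 hrs
      have : ∀ k : ℕ, ∀ b ∈ B, ∃ c ∈ B, (r*s)^k • c = b := by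
        intro k
        induction k with
        | zero => intro b hb; exact ⟨b, hb, by simp⟩
        | succ k ihk =>
          intro b hb
          obtain ⟨c, hc, rfl⟩ := ihk b hb
          obtain ⟨d, hd, rfl⟩ := hr hc
          obtain ⟨e, he, rfl⟩ := hs hd
          exact ⟨e, he, by simp only [ml_apply]; rw [pow_succ, mul_smul, mul_smul]⟩
      apply hB0; rw [eq_bot_iff]; intro b hb
      obtain ⟨c, hc, rfl⟩ := this n b hb
      exact hn c hc
  by_cases hIp : I ≤ p
  · obtain ⟨k, hk⟩ := Ideal.exists_pow_le_of_le_radical_of_fg hIp (IsNoetherian.noetherian I)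
    have hBfin : Module.Finite R B := by
      refine fin_of_kl_of_pow (X := B) I ?_ (k := k) (fun a ha b => Subtype.ext (Submodule.mem_annihilator.1 (hk ha) b b.2))
      let f : kl (I : Set R) B →ₗ[R] kl (I : Set R) X := LinearMap.codRestrict _ (B.subtype ∘ₗ Submodule.subtype _)
        (fun y a ha => congrArg Subtype.val (y.2 a ha))
      exact fin_inj (f := f) (fun p q hpq => by have h3 := congrArg Subtype.val hpq; exact Subtype.ext (Subtype.ext h3)) h
    exact ⟨∅, by simp, fun x hx _ => ⟨B, Module.Finite.iff_fg.1 hBfin, le_sup_left⟩⟩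
  · refine ⟨{p}, ?_, fun x hx hxS => ⟨⊥, Submodule.fg_bot, ?_⟩⟩
    · intro q hq; rw [Finset.mem_singleton.1 hq]; exact ⟨hprime, hIp⟩
    · rw [bot_sup_eq]
      exact (hdich x).resolve_right (fun h => hxS p (by simp) ((hp x).2 h))
end D4
end CLC

set_option linter.all false
namespace CLC
section D5
variable {R : Type u} [CommRing R] [IsNoetherianRing R]
variable {X Y M N L : Type u} [AddCommGroup X] [Module R X] [AddCommGroup M] [Module R M]
   [AddCommGroup Y] [Module R Y] [AddCommGroup N] [Module R N]
   [AddCommGroup L] [Module R L]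

lemma avoid (I : Ideal R) (S : Finset (Ideal R)) (hS : ∀ p ∈ S, p.IsPrime ∧ ¬ I ≤ p) :
    ∃ x ∈ I, ∀ p ∈ S, x ∉ p := by
  by_contra hcon
  push Not at hcon
  have h1 : (I : Set R) ⊆ ⋃ p ∈ (S : Set (Ideal R)), (p : Set R) := by
    intro x hx
    obtain ⟨p, hp, hxp⟩ := hcon x hx
    exact Set.mem_biUnion hp hxp
  obtain ⟨p, hp, hle⟩ := (Ideal.subset_union_prime (s := S) (f := fun p => p) ⊥ ⊥ (fun p hp _ _ => (hS p hp).1)).1 h1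
  exact (hS p hp).2 hle

lemma exists_prime_of_not_le_radical {I a : Ideal R} (h : ¬ I ≤ a.radical) : ∃ P : Ideal R, P.IsPrime ∧ a ≤ P ∧ ¬ I ≤ P := by
  by_contra hcon
  push Not at hcon
  apply h
  rw [Ideal.radical_eq_sInf]
  exact le_sInf fun p hp => hcon p hp.2 hp.1

lemma fin_kl_of_inj {I : Ideal R} {f : M →ₗ[R] N} (hf : Function.Injective f) (h : Module.Finite R (kl (I : Set R) N)) :
    Module.Finite R (kl (I : Set R) M) := by
  rw [fin_kl_iff] at h ⊢
  exact fin_inj (EX.map0_inj hf) h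

variable [IsLocalRing R]
open IsLocalRing
lemma art_of_killed [Module.Finite R X] (h : ∀ a ∈ maximalIdeal R, ∀ x : X, a • x = 0) : IsArtinian R X := by
  have ht : Module.IsTorsionBySet R X (maximalIdeal R : Set R) := fun x a => h a a.2 x
  letI := ht.module
  letI := Ideal.Quotient.field (maximalIdeal R)
  have hsc : IsScalarTower R (R ⧸ maximalIdeal R) X := ht.isScalarTower
  have h1 : Module.Finite (R ⧸ maximalIdeal R) X := Module.Finite.of_restrictScalars_finite R _ X
  have h3 : IsArtinian (R ⧸ maximalIdeal R) X := inferInstance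
  exact isArtinian_of_surjective_algebraMap (S := R) (R := R ⧸ maximalIdeal R) (M := X) Ideal.Quotient.mk_surjective

lemma art_of_fin_tors [Module.Finite R X] (h : ∀ x : X, x ∈ Gam (maximalIdeal R) X) : IsArtinian R X := by
  refine art_of_kl_ideal (maximalIdeal R) h ?_
  exact art_of_killed fun a ha x => Subtype.ext (x.2 a ha)

lemma Gam_mono {I J : Ideal R} (h : I ≤ J) : Gam J X ≤ Gam I X := fun x ⟨n, hn⟩ => ⟨n, fun a ha => hn a (Ideal.pow_right_mono h n ha)⟩

lemma art_of_tors {I : Ideal R} (hI : I ≤ maximalIdeal R) (h : ∀ x : X, x ∈ Gam (maximalIdeal R) X) 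
    (hk : Module.Finite R (kl (I : Set R) X)) : IsArtinian R X := by
  refine art_of_kl_ideal I (fun x => Gam_mono hI (h x)) ?_
  exact art_of_fin_tors (tors_of_inj (Submodule.subtype_injective _) h)

lemma killed_sup {a : Ideal R} {x : R} (ha : ∀ r ∈ a, ∀ y : X, r • y = 0) : 
    ∀ r ∈ a ⊔ Ideal.span {x}, ∀ y : LinearMap.ker (ml x X), r • y = 0 := by
  intro r hr y
  obtain ⟨b, hb, c, hc, rfl⟩ := Submodule.mem_sup.1 hr
  obtain ⟨d, rfl⟩ := Ideal.mem_span_singleton'.1 hc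
  apply Subtype.ext
  change (b + d * x) • (y : X) = 0
  have : x • (y : X) = 0 := y.2
  rw [add_smul, ha b hb, mul_smul, this, smul_zero, add_zero]

lemma lt_sup_of {a P : Ideal R} {x : R} (h : a ≤ P) (hx : x ∉ P) : a < a ⊔ Ideal.span {x} := by
  refine lt_of_le_not_ge le_sup_left fun hle => hx (h (hle ?_))
  exact (le_sup_right : _ ≤ a ⊔ Ideal.span {x}) (Ideal.mem_span_singleton_self x)

lemma critB0 {I : Ideal R} (hI : I ≤ maximalIdeal R) (a : Ideal R) : ∀ (X : Type u) [AddCommGroup X] [Module R X],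
    (∀ r ∈ a, ∀ y : X, r • y = 0) → (∀ x : X, x ∈ Gam (maximalIdeal R) X) → Module.Finite R (kl (I : Set R) X) →
    ∀ i, Module.Finite R (EX R (R ⧸ I) X i) := by
  classical
  refine IsNoetherian.induction (R := R) (M := R) (P := fun a : Ideal R => ∀ (X : Type u) [AddCommGroup X] [Module R X],
    (∀ r ∈ a, ∀ y : X, r • y = 0) → (∀ x : X, x ∈ Gam (maximalIdeal R) X) → Module.Finite R (kl (I : Set R) X) →
    ∀ i, Module.Finite R (EX R (R ⧸ I) X i)) (fun (a : Ideal R) ih => ?_) a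
  intro X _ _ ha hm hk
  by_cases hIa : I ≤ a.radical
  · obtain ⟨k, hk'⟩ := Ideal.exists_pow_le_of_le_radical_of_fg hIa (IsNoetherian.noetherian I)
    have := fin_of_kl_of_pow I hk (k := k) fun r hr x => ha r (hk' hr) x
    exact fun i => EX.finite i
  · obtain ⟨P, hP, haP, hIP⟩ := exists_prime_of_not_le_radical hIa
    have := art_of_tors hI hm hk
    obtain ⟨S, hS, hfin⟩ := lemAV I hk
    obtain ⟨x, hxI, hxS⟩ := avoid I (insert P S) (by
      intro p hp
      rcases Finset.mem_insert.1 hp with rfl | hp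
      exacts [⟨hP, hIP⟩, hS p hp])
    have hZ := hfin x hxI fun p hp => hxS p (Finset.mem_insert_of_mem hp)
    refine lemC hxI ?_ fun i => EX.finite i
    exact ih _ (lt_sup_of haP (hxS P (by simp))) _ (killed_sup ha) (tors_of_inj (Submodule.subtype_injective _) hm)
      (fin_kl_of_inj (Submodule.subtype_injective _) hk)
end D5
end CLC

set_option linter.all false
namespace CLC
section D6
variable {R : Type u} [CommRing R] [IsNoetherianRing R]
open IsLocalRing

lemma locAV {I a P : Ideal R} [hP : P.IsPrime] (hmin : P ∈ (I ⊔ a).minimalPrimes) 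
    (X : Type u) [AddCommGroup X] [Module R X]
    (ha : ∀ r ∈ a, ∀ y : X, r • y = 0) (ht : ∀ x : X, x ∈ Gam I X) (hk : Module.Finite R (kl (I : Set R) X)) :
    ∃ S : Finset (Ideal R), (∀ p ∈ S, p.IsPrime ∧ ¬ I ≤ p) ∧ ∀ x ∈ I, (∀ p ∈ S, x ∉ p) →
      ∃ F : Submodule R X, F.FG ∧ ∀ z, ∃ s ∉ P, s • z ∈ F ⊔ LinearMap.range (ml x X) := by
  classical
  let S' := Localization.AtPrime P
  let N := LocalizedModule P.primeCompl X
  let f : X →ₗ[R] N := LocalizedModule.mkLinearMap P.primeCompl X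
  have hunit : ∀ (W : Submodule S' N) (s : P.primeCompl) (y : N), (s : R) • y ∈ W → y ∈ W := by
    intro W s y h
    rw [← algebraMap_smul S' (s : R) y] at h
    exact (Submodule.smul_mem_iff_of_isUnit W (IsLocalization.map_units S' s)).1 h
  have hzero : ∀ (s : P.primeCompl) (y : N), (s : R) • y = 0 → y = 0 := fun s y h => 
    (Submodule.mem_bot S').1 (hunit ⊥ s y ((Submodule.mem_bot S').2 h))
  have hsurj : ∀ y : N, ∃ (z : X) (s : P.primeCompl), (s : R) • y = f z := fun y => by
    obtain ⟨⟨z, s⟩, h⟩ := IsLocalizedModule.surj P.primeCompl f y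
    exact ⟨z, s, h⟩
  have hf0 : ∀ z : X, f z = 0 → ∃ c ∉ P, c • z = 0 := fun z h => by
    obtain ⟨c, hc⟩ := (IsLocalizedModule.eq_zero_iff P.primeCompl f).1 h
    exact ⟨c, c.2, hc⟩
  have hmax : (P.map (algebraMap R S')) = maximalIdeal S' := Localization.AtPrime.map_eq_maximalIdeal
  have h1 : ∀ y : N, y ∈ Gam (maximalIdeal S') N := by
    rw [← support_iff_tors]
    intro Q hQ
    obtain ⟨y, hy⟩ := Module.mem_support_iff_exists_annihilator.1 hQ
    obtain ⟨z, s, hs⟩ := hsurj y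
    have hu : algebraMap R S' s ∉ Q.asIdeal := fun h => Q.2.ne_top (Ideal.eq_top_of_isUnit_mem _ h (IsLocalization.map_units S' s))
    have hmem : ∀ b : R, b • z = 0 → algebraMap R S' b ∈ Q.asIdeal := by
      intro b hb
      apply hy
      rw [Submodule.mem_annihilator_span_singleton, algebraMap_smul]
      apply hzero s
      rw [smul_comm, hs, ← map_smul, hb, map_zero]
    have hle : I ⊔ a ≤ Q.asIdeal.comap (algebraMap R S') := by
      refine sup_le (fun b hb => ?_) (fun b hb => hmem b (ha b hb z))
      obtain ⟨n, hn⟩ := ht z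
      have := hmem (b^n) (hn _ (Ideal.pow_mem_pow hb n))
      rw [map_pow] at this
      exact Q.2.mem_of_pow_mem n this
    have hq : (Q.asIdeal.comap (algebraMap R S')).IsPrime := inferInstance
    have hqP : Q.asIdeal.comap (algebraMap R S') ≤ P := by
      intro b hb
      by_contra hbP
      exact Q.2.ne_top (Ideal.eq_top_of_isUnit_mem _ hb (IsLocalization.map_units S' (⟨b, hbP⟩ : P.primeCompl)))
    have := hmin.2 ⟨hq, hle⟩ hqP
    change maximalIdeal S' ≤ Q.asIdeal
    rw [← hmax]
    exact Ideal.map_le_iff_le_comap.2 this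
  let I' : Ideal S' := I.map (algebraMap R S')
  have hI' : I' ≤ maximalIdeal S' := by
    rw [← hmax]; exact Ideal.map_mono (le_sup_left.trans hmin.1.2)
  have h2 : Module.Finite S' (kl (I' : Set S') N) := by
    obtain ⟨T, hT⟩ := Module.Finite.iff_fg.1 hk
    obtain ⟨G, hG⟩ := IsNoetherian.noetherian I
    have hle : kl (I' : Set S') N ≤ Submodule.span S' (f '' T) := by
      intro y hy
      obtain ⟨z, s, hs⟩ := hsurj y
      have hc : ∀ b : R, ∃ c, c ∉ P ∧ (b ∈ I → c • b • z = 0) := by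
        intro b
        by_cases hb : b ∈ I
        · obtain ⟨c, hc, hc'⟩ := hf0 (b • z) (by
            rw [map_smul, ← hs, smul_comm, ← algebraMap_smul S' b y, hy _ (Ideal.mem_map_of_mem _ hb), smul_zero])
          exact ⟨c, hc, fun _ => hc'⟩
        · exact ⟨1, P.primeCompl.one_mem, fun h => absurd h hb⟩
      choose c hcP hc using hc
      let t := ∏ b ∈ G, c b
      have htP : t ∈ P.primeCompl := Submonoid.prod_mem _ fun b _ => hcP b
      have htz : t • z ∈ kl (I : Set R) X := by
        have : kl (I : Set R) X = kl (G : Set R) X := by rw [← hG]; exact kl_span _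
        rw [this]
        intro b hb
        have hbI : b ∈ I := hG ▸ Submodule.subset_span hb
        obtain ⟨d, hd⟩ := Finset.dvd_prod_of_mem c hb
        change b • (∏ b ∈ G, c b) • z = 0
        rw [hd, smul_comm, mul_comm, mul_smul, hc b hbI, smul_zero]
      rw [← hT] at htz
      have h3 : f (t • z) ∈ Submodule.span S' (f '' T) := by
        have : f (t • z) ∈ (Submodule.span R (T : Set X)).map f := ⟨_, htz, rfl⟩
        rw [Submodule.map_span] at this
        exact Submodule.span_le_restrictScalars R S' _ this
      apply hunit _ s
      apply hunit _ ⟨t, htP⟩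
      rw [hs, ← map_smul]; exact h3
    have : Module.Finite S' (Submodule.span S' (f '' T)) := Module.Finite.span_of_finite S' (T.finite_toSet.image f)
    exact fin_inj (Submodule.inclusion_injective hle) this
  have hart : IsArtinian S' N := art_of_tors hI' h1 h2
  obtain ⟨S1, hS1, hfin⟩ := lemAV I' h2
  refine ⟨S1.image (fun q => q.comap (algebraMap R S')), ?_, ?_⟩
  · intro p hp
    obtain ⟨q, hq, rfl⟩ := Finset.mem_image.1 hp
    have := (hS1 q hq).1
    exact ⟨inferInstance, fun h => (hS1 q hq).2 (Ideal.map_le_iff_le_comap.2 h)⟩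
  · intro x hx hxS
    have hfinx := hfin (algebraMap R S' x) (Ideal.mem_map_of_mem _ hx) (fun p hp h => 
      hxS _ (Finset.mem_image.2 ⟨p, hp, rfl⟩) h)
    obtain ⟨G, hG⟩ := Module.Finite.fg_top (R := S') (M := N ⧸ LinearMap.range (ml (algebraMap R S' x) N))
    choose y hy using fun g : N ⧸ LinearMap.range (ml (algebraMap R S' x) N) => Submodule.mkQ_surjective _ g
    choose z s hs using hsurj
    let F : Submodule R X := Submodule.span R ((G.image fun g => z (y g) : Finset X) : Set X)
    let W := F ⊔ LinearMap.range (ml x X)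
    let Wl : Submodule S' N := W.localized' S' P.primeCompl f
    have hfW : ∀ w ∈ W, f w ∈ Wl := fun w hw => Submodule.mem_localized' .. |>.2 ⟨w, hw, 1, by simp⟩
    have hr : LinearMap.range (ml (algebraMap R S' x) N) ≤ Wl := by
      rintro _ ⟨v, rfl⟩
      apply hunit _ (s v)
      rw [ml_apply, algebraMap_smul, smul_comm, hs, ← map_smul]
      exact hfW _ (Submodule.mem_sup_right ⟨z v, rfl⟩)
    have htop : ∀ v : N, v ∈ Wl := by
      intro v
      have h5 : (⊤ : Submodule S' (N ⧸ LinearMap.range (ml (algebraMap R S' x) N))) ≤ Wl.map (Submodule.mkQ _) := by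
        rw [← hG, Submodule.span_le]
        intro g hg
        refine ⟨y g, ?_, hy g⟩
        apply hunit _ (s (y g))
        rw [hs]
        exact hfW _ (Submodule.mem_sup_left (Submodule.subset_span (Finset.mem_coe.2 (Finset.mem_image_of_mem _ hg))))
      obtain ⟨w, hw, hwv⟩ := h5 (trivial : Submodule.mkQ _ v ∈ ⊤)
      have : v - w ∈ LinearMap.range (ml (algebraMap R S' x) N) := (Submodule.Quotient.eq _).1 hwv.symm
      have := Wl.add_mem (hr this) hw
      rwa [sub_add_cancel] at this
    refine ⟨F, ⟨_, rfl⟩, fun v => ?_⟩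
    obtain ⟨w, hw, t, hwt⟩ := (Submodule.mem_localized' ..).1 (htop (f v))
    have h6 : f w = (t : R) • f v := by
      rw [← hwt]; exact (IsLocalizedModule.mk'_cancel' f w t).symm
    obtain ⟨c, hc, hc'⟩ := hf0 (w - (t : R) • v) (by rw [map_sub, map_smul, h6, sub_self])
    refine ⟨c * t, P.primeCompl.mul_mem hc t.2, ?_⟩
    rw [smul_sub, sub_eq_zero] at hc'
    rw [mul_smul, ← hc']
    exact Submodule.smul_mem _ _ hw

variable [IsLocalRing R]
lemma critB {I : Ideal R} (hI : I ≤ maximalIdeal R) (a : Ideal R) : ∀ (X : Type u) [AddCommGroup X] [Module R X],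
    (∀ P Q : Ideal R, P.IsPrime → Q.IsPrime → I ⊔ a ≤ P → P < Q → Q = maximalIdeal R) → 
    (∀ r ∈ a, ∀ y : X, r • y = 0) → (∀ x : X, x ∈ Gam I X) → Module.Finite R (EX R (R ⧸ I) X 0) →
    Module.Finite R (EX R (R ⧸ I) X 1) →
    ∀ i, Module.Finite R (EX R (R ⧸ I) X i) := by
  classical
  refine IsNoetherian.induction (R := R) (M := R) (P := fun a : Ideal R => ∀ (X : Type u) [AddCommGroup X] [Module R X],
    (∀ P Q : Ideal R, P.IsPrime → Q.IsPrime → I ⊔ a ≤ P → P < Q → Q = maximalIdeal R) → 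
    (∀ r ∈ a, ∀ y : X, r • y = 0) → (∀ x : X, x ∈ Gam I X) → Module.Finite R (EX R (R ⧸ I) X 0) →
    Module.Finite R (EX R (R ⧸ I) X 1) →
    ∀ i, Module.Finite R (EX R (R ⧸ I) X i)) (fun (a : Ideal R) ih => ?_) a
  intro X _ _ hdim ha ht h0 h1
  have hk := fin_kl_iff I |>.2 h0
  by_cases hIa : I ≤ a.radical
  · obtain ⟨k, hk'⟩ := Ideal.exists_pow_le_of_le_radical_of_fg hIa (IsNoetherian.noetherian I)
    have := fin_of_kl_of_pow I hk (k := k) fun r hr x => ha r (hk' hr) x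
    exact fun i => EX.finite i
  obtain ⟨P0, hP0, haP, hIP⟩ := exists_prime_of_not_le_radical hIa
  have hfinmin : (I ⊔ a).minimalPrimes.Finite := Ideal.finite_minimalPrimes_of_isNoetherianRing R _
  have hch : ∀ P : Ideal R, ∃ S : Finset (Ideal R), (∀ p ∈ S, p.IsPrime ∧ ¬ I ≤ p) ∧ (P ∈ (I ⊔ a).minimalPrimes → ∀ x ∈ I, (∀ p ∈ S, x ∉ p) →
      ∃ F : Submodule R X, F.FG ∧ ∀ z, ∃ s ∉ P, s • z ∈ F ⊔ LinearMap.range (ml x X)) := by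
    intro P
    by_cases hPm : P ∈ (I ⊔ a).minimalPrimes
    · have hPp : P.IsPrime := hPm.1.1
      obtain ⟨S, hS, h⟩ := locAV hPm X ha ht hk
      exact ⟨S, hS, fun _ => h⟩
    · exact ⟨∅, by simp, fun h => absurd h hPm⟩
  choose S hS hSx using hch
  obtain ⟨x, hxI, hxS⟩ := avoid I (insert P0 (hfinmin.toFinset.biUnion S)) (by
      intro p hp
      rcases Finset.mem_insert.1 hp with rfl | hp
      · exact ⟨hP0, hIP⟩
      · obtain ⟨P, hP, hpP⟩ := Finset.mem_biUnion.1 hp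
        exact hS P p hpP)
  have hxF : ∀ P ∈ (I ⊔ a).minimalPrimes, ∃ F : Submodule R X, F.FG ∧ ∀ z, ∃ s ∉ P, s • z ∈ F ⊔ LinearMap.range (ml x X) := by
    intro P hP
    refine hSx P hP x hxI fun p hp => hxS p (Finset.mem_insert_of_mem (Finset.mem_biUnion.2 ⟨P, hfinmin.mem_toFinset.2 hP, hp⟩))
  have s1 := SES.kerRange (ml x X)
  have s2 := SES.sub (LinearMap.range (ml x X))
  have hU0 := s2.fin_left0 (R ⧸ I) h0
  have hL0 := s1.fin_left0 (R ⧸ I) h0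
  have hL1 := s1.fin_left (R ⧸ I) 0 hU0 h1
  have hL := ih (a ⊔ Ideal.span {x}) (lt_sup_of haP (hxS P0 (by simp))) (LinearMap.ker (ml x X)) 
    (fun P Q hP hQ hle => hdim P Q hP hQ (le_trans (sup_le_sup_left le_sup_left _) hle))
    (killed_sup ha) (tors_of_inj (Submodule.subtype_injective _) ht) hL0 hL1
  have hU1 := s1.fin_right (R ⧸ I) 1 h1 (hL 2)
  have hZ0 := s2.fin_right (R ⧸ I) 0 h0 hU1
  refine lemC hxI hL ?_
  -- Z = X / xX
  choose! F hF hFz using hxF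
  let F0 : Submodule R X := ⨆ P ∈ hfinmin.toFinset, F P
  have hF0 : F0.FG := Submodule.fg_biSup _ _ fun P hP => hF P (hfinmin.mem_toFinset.1 hP)
  let Z0 : Submodule R (X ⧸ LinearMap.range (ml x X)) := F0.map (Submodule.mkQ _)
  have hZ0fin : Module.Finite R Z0 := Module.Finite.iff_fg.2 (hF0.map _)
  have htors : ∀ y : (X ⧸ LinearMap.range (ml x X)) ⧸ Z0, y ∈ Gam (maximalIdeal R) _ := by
    rw [← support_iff_tors]
    intro Q hQ
    obtain ⟨y, hy⟩ := Module.mem_support_iff_exists_annihilator.1 hQ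
    obtain ⟨z, rfl⟩ := Submodule.mkQ_surjective _ y
    obtain ⟨v, rfl⟩ := Submodule.mkQ_surjective _ z
    have hann : ∀ b : R, b • v = 0 → b ∈ Q.asIdeal := by
      intro b hb
      apply hy
      rw [Submodule.mem_annihilator_span_singleton, ← map_smul, ← map_smul, hb, map_zero, map_zero]
    have hle : I ⊔ a ≤ Q.asIdeal := by
      refine sup_le (fun b hb => ?_) (fun b hb => hann b (ha b hb v))
      obtain ⟨n, hn⟩ := ht v
      exact Q.2.mem_of_pow_mem n (hann _ (hn _ (Ideal.pow_mem_pow hb n)))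
    obtain ⟨P, hP, hPQ⟩ := Ideal.exists_minimalPrimes_le hle
    change maximalIdeal R ≤ Q.asIdeal
    rcases eq_or_lt_of_le hPQ with heq | hlt
    · exfalso
      obtain ⟨s, hs, hsv⟩ := hFz P hP v
      apply hs
      rw [heq]
      apply hy
      rw [Submodule.mem_annihilator_span_singleton, ← map_smul, ← map_smul]
      refine (Submodule.Quotient.mk_eq_zero _).2 ?_
      obtain ⟨c, hc, d, hd, hcd⟩ := Submodule.mem_sup.1 hsv
      refine ⟨c, Submodule.mem_iSup_of_mem P (Submodule.mem_iSup_of_mem (hfinmin.mem_toFinset.2 hP) hc), ?_⟩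
      rw [← hcd, map_add]
      have : (LinearMap.range (ml x X)).mkQ d = 0 := (Submodule.Quotient.mk_eq_zero _).2 hd
      rw [this, add_zero]
    · exact (hdim P Q.asIdeal hP.1.1 Q.2 hP.1.2 hlt).ge
  have s3 := SES.sub Z0
  have hW0 := s3.fin_right (R ⧸ I) 0 hZ0 (EX.finite 1)
  have hW := critB0 hI ⊥ _ (by intro r hr y; rw [(Submodule.mem_bot R).1 hr, zero_smul]) htors ((fin_kl_iff I).2 hW0)
  exact fun i => s3.fin_mid _ i (EX.finite i) (hW i)
end D6
end CLC

set_option linter.all false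
namespace CLC
section E1
variable {R : Type u} [CommRing R] [IsNoetherianRing R] [IsLocalRing R]
open IsLocalRing
open scoped Pointwise

/-- dimension of `R/a` as a natural number -/
noncomputable def dm (a : Ideal R) : ℕ := ((ringKrullDim (R ⧸ a)).unbotD 0).toNat

lemma dm_eq {a : Ideal R} (ha : a ≤ maximalIdeal R) : ringKrullDim (R ⧸ a) = (dm a : ℕ∞) := by
  have hne : a ≠ ⊤ := fun h => (maximalIdeal.isMaximal R).ne_top (top_le_iff.1 (h ▸ ha))
  have : Nontrivial (R ⧸ a) := Ideal.Quotient.nontrivial_iff.2 hne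
  have : IsLocalRing (R ⧸ a) := IsLocalRing.of_surjective' (Ideal.Quotient.mk a) Ideal.Quotient.mk_surjective
  have h1 : ringKrullDim (R ⧸ a) ≠ ⊤ := ringKrullDim_ne_top
  have h2 : ringKrullDim (R ⧸ a) ≠ ⊥ := ringKrullDim_ne_bot
  unfold dm
  generalize ringKrullDim (R ⧸ a) = d at *
  obtain ⟨e, rfl⟩ := WithBot.ne_bot_iff_exists.1 h2
  have h3 : e ≠ ⊤ := fun h => h1 (by rw [h]; rfl)
  rw [WithBot.unbotD_coe, ENat.coe_toNat h3]

lemma le_dm_iff {a : Ideal R} (ha : a ≤ maximalIdeal R) {n : ℕ} :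
    n ≤ dm a ↔ ∃ l : LTSeries (PrimeSpectrum.zeroLocus (R := R) a), l.length = n := by
  rw [← Order.le_krullDim_iff, ← ringKrullDim_quotient, dm_eq ha]
  exact ⟨fun h => by exact_mod_cast h, fun h => by exact_mod_cast h⟩

lemma prime_le {p : Ideal R} (hp : p.IsPrime) : p ≤ maximalIdeal R := le_maximalIdeal hp.ne_top

lemma dm_anti {a b : Ideal R} (h : a ≤ b) (hb : b ≤ maximalIdeal R) : dm b ≤ dm a := by
  obtain ⟨l, hl⟩ := (le_dm_iff hb).1 le_rfl
  refine (le_dm_iff (h.trans hb)).2 ⟨l.map (fun x => ⟨x.1, fun y hy => x.2 (h hy)⟩) (fun x y hxy => hxy), hl⟩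

lemma dm_lt {p q : Ideal R} (hp : p.IsPrime) (hq : q.IsPrime) (h : p < q) : dm q + 1 ≤ dm p := by
  obtain ⟨l, hl⟩ := (le_dm_iff (prime_le hq)).1 le_rfl
  let l' : LTSeries (PrimeSpectrum.zeroLocus (R := R) p) :=
    l.map (fun x => ⟨x.1, fun y hy => x.2 (h.le hy)⟩) (fun x y hxy => hxy)
  refine (le_dm_iff (prime_le hp)).2 ⟨l'.cons ⟨⟨p, hp⟩, fun y hy => hy⟩ ?_, ?_⟩
  · change p < l'.head.1.asIdeal
    refine lt_of_lt_of_le h ?_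
    exact l.head.2
  · simp [l']; exact hl

lemma exists_prime_dm {a : Ideal R} (ha : a ≤ maximalIdeal R) : ∃ P : Ideal R, P.IsPrime ∧ a ≤ P ∧ dm P = dm a := by
  obtain ⟨l, hl⟩ := (le_dm_iff ha).1 le_rfl
  have h1 : a ≤ l.head.1.asIdeal := l.head.2
  have h2 := prime_le l.head.1.2
  refine ⟨l.head.1.asIdeal, l.head.1.2, h1, le_antisymm (dm_anti h1 h2) ?_⟩
  have hmono : ∀ i, l.head ≤ l i := fun i => LTSeries.head_le l i
  refine (le_dm_iff h2).2 ⟨⟨l.length, fun i => ⟨(l i).1, hmono i⟩, fun i => l.step i⟩, hl⟩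

lemma dm_eq_zero {q : Ideal R} (hq : q.IsPrime) : dm q = 0 ↔ q = maximalIdeal R := by
  constructor
  · intro h
    by_contra hne
    have := dm_lt hq (maximalIdeal.isMaximal R).isPrime (lt_of_le_of_ne (prime_le hq) hne)
    omega
  · rintro rfl
    by_contra h
    obtain ⟨l, hl⟩ := (le_dm_iff (le_refl (maximalIdeal R))).1 (Nat.one_le_iff_ne_zero.2 h)
    have h1 := l.step ⟨0, by omega⟩
    have h2 : ∀ x : PrimeSpectrum.zeroLocus (R := R) (maximalIdeal R), x.1.asIdeal = maximalIdeal R := fun x =>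
      le_antisymm (prime_le x.1.2) x.2
    have h3 : ∀ x y : PrimeSpectrum.zeroLocus (R := R) (maximalIdeal R), x = y := fun x y =>
      Subtype.ext (PrimeSpectrum.ext ((h2 x).trans (h2 y).symm))
    exact (ne_of_lt h1) (h3 _ _)

lemma dm_eq_zero_iff {a : Ideal R} (ha : a ≤ maximalIdeal R) :
   dm a = 0 ↔ ∀ P : Ideal R, P.IsPrime → a ≤ P → P = maximalIdeal R := by
  constructor
  · intro h P hP haP
    rw [← dm_eq_zero hP]
    have := dm_anti haP (prime_le hP)
    omega
  · intro h
    obtain ⟨P, hP, h1, h2⟩ := exists_prime_dm ha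
    rw [← h2, dm_eq_zero hP, h P hP h1]

lemma dm_le_one_iff {a : Ideal R} (ha : a ≤ maximalIdeal R) : dm a ≤ 1 ↔
    ∀ P Q : Ideal R, P.IsPrime → Q.IsPrime → a ≤ P → P < Q → Q = maximalIdeal R := by
  constructor
  · intro h P Q hP hQ h1 h2
    have h3 := dm_lt hP hQ h2
    have h4 := dm_anti h1 (prime_le hP)
    rw [← dm_eq_zero hQ]; omega
  · intro h
    by_contra hlt
    obtain ⟨l, hl⟩ := (le_dm_iff ha).1 (show 2 ≤ dm a by omega)
    have h1 := l.step ⟨0, by omega⟩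
    have h2 := l.step ⟨1, by omega⟩
    have h3 := h _ _ (l _).1.2 (l _).1.2 (l (Fin.castSucc ⟨0, by omega⟩)).2 h1
    have h4 : (l.toFun (Fin.castSucc ⟨1, by omega⟩)).1.asIdeal < (l.toFun (Fin.succ ⟨1, by omega⟩)).1.asIdeal := h2
    have h5 := prime_le (l.toFun (Fin.succ ⟨1, by omega⟩)).1.2
    have h6 : (l.toFun (Fin.castSucc ⟨1, by omega⟩)).1.asIdeal = maximalIdeal R := h3
    rw [h6] at h4
    exact absurd h5 h4.not_ge

lemma span_le_m {a : Ideal R} (ha : a ≤ maximalIdeal R) {y : R} (hy : y ∈ maximalIdeal R) :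
    a ⊔ Ideal.span {y} ≤ maximalIdeal R := sup_le ha ((Ideal.span_singleton_le_iff_mem _).2 hy)

lemma dm_le_succ {a : Ideal R} (ha : a ≤ maximalIdeal R) {y : R} (hy : y ∈ maximalIdeal R) :
    dm a ≤ dm (a ⊔ Ideal.span {y}) + 1 := by
  have h1 := Module.supportDim_le_supportDim_quotSMulTop_succ (M := R ⧸ a) hy
  have h2 : Module.supportDim R (QuotSMulTop y (R ⧸ a)) ≤ Module.supportDim R (R ⧸ (a ⊔ Ideal.span {y})) := by
    have hle : (a ⊔ Ideal.span {y} : Ideal R) ≤ 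
        LinearMap.ker ((Submodule.mkQ (y • (⊤ : Submodule R (R ⧸ a)))).comp (Submodule.mkQ a)) := by
      refine sup_le (fun r hr => ?_) ((Ideal.span_singleton_le_iff_mem _).2 ?_)
      · rw [LinearMap.mem_ker, LinearMap.comp_apply, show Submodule.mkQ a r = 0 from (Submodule.Quotient.mk_eq_zero _).2 hr, map_zero]
      · rw [LinearMap.mem_ker, LinearMap.comp_apply, Submodule.mkQ_apply, Submodule.mkQ_apply, Submodule.Quotient.mk_eq_zero]
        exact ⟨Submodule.Quotient.mk 1, trivial, by
          change y • (Submodule.Quotient.mk 1 : R ⧸ a) = Submodule.Quotient.mk y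
          rw [← Submodule.Quotient.mk_smul, smul_eq_mul, mul_one]⟩
    refine Module.supportDim_le_of_surjective (Submodule.liftQ _ _ hle) ?_
    rw [← LinearMap.range_eq_top, Submodule.range_liftQ, LinearMap.range_eq_top]
    exact (Submodule.mkQ_surjective _).comp (Submodule.mkQ_surjective _)
  have h3 := h1.trans (add_le_add_left h2 1)
  rw [Module.supportDim_quotient_eq_ringKrullDim, Module.supportDim_quotient_eq_ringKrullDim, dm_eq ha, dm_eq (span_le_m ha hy)] at h3
  exact_mod_cast h3

lemma dm_succ_le {a : Ideal R} (ha : a ≤ maximalIdeal R) {y : R} (hy : y ∈ maximalIdeal R) 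
    (h : ∀ P ∈ a.minimalPrimes, y ∉ P) : dm (a ⊔ Ideal.span {y}) + 1 ≤ dm a := by
  obtain ⟨P, hP, h1, h2⟩ := exists_prime_dm (span_le_m ha hy)
  have hyP : y ∈ P := h1 (Ideal.mem_sup_right (Ideal.mem_span_singleton_self y))
  obtain ⟨Q, hQ, hQP⟩ := Ideal.exists_minimalPrimes_le (le_sup_left.trans h1)
  have hlt : Q < P := lt_of_le_of_ne hQP (fun h' => h Q hQ (h' ▸ hyP))
  have := dm_lt hQ.1.1 hP hlt
  have := dm_anti hQ.1.2 (prime_le hQ.1.1)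
  omega

lemma dm_sup_lt {p : Ideal R} (hp : p.IsPrime) {y : R} (hy : y ∈ maximalIdeal R) 
    (h : y ∉ p) : dm (p ⊔ Ideal.span {y}) + 1 = dm p := by
  refine le_antisymm (dm_succ_le (prime_le hp) hy fun P hP => ?_) (dm_le_succ (prime_le hp) hy)
  rw [Ideal.minimalPrimes_eq_subsingleton_self] at hP
  rw [Set.mem_singleton_iff.1 hP]; exact h

/-- intermediate prime of given dimension -/
lemma exists_dm_pred {p : Ideal R} (hp : p.IsPrime) (h : dm p ≠ 0) : ∃ q : Ideal R, q.IsPrime ∧ p < q ∧ dm q + 1 = dm p := by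
  have hne : p < maximalIdeal R := lt_of_le_of_ne (prime_le hp) (fun h' => h ((dm_eq_zero hp).2 h'))
  obtain ⟨y, hy, hyp⟩ := SetLike.exists_of_lt hne
  obtain ⟨P, hP, h1, h2⟩ := exists_prime_dm (span_le_m (prime_le hp) hy)
  refine ⟨P, hP, lt_of_le_of_ne (le_sup_left.trans h1) fun h' => hyp ?_, by rw [h2, dm_sup_lt hp hy hyp]⟩
  rw [h']; exact h1 (Ideal.mem_sup_right (Ideal.mem_span_singleton_self y))

lemma exists_dm_one {p : Ideal R} (hp : p.IsPrime) (h : dm p ≠ 0) : ∃ q : Ideal R, q.IsPrime ∧ p ≤ q ∧ dm q = 1 := by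
  induction' hn : dm p using Nat.strong_induction_on with n ih generalizing p
  by_cases h1 : n = 1
  · exact ⟨p, hp, le_rfl, hn.trans h1⟩
  obtain ⟨q, hq, hpq, hd⟩ := exists_dm_pred hp h
  obtain ⟨q', a, b, c⟩ := ih (dm q) (by omega) hq (by omega) rfl
  exact ⟨q', a, hpq.le.trans b, c⟩
end E1
end CLC

set_option linter.all false
namespace CLC
section E2
variable {R : Type u} [CommRing R]
open IsLocalRing

/-- `M` is killed by `a` -/
def Kd (a : Ideal R) (M : Type u) [AddCommGroup M] [Module R M] : Prop := ∀ r ∈ a, ∀ y : M, r • y = 0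

section
variable {M N L : Type u} [AddCommGroup M] [Module R M] [AddCommGroup N] [Module R N] [AddCommGroup L] [Module R L]
lemma Kd.inj {a : Ideal R} {f : M →ₗ[R] N} (hf : Function.Injective f) (h : Kd a N) : Kd a M := fun r hr y => 
  hf (by rw [map_smul, h r hr, map_zero])
lemma Kd.surj {a : Ideal R} {f : M →ₗ[R] N} (hf : Function.Surjective f) (h : Kd a M) : Kd a N := fun r hr y => by
  obtain ⟨y, rfl⟩ := hf y
  rw [← map_smul, h r hr, map_zero]
lemma Kd.mono {a b : Ideal R} (hab : a ≤ b) (h : Kd b M) : Kd a M := fun r hr y => h r (hab hr) y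
lemma Kd.quot (a : Ideal R) : Kd a (R ⧸ a) := fun r hr y => by
  obtain ⟨y, rfl⟩ := Submodule.mkQ_surjective _ y
  rw [← map_smul]
  exact (Submodule.Quotient.mk_eq_zero _).2 (by rw [smul_eq_mul, mul_comm]; exact a.mul_mem_left _ hr)
lemma Kd.le_of_quot {a b : Ideal R} (h : Kd a (R ⧸ b)) : a ≤ b := fun r hr => by
  have := h r hr (Submodule.mkQ b 1)
  rw [← map_smul, smul_eq_mul, mul_one] at this
  exact (Submodule.Quotient.mk_eq_zero _).1 this
lemma Kd.lc {a : Ideal R} (h : Kd a M) (I : Ideal R) (i : ℕ) : Kd a (LC I i M) := fun r hr y => LC.smul_eq_zero I i (h r hr) y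

lemma fg_ind [IsNoetherianRing R] (b : Ideal R) {P : ∀ (M : Type u) [AddCommGroup M] [Module R M], Prop}
    (hsub : ∀ (M : Type u) [AddCommGroup M] [Module R M], Subsingleton M → P M)
    (hcongr : ∀ (M N : Type u) [AddCommGroup M] [Module R M] [AddCommGroup N] [Module R N] (e : M ≃ₗ[R] N), P M → P N)
    (hprime : ∀ p : Ideal R, p.IsPrime → b ≤ p → P (R ⧸ p))
    (hext : ∀ (M N L : Type u) [AddCommGroup M] [Module R M] [AddCommGroup N] [Module R N] [AddCommGroup L] [Module R L]
      (f : M →ₗ[R] N) (g : N →ₗ[R] L), SES f g → P M → P L → P N)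
    (M : Type u) [AddCommGroup M] [Module R M] (hM : Module.Finite R M) (hk : Kd b M) : P M := by
  revert hk
  refine IsNoetherianRing.induction_on_isQuotientEquivQuotientPrime R hM (motive := fun N _ _ _ => Kd b N → P N) ?_ ?_ ?_
  · intro N _ _ _ h _
    exact hsub N h
  · intro N _ _ _ p e hk
    exact hcongr _ _ e.symm (hprime p.1 p.2 (Kd.le_of_quot (hk.surj (f := e.toLinearMap) e.surjective)))
  · intro N1 _ _ _ N2 _ _ _ N3 _ _ _ f g hf hg hfg h1 h3 hk
    exact hext _ _ _ f g ⟨hf, hg, hfg⟩ (h1 (hk.inj hf)) (h3 (hk.surj hg))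

lemma lc_zero_of_primes [IsNoetherianRing R] (I : Ideal R) (i : ℕ) (b : Ideal R)
    (h : ∀ p : Ideal R, p.IsPrime → b ≤ p → Subsingleton (LC I i (R ⧸ p)))
    (M : Type u) [AddCommGroup M] [Module R M] (hM : Module.Finite R M) (hk : Kd b M) : Subsingleton (LC I i M) := by
  refine fg_ind b (P := fun M _ _ => Subsingleton (LC I i M)) ?_ ?_ h ?_ M hM hk
  · intro M _ _ h; exact LC.sub_of_sub I i
  · intro M N _ _ _ _ e h; exact (LC.congr I i e).symm.toEquiv.subsingleton
  · intro M N L _ _ _ _ _ _ f g s h1 h2; exact s.sub_mid I i h1 h2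

lemma sub_of_inj_tors {I : Ideal R} {x : R} (hx : x ∈ I) (hinj : ∀ y : M, x • y = 0 → y = 0) (ht : ∀ y : M, y ∈ Gam I M) :
    Subsingleton M := by
  refine subsingleton_of_forall_eq 0 fun y => ?_
  obtain ⟨n, hn⟩ := ht y
  have := hn _ (Ideal.pow_mem_pow hx n)
  clear hn
  induction n with
  | zero => simpa using this
  | succ n ih => exact ih (hinj _ (by rw [← mul_smul, ← pow_succ']; exact this))

lemma ml_quot_inj {p : Ideal R} (hp : p.IsPrime) {x : R} (hx : x ∉ p) : Function.Injective (ml x (R ⧸ p)) := by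
  refine (injective_iff_map_eq_zero _).2 fun y hy => ?_
  obtain ⟨y, rfl⟩ := Submodule.mkQ_surjective _ y
  rw [ml_apply, ← map_smul] at hy
  have := (Submodule.Quotient.mk_eq_zero _).1 hy
  exact (Submodule.Quotient.mk_eq_zero _).2 ((hp.mem_or_mem this).resolve_left hx)

lemma Kd.coker {p : Ideal R} {x : R} (h : Kd p M) : Kd (p ⊔ Ideal.span {x}) (M ⧸ LinearMap.range (ml x M)) := by
  intro r hr y
  obtain ⟨y, rfl⟩ := Submodule.mkQ_surjective _ y
  obtain ⟨a, ha, b, hb, rfl⟩ := Submodule.mem_sup.1 hr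
  obtain ⟨c, rfl⟩ := Ideal.mem_span_singleton'.1 hb
  rw [← map_smul, add_smul, h a ha, zero_add]
  exact (Submodule.Quotient.mk_eq_zero _).2 ⟨c • y, by rw [ml_apply, ← mul_smul, mul_comm]⟩

lemma LC.map_ml (I : Ideal R) (i : ℕ) (x : R) : LC.map I i (ml x M) = ml x (LC I i M) := by
  ext y
  have h : ml x M = x • LinearMap.id := by ext y; rfl
  rw [h, LC.map_smul, LC.map_id]; rfl

lemma SES.mlquot {p : Ideal R} (hp : p.IsPrime) {x : R} (hx : x ∉ p) : 
    SES (ml x (R ⧸ p)) (LinearMap.range (ml x (R ⧸ p))).mkQ := SES.coker (ml_quot_inj hp hx)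
end

variable [IsNoetherianRing R] [IsLocalRing R]

/-- Grothendieck vanishing -/
lemma groth (I : Ideal R) {p : Ideal R} (hp : p.IsPrime) (i : ℕ) (hi : dm p < i) : Subsingleton (LC I i (R ⧸ p)) := by
  induction' hn : dm p using Nat.strong_induction_on with n ih generalizing p i
  obtain ⟨i, rfl⟩ : ∃ j, i = j + 1 := ⟨i - 1, by omega⟩
  by_cases hIp : I ≤ p
  · refine LC.tors_vanish I i _ fun y => ⟨1, fun a ha => Kd.quot p a (hIp (by simpa using ha)) y⟩
  obtain ⟨x, hx, hxp⟩ := SetLike.not_le_iff_exists.1 hIp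
  have s := SES.mlquot hp hxp
  have h0 : Subsingleton (LC I i ((R ⧸ p) ⧸ LinearMap.range (ml x (R ⧸ p)))) := by
    refine lc_zero_of_primes I i (p ⊔ Ideal.span {x}) (fun q hq hle => ?_) _ inferInstance (Kd.coker (Kd.quot p))
    have hlt : p < q := lt_of_le_of_ne (le_sup_left.trans hle) fun h => hxp (h ▸ hle (Ideal.mem_sup_right (Ideal.mem_span_singleton_self x)))
    have := dm_lt hp hq hlt
    exact ih (dm q) (by omega) hq i (by omega) rfl
  have hinj := s.lc_inj I i h0
  rw [LC.map_ml] at hinj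
  refine sub_of_inj_tors hx (fun y hy => hinj ?_) (LC.torsion I (i+1))
  rw [map_zero]; exact hy

lemma groth_fg (I : Ideal R) (M : Type u) [AddCommGroup M] [Module R M] (hM : Module.Finite R M) : 
    ∃ n, ∀ i ≥ n, Subsingleton (LC I i M) := by
  let P : ∀ (M : Type u) [AddCommGroup M] [Module R M], Prop := fun M _ _ => ∃ n, ∀ i ≥ n, Subsingleton (LC I i M)
  have key := fg_ind (⊥ : Ideal R) (P := P) ?_ ?_ ?_ ?_ M hM ?_
  · exact key
  · intro M _ _ h; exact ⟨0, fun i _ => LC.sub_of_sub I i⟩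
  · rintro M N _ _ _ _ e ⟨n, h⟩; exact ⟨n, fun i hi => have := h i hi; (LC.congr I i e).symm.toEquiv.subsingleton⟩
  · intro p hp _
    exact ⟨dm p + 1, fun i hi => groth I hp i hi⟩
  · rintro M N L _ _ _ _ _ _ f g s ⟨n, h1⟩ ⟨n', h2⟩
    exact ⟨max n n', fun i hi => s.sub_mid I i (h1 i (le_trans (le_max_left _ _) hi)) (h2 i (le_trans (le_max_right _ _) hi))⟩
  · intro r hr y; rw [(Submodule.mem_bot R).1 hr, zero_smul]

/-- cohomological dimension of `R/p` is less than `k` -/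
def V (I p : Ideal R) (k : ℕ) : Prop := ∀ i ≥ k, Subsingleton (LC I i (R ⧸ p))

lemma V.mono_k {I p : Ideal R} {k l : ℕ} (h : V I p k) (hkl : k ≤ l) : V I p l := fun i hi => h i (hkl.trans hi)
lemma V_groth (I : Ideal R) {p : Ideal R} (hp : p.IsPrime) : V I p (dm p + 1) := fun i hi => groth I hp i hi

lemma V.aux {I p : Ideal R} (hp : p.IsPrime) {k : ℕ} (h : V I p k) (n : ℕ) : ∀ i, k ≤ i → dm p < i + n →
    ∀ q : Ideal R, q.IsPrime → p ≤ q → Subsingleton (LC I i (R ⧸ q)) := by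
  induction n with
  | zero => 
    intro i hi hd q hq hpq
    exact groth I hq i (lt_of_le_of_lt (dm_anti hpq (prime_le hq)) hd)
  | succ n ih =>
    intro i hi hd q hq hpq
    have hs : Function.Surjective (Submodule.factor hpq) := Submodule.factor_surjective hpq
    have s := SES.ker hs
    refine s.sub_right I i (h i hi) ?_
    exact lc_zero_of_primes I (i+1) p (ih (i+1) (by omega) (by omega)) _ inferInstance ((Kd.quot p).inj (Submodule.subtype_injective _))

lemma V.mono {I p q : Ideal R} (hp : p.IsPrime) (hq : q.IsPrime) (hpq : p ≤ q) {k : ℕ} (h : V I p k) : V I q k := fun i hi =>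
  V.aux hp h (dm p + 1) i hi (by omega) q hq hpq

lemma lc_zero_of_V {I b : Ideal R} {k : ℕ} (h : ∀ p ∈ b.minimalPrimes, V I p k) (M : Type u) [AddCommGroup M] [Module R M] 
    (hM : Module.Finite R M) (hk : Kd b M) (i : ℕ) (hi : k ≤ i) : Subsingleton (LC I i M) := by
  refine lc_zero_of_primes I i b (fun p hp hbp => ?_) M hM hk
  obtain ⟨p0, h0, hle⟩ := Ideal.exists_minimalPrimes_le hbp
  exact (h p0 h0).mono h0.1.1 hp hle i hi

lemma lc_zero_of_Vp {I p : Ideal R} (hp : p.IsPrime) {k : ℕ} (h : V I p k) (M : Type u) [AddCommGroup M] [Module R M] 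
    (hM : Module.Finite R M) (hk : Kd p M) (i : ℕ) (hi : k ≤ i) : Subsingleton (LC I i M) :=
  lc_zero_of_primes I i p (fun q hq hpq => h.mono hp hq hpq i hi) M hM hk

/-- right exactness at the top -/
lemma V.surj {I p : Ideal R} (hp : p.IsPrime) {k : ℕ} (h : V I p (k+1)) {M N : Type u} [AddCommGroup M] [Module R M] [AddCommGroup N] [Module R N]
    (hM : Module.Finite R M) (hk : Kd p M) {g : M →ₗ[R] N} (hg : Function.Surjective g) : Function.Surjective (LC.map I k g) :=
  (SES.ker hg).lc_surj I k (lc_zero_of_Vp hp h _ inferInstance (hk.inj (Submodule.subtype_injective _)) _ le_rfl)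

lemma cof_dim_one {I a : Ideal R} (hI : I ≤ maximalIdeal R) (hd : ∀ P Q : Ideal R, P.IsPrime → Q.IsPrime → I ⊔ a ≤ P → P < Q → Q = maximalIdeal R) 
    (M : Type u) [AddCommGroup M] [Module R M] (hM : Module.Finite R M) (hk : Kd a M) (i : ℕ) : Cof I (LC I i M) := by
  induction' i using Nat.strong_induction_on with i ih
  have h1 := lemA I i M (fun i => EX.finite i) ih
  exact ⟨LC.torsion I i, critB hI a _ hd (hk.lc I i) (LC.torsion I i) h1.1 h1.2⟩

lemma cof_zero (I : Ideal R) (M : Type u) [AddCommGroup M] [Module R M] (hM : Module.Finite R M) : Cof I (LC I 0 M) :=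
  Cof.of_fin (fin_surj (LC.equiv0 M I).symm.surjective (inferInstanceAs (Module.Finite R (Gam I M)))) (LC.torsion I 0)

/-- `I` in the class -/
def Cls (I : Ideal R) : Prop := ∀ (M : Type u) [AddCommGroup M] [Module R M], Module.Finite R M → ∀ i, Cof I (LC I i M)

lemma cls_of (I : Ideal R) (hI : I ≤ maximalIdeal R) 
    (h : ∀ p ∈ minimalPrimes R, V I p 2 ∨ dm (I ⊔ p) ≤ 1) : Cls I := by
  classical
  have hfin : (minimalPrimes R).Finite := minimalPrimes.finite_of_isNoetherianRing R
  let SB := hfin.toFinset.filter (fun p => V I p 2)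
  let SD := hfin.toFinset.filter (fun p => dm (I ⊔ p) ≤ 1)
  let b : Ideal R := SB.inf id
  let c : Ideal R := SD.inf id
  have hB : ∀ p : Ideal R, p.IsPrime → b ≤ p → V I p 2 := by
    intro p hp hbp
    obtain ⟨q, hq, hqp⟩ := (Ideal.IsPrime.inf_le' hp).1 hbp
    have := Finset.mem_filter.1 hq
    exact this.2.mono ((hfin.mem_toFinset.1 this.1).1.1) hp hqp
  have hD : ∀ P Q : Ideal R, P.IsPrime → Q.IsPrime → I ⊔ c ≤ P → P < Q → Q = maximalIdeal R := by
    intro P Q hP hQ hle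
    obtain ⟨q, hq, hqp⟩ := (Ideal.IsPrime.inf_le' hP).1 (le_sup_right.trans hle)
    have := Finset.mem_filter.1 hq
    exact (dm_le_one_iff (sup_le hI (prime_le (hfin.mem_toFinset.1 this.1).1.1))).1 this.2 P Q hP hQ (sup_le (le_sup_left.trans hle) hqp)
  have hnil : b * c ≤ nilradical R := by
    rw [nilradical, Ideal.radical_eq_sInf]
    refine le_sInf fun p hp => ?_
    have := hp.2
    obtain ⟨q, hq, hqp⟩ := Ideal.exists_minimalPrimes_le (I := (⊥ : Ideal R)) (J := p) hp.1
    refine le_trans ?_ hqp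
    rcases h q hq with h1 | h1
    · exact Ideal.mul_le_left.trans (Finset.inf_le (f := id) (Finset.mem_filter.2 ⟨hfin.mem_toFinset.2 hq, h1⟩))
    · exact Ideal.mul_le_right.trans (Finset.inf_le (f := id) (Finset.mem_filter.2 ⟨hfin.mem_toFinset.2 hq, h1⟩))
  obtain ⟨k, hk⟩ := Ideal.exists_pow_le_of_le_radical_of_fg hnil (IsNoetherian.noetherian _)
  rw [mul_pow] at hk
  intro M _ _ hM
  let L' : Submodule R M := c ^ k • ⊤
  have hL' : Kd (b ^ k) L' := by
    intro r hr y
    apply Subtype.ext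
    have hy : y.1 ∈ (c ^ k • ⊤ : Submodule R M) := y.2
    refine Submodule.smul_induction_on (p := fun z => r • z = 0) hy ?_ ?_
    · intro s hs n _
      rw [← mul_smul, (Submodule.mem_bot R).1 (hk (Ideal.mul_mem_mul hr hs)), zero_smul]
    · intro x y hx hy; rw [smul_add, hx, hy, add_zero]
  have hQ : Kd (c ^ k) (M ⧸ L') := by
    intro r hr y
    obtain ⟨y, rfl⟩ := Submodule.mkQ_surjective _ y
    rw [← map_smul]
    exact (Submodule.Quotient.mk_eq_zero _).2 (Submodule.smul_mem_smul hr trivial)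
  have hz : ∀ i, 2 ≤ i → Subsingleton (LC I i L') := fun i hi => lc_zero_of_primes I i (b ^ k) 
    (fun p hp hle => hB p hp (by
      rcases Nat.eq_zero_or_pos k with rfl | hk0
      · rw [pow_zero, Ideal.one_eq_top] at hle
        exact absurd (top_le_iff.1 hle) hp.ne_top
      · exact (hp.pow_le_iff hk0.ne').1 hle) i hi) _ inferInstance hL'
  have hq := cof_dim_one (a := c ^ k) hI (fun P Q hP hQ hle => hD P Q hP hQ (by
      refine sup_le (le_sup_left.trans hle) ?_
      rcases Nat.eq_zero_or_pos k with rfl | hk0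
      · rw [pow_zero, Ideal.one_eq_top] at hle
        exact absurd (top_le_iff.1 (le_sup_right.trans hle)) hP.ne_top
      · exact (hP.pow_le_iff hk0.ne').1 (le_sup_right.trans hle))) (M ⧸ L') inferInstance hQ
  have s := SES.sub L'
  have h2 : ∀ i, 2 ≤ i → Cof I (LC I i M) := fun i hi => 
    (hq i).congr (LinearEquiv.ofBijective _ ⟨s.lc_inj' I i (hz i hi), s.lc_surj I i (hz (i+1) (by omega))⟩).symm
  have h0 := cof_zero I M hM
  obtain ⟨n, hn⟩ := groth_fg I M hM
  have h1 : Cof I (LC I 1 M) := lemD I 1 n M (fun i => EX.finite i) hn (fun j hj => by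
    rcases j with _ | _ | j
    · exact h0
    · exact absurd rfl hj
    · exact h2 _ (by omega))
  intro i
  rcases i with _ | _ | j
  · exact h0
  · exact h1
  · exact h2 _ (by omega)
end E2
end CLC

set_option linter.all false
namespace CLC
section E3
variable {R : Type u} [CommRing R] [IsNoetherianRing R] [IsLocalRing R]
open IsLocalRing

lemma m_tors {I a : Ideal R} (hI : I ⊔ a ≤ maximalIdeal R) (hd : dm (I ⊔ a) = 0) {X : Type u} [AddCommGroup X] [Module R X]
    (hk : Kd a X) (ht : ∀ x : X, x ∈ Gam I X) : ∀ x : X, x ∈ Gam (maximalIdeal R) X := by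
  rw [← support_iff_tors]
  intro Q hQ
  obtain ⟨y, hy⟩ := Module.mem_support_iff_exists_annihilator.1 hQ
  have hann : ∀ b : R, b • y = 0 → b ∈ Q.asIdeal := by
    intro b hb
    apply hy
    rw [Submodule.mem_annihilator_span_singleton, hb]
  have hle : I ⊔ a ≤ Q.asIdeal := by
    refine sup_le (fun b hb => ?_) (fun b hb => hann b (hk b hb y))
    obtain ⟨n, hn⟩ := ht y
    exact Q.2.mem_of_pow_mem n (hann _ (hn _ (Ideal.pow_mem_pow hb n)))
  exact ((dm_eq_zero_iff hI).1 hd _ Q.2 hle).ge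

lemma small_cof {I a : Ideal R} (hI : I ⊔ a ≤ maximalIdeal R) (hd : dm (I ⊔ a) = 0) {M : Type u} [AddCommGroup M] [Module R M]
    (hM : Module.Finite R M) (hk : Kd a M) (i : ℕ) : Cof I (LC I i M) :=
  cof_dim_one (le_sup_left.trans hI) ((dm_le_one_iff hI).1 (by omega)) M hM hk i

lemma small_art {I a : Ideal R} (hI : I ⊔ a ≤ maximalIdeal R) (hd : dm (I ⊔ a) = 0) {M : Type u} [AddCommGroup M] [Module R M]
    (hM : Module.Finite R M) (hk : Kd a M) (i : ℕ) : IsArtinian R (LC I i M) ∧ Module.Finite R (kl (I : Set R) (LC I i M)) := by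
  have h := (fin_kl_iff I).2 ((small_cof hI hd hM hk i).2 0)
  exact ⟨art_of_tors (le_sup_left.trans hI) (m_tors hI hd (hk.lc I i) (LC.torsion I i)) h, h⟩

/-- divisibility of top cohomology -/
lemma div_top {I p : Ideal R} (hp : p.IsPrime) {c : ℕ} {y : R} (hy : y ∉ p)
    (h : ∀ q : Ideal R, q.IsPrime → p < q → Subsingleton (LC I c (R ⧸ q))) :
    Function.Surjective (ml y (LC I c (R ⧸ p))) := by
  have s := SES.mlquot hp hy
  rw [← LC.map_ml]
  refine s.lc_surj' I c (lc_zero_of_primes I c (p ⊔ Ideal.span {y}) (fun q hq hle => h q hq ?_) _ inferInstance (Kd.coker (Kd.quot p)))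
  exact lt_of_le_of_ne (le_sup_left.trans hle) fun h => hy (h ▸ hle (Ideal.mem_sup_right (Ideal.mem_span_singleton_self y)))

lemma sub_of_div {X : Type u} [AddCommGroup X] [Module R X] (hX : Module.Finite R X) {y : R} (hy : y ∈ maximalIdeal R) 
    (h : Function.Surjective (ml y X)) : Subsingleton X := by
  have : (⊤ : Submodule R X) = ⊥ := by
    refine Submodule.eq_bot_of_le_smul_of_le_jacobson_bot (Ideal.span {y}) ⊤ (Module.Finite.fg_top) ?_ ?_
    · intro x _
      obtain ⟨z, rfl⟩ := h x
      exact Submodule.smul_mem_smul (Ideal.mem_span_singleton_self y) trivial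
    · rw [IsLocalRing.jacobson_eq_maximalIdeal _ bot_ne_top]
      exact (Ideal.span_singleton_le_iff_mem _).2 hy
  exact subsingleton_of_forall_eq 0 fun x => (Submodule.mem_bot R).1 (this ▸ (Submodule.mem_top : x ∈ (⊤ : Submodule R X)))

lemma not_fg_top {I q : Ideal R} (hq : q.IsPrime) {c : ℕ} (hc : dm q = c) (hc1 : c ≠ 0)
    (hf : Module.Finite R (LC I c (R ⧸ q))) : Subsingleton (LC I c (R ⧸ q)) := by
  have hne : q < maximalIdeal R := lt_of_le_of_ne (prime_le hq) (fun h' => hc1 (hc ▸ (dm_eq_zero hq).2 h'))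
  obtain ⟨y, hy, hyp⟩ := SetLike.exists_of_lt hne
  refine sub_of_div hf hy (div_top hq hyp fun q' hq' hlt => groth I hq' c ?_)
  have := dm_lt hq hq' hlt
  omega

lemma lc0_ne {I : Ideal R} (hI : I ≤ maximalIdeal R) : ¬ Subsingleton (LC I 0 (R ⧸ maximalIdeal R)) := by
  intro h
  rw [← Gam_eq_bot_iff] at h
  have h1 : (Submodule.mkQ (maximalIdeal R) 1) ∈ Gam I (R ⧸ maximalIdeal R) := 
    ⟨1, fun a ha => Kd.quot _ a (hI (by simpa using ha)) _⟩
  rw [h, Submodule.mem_bot] at h1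
  exact (maximalIdeal.isMaximal R).ne_top ((Ideal.eq_top_iff_one _).2 ((Submodule.Quotient.mk_eq_zero _).1 h1))

lemma nonvanish {I : Ideal R} (hI : I ≤ maximalIdeal R) (c : ℕ) : ∀ q : Ideal R, q.IsPrime → dm (I ⊔ q) = 0 → dm q = c →
    ¬ Subsingleton (LC I c (R ⧸ q)) := by
  classical
  induction c with
  | zero =>
    intro q hq _ hc
    rw [(dm_eq_zero hq).1 hc]
    exact lc0_ne hI
  | succ c ih =>
    intro q hq hs hc hsub
    have hIq : I ⊔ q ≤ maximalIdeal R := sup_le hI (prime_le hq)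
    have hnot : ¬ I ≤ q := fun h => by rw [sup_eq_right.2 h] at hs; omega
    obtain ⟨h1, h2⟩ := small_art hIq hs (inferInstance : Module.Finite R (R ⧸ q)) (Kd.quot q) c
    obtain ⟨S, hS, hSx⟩ := lemAV I h2
    obtain ⟨y, hyI, hyS⟩ := avoid I (insert q S) (by
      intro p hp
      rcases Finset.mem_insert.1 hp with rfl | hp
      · exact ⟨hq, hnot⟩
      · exact hS p hp)
    have hyq : y ∉ q := hyS q (by simp)
    have hf := hSx y hyI fun p hp => hyS p (Finset.mem_insert_of_mem hp)
    have s := SES.mlquot hq hyq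
    have hsurj := s.lc_surj I c hsub
    obtain ⟨δ, hex, -⟩ := s.lcδ I c
    rw [LC.map_ml] at hex
    -- R/(q+y) → R/q'
    obtain ⟨q', hq', hle, hd'⟩ := exists_prime_dm (span_le_m (prime_le hq) (hI hyI))
    have hdq' : dm q' = c := by have := dm_sup_lt hq (hI hyI) hyq; omega
    have hqq' : q ≤ q' := le_sup_left.trans hle
    have hyq' : y ∈ q' := hle (Ideal.mem_sup_right (Ideal.mem_span_singleton_self y))
    have hker : LinearMap.range (ml y (R ⧸ q)) ≤ LinearMap.ker (Submodule.factor hqq') := by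
      rintro _ ⟨z, rfl⟩
      rw [LinearMap.mem_ker, ml_apply, map_smul]
      exact Kd.quot q' y hyq' _
    let g := Submodule.liftQ _ _ hker
    have hg : Function.Surjective g := by
      rw [← LinearMap.range_eq_top, Submodule.range_liftQ, LinearMap.range_eq_top]
      exact Submodule.factor_surjective hqq'
    have hgs : Function.Surjective (LC.map I c g) := by
      refine (SES.ker hg).lc_surj I c (lc_zero_of_primes I (c+1) (q ⊔ Ideal.span {y}) (fun p hp hle => groth I hp _ ?_) _ inferInstance
        ((Kd.coker (Kd.quot q)).inj (Submodule.subtype_injective _)))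
      have := dm_anti hle (prime_le hp)
      omega
    have hIq' : dm (I ⊔ q') = 0 := by
      have := dm_anti (sup_le_sup_left hqq' I) (sup_le hI (prime_le hq')); omega
    have hfin : Module.Finite R (LC I c (R ⧸ q')) := by
      refine fin_surj hgs (fin_surj (f := Submodule.liftQ (LinearMap.range (ml y _)) (LC.map I c (LinearMap.range (ml y (R ⧸ q))).mkQ) ?_) ?_ hf)
      · exact le_of_eq (LinearMap.exact_iff.1 hex).symm
      · rw [← LinearMap.range_eq_top, Submodule.range_liftQ, LinearMap.range_eq_top]
        exact hsurj
    refine ih q' hq' hIq' hdq' ?_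
    by_cases hc0 : c = 0
    · subst hc0
      have : Subsingleton (LC I 0 (R ⧸ q)) := by
        refine sub_of_inj_tors hyI (fun z hz => ?_) (LC.torsion I 0)
        have hinj := LC.map0_inj I (ml_quot_inj hq hyq)
        rw [LC.map_ml] at hinj
        exact hinj (by rw [map_zero]; exact hz)
      exact (hgs.comp hsurj).subsingleton
    · exact not_fg_top hq' hdq' hc0 hfin

lemma exists_avoid_min {a : Ideal R} (ha : a ≤ maximalIdeal R) (h : dm a ≠ 0) (p : Ideal R) (hp : p.IsPrime) (hpm : p ≠ maximalIdeal R) : 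
    ∃ y ∈ maximalIdeal R, y ∉ p ∧ ∀ P ∈ a.minimalPrimes, dm P ≠ 0 → y ∉ P := by
  classical
  have hfin : (a.minimalPrimes).Finite := Ideal.finite_minimalPrimes_of_isNoetherianRing R a
  obtain ⟨y, hy, hyS⟩ := avoid (maximalIdeal R) (insert p (hfin.toFinset.filter fun P => dm P ≠ 0)) (by
    intro P hP
    rcases Finset.mem_insert.1 hP with rfl | hP
    · exact ⟨hp, fun h' => hpm (le_antisymm (prime_le hp) h')⟩
    · obtain ⟨h1, h2⟩ := Finset.mem_filter.1 hP
      have h3 := (hfin.mem_toFinset.1 h1).1.1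
      exact ⟨h3, fun h' => h2 ((dm_eq_zero h3).2 (le_antisymm (prime_le h3) h'))⟩)
  exact ⟨y, hy, hyS p (by simp), fun P hP hd => hyS P (Finset.mem_insert_of_mem (Finset.mem_filter.2 ⟨hfin.mem_toFinset.2 hP, hd⟩))⟩

lemma min_dm_ne {a : Ideal R} (ha : a ≤ maximalIdeal R) (h : dm a ≠ 0) {P : Ideal R} (hP : P ∈ a.minimalPrimes) : dm P ≠ 0 := by
  intro hd
  have hm := (dm_eq_zero hP.1.1).1 hd
  obtain ⟨Q, hQ, hQa, hQd⟩ := exists_prime_dm ha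
  have := hP.2 ⟨hQ, hQa⟩ (hm ▸ prime_le hQ)
  have h3 : Q = maximalIdeal R := le_antisymm (prime_le hQ) (hm ▸ this)
  exact h (hQd ▸ (dm_eq_zero hQ).2 h3)

lemma dim_ineq {I : Ideal R} (hI : I ≤ maximalIdeal R) (e : ℕ) : ∀ (p : Ideal R) (k : ℕ), p.IsPrime → V I p (k+1) → dm (I ⊔ p) ≤ e → dm p ≤ k + e := by
  induction e with
  | zero =>
    intro p k hp hV hd
    by_contra hlt
    exact nonvanish hI (dm p) p hp (by omega) rfl (hV (dm p) (by omega))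
  | succ e ih =>
    intro p k hp hV hd
    by_cases hde : dm (I ⊔ p) ≤ e
    · have := ih p k hp hV hde; omega
    have hIp : I ⊔ p ≤ maximalIdeal R := sup_le hI (prime_le hp)
    obtain ⟨P, hP, -⟩ := Ideal.exists_minimalPrimes_le hIp
    have hpm : p ≠ maximalIdeal R := by
      intro h
      have := (dm_eq_zero hp).2 h
      have := dm_anti (le_sup_right : p ≤ I ⊔ p) hIp
      omega
    obtain ⟨y, hy, hyp, hyP⟩ := exists_avoid_min hIp (by omega) p hp hpm
    obtain ⟨q', hq', hle, hd'⟩ := exists_prime_dm (span_le_m (prime_le hp) hy)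
    have h1 := dm_le_succ (prime_le hp) hy
    have h2 := dm_succ_le hIp hy fun P hP => hyP P hP (min_dm_ne hIp (by omega) hP)
    have h3 : dm (I ⊔ q') ≤ dm (I ⊔ p ⊔ Ideal.span {y}) := dm_anti (by rw [sup_assoc]; exact sup_le_sup_left hle I) (sup_le hI (prime_le hq'))
    have := ih q' k hq' (hV.mono hp hq' (le_sup_left.trans hle)) (by omega)
    omega
end E3
end CLC

set_option linter.all false
namespace CLC
section E4
variable {R : Type u} [CommRing R] [IsNoetherianRing R] [IsLocalRing R]
open IsLocalRing

structure Nice (I : Ideal R) (A : Type u) [AddCommGroup A] [Module R A] : Prop where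
  tors : ∀ x : A, x ∈ Gam (maximalIdeal R) A
  fin : Module.Finite R (kl (I : Set R) A)

def ZC (I : Ideal R) : ℕ → ∀ (A : Type u) [AddCommGroup A] [Module R A], Prop
  | 0, A, _, _ => Module.Finite R A
  | k + 1, A, _, _ => ∃ S : Finset (Ideal R), (∀ p ∈ S, p.IsPrime ∧ ¬ I ≤ p) ∧ ∀ y ∈ I, (∀ p ∈ S, y ∉ p) → 
      ZC I k (LinearMap.ker (ml y A))

section
variable {I : Ideal R} {A B : Type u} [AddCommGroup A] [Module R A] [AddCommGroup B] [Module R B]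

lemma Nice.inj {f : A →ₗ[R] B} (hf : Function.Injective f) (h : Nice I B) : Nice I A :=
  ⟨tors_of_inj hf h.tors, fin_kl_of_inj hf h.fin⟩

lemma Nice.surj (hI : I ≤ maximalIdeal R) {f : A →ₗ[R] B} (hf : Function.Surjective f) (h : Nice I A) : Nice I B := by
  refine ⟨tors_of_surj hf h.tors, ?_⟩
  have hk : Nice I (LinearMap.ker f) := h.inj (Submodule.subtype_injective _)
  have hb : ∀ (X : Type u) [AddCommGroup X] [Module R X], ∀ r ∈ (⊥ : Ideal R), ∀ y : X, r • y = 0 := by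
    intro X _ _ r hr y; rw [(Submodule.mem_bot R).1 hr, zero_smul]
  have h1 := critB0 hI ⊥ _ (hb _) h.tors h.fin 0
  have h2 := critB0 hI ⊥ _ (hb _) hk.tors hk.fin 1
  exact (fin_kl_iff I).2 ((SES.ker hf).fin_right (R ⧸ I) 0 h1 h2)

/-- restriction of `f` to kernels of `y` -/
def kerMap (y : R) (f : A →ₗ[R] B) : LinearMap.ker (ml y A) →ₗ[R] LinearMap.ker (ml y B) :=
  f.restrict (fun x hx => by
    rw [LinearMap.mem_ker, ml_apply] at *
    rw [← map_smul, hx, map_zero])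
lemma kerMap_coe (y : R) (f : A →ₗ[R] B) (x : LinearMap.ker (ml y A)) : (kerMap y f x : B) = f x := rfl
lemma kerMap_inj {y : R} {f : A →ₗ[R] B} (hf : Function.Injective f) : Function.Injective (kerMap y f) := by
  intro a b hab
  have := congrArg Subtype.val hab
  exact Subtype.ext (hf this)
end

lemma ZC.inj {I : Ideal R} (k : ℕ) : ∀ {A B : Type u} [AddCommGroup A] [Module R A] [AddCommGroup B] [Module R B]
    {f : A →ₗ[R] B} (hf : Function.Injective f) (h : ZC I k B), ZC I k A := by
  induction k with
  | zero => intro A B _ _ _ _ f hf h; exact fin_inj hf h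
  | succ k ih => 
    rintro A B _ _ _ _ f hf ⟨S, hS, h⟩
    exact ⟨S, hS, fun y hy hyS => ih (kerMap_inj hf) (h y hy hyS)⟩

lemma fin_ext {X Y : Type u} [AddCommGroup X] [Module R X] [AddCommGroup Y] [Module R Y] (f : X →ₗ[R] Y) (h1 : Module.Finite R (LinearMap.ker f)) (h2 : Module.Finite R (LinearMap.range f)) : Module.Finite R X := by
  have s := SES.kerRange f
  exact fin_exact s.exact h1 h2

lemma ZC.ker_fg {I : Ideal R} (k : ℕ) : ∀ {A B : Type u} [AddCommGroup A] [Module R A] [AddCommGroup B] [Module R B]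
    {f : A →ₗ[R] B} (hf : Module.Finite R (LinearMap.ker f)) (h : ZC I k B), ZC I k A := by
  induction k with
  | zero => 
    intro A B _ _ _ _ f hf h
    have h : Module.Finite R B := h
    exact fin_ext f hf (fin_inj (Submodule.subtype_injective _) h)
  | succ k ih => 
    rintro A B _ _ _ _ f hf ⟨S, hS, h⟩
    refine ⟨S, hS, fun y hy hyS => ih (f := kerMap y f) ?_ (h y hy hyS)⟩
    refine fin_inj (f := ((LinearMap.ker (ml y A)).subtype.comp (LinearMap.ker (kerMap y f)).subtype).codRestrict (LinearMap.ker f) ?_) ?_ hf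
    · intro x
      exact congrArg Subtype.val x.2
    · intro p q hpq
      have h3 := congrArg Subtype.val hpq
      exact Subtype.ext (Subtype.ext h3)

lemma ZC.coker_fg {I : Ideal R} (hI : I ≤ maximalIdeal R) (k : ℕ) : ∀ {A B : Type u} [AddCommGroup A] [Module R A] [AddCommGroup B] [Module R B]
    {f : A →ₗ[R] B} (hA : Nice I A) (hf : Module.Finite R (B ⧸ LinearMap.range f)) (h : ZC I k A), ZC I k B := by
  classical
  induction k with
  | zero => 
    intro A B _ _ _ _ f hA hf h
    have h : Module.Finite R A := h
    exact fin_exact (LinearMap.exact_map_mkQ_range f) h hf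
  | succ k ih => 
    rintro A B _ _ _ _ f hA hf ⟨S, hS, h⟩
    have hC : Nice I (LinearMap.ker f) := hA.inj (Submodule.subtype_injective _)
    have := art_of_tors hI hC.tors hC.fin
    obtain ⟨S', hS', hAV⟩ := lemAV I hC.fin
    refine ⟨S ∪ S', fun p hp => (Finset.mem_union.1 hp).elim (hS p) (hS' p), fun y hy hyS => ?_⟩
    refine ih (f := kerMap y f) (hA.inj (Submodule.subtype_injective _)) ?_ (h y hy fun p hp => hyS p (Finset.mem_union_left _ hp))
    have hCy := hAV y hy fun p hp => hyS p (Finset.mem_union_right _ hp)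
    let W : Submodule R A := LinearMap.ker (f.comp (ml y A))
    let u : W →ₗ[R] LinearMap.ker f := ((ml y A).comp W.subtype).codRestrict _ (fun x => x.2)
    let ψ : W →ₗ[R] LinearMap.ker f ⧸ LinearMap.range (ml y (LinearMap.ker f)) := (Submodule.mkQ _).comp u
    let v : W →ₗ[R] LinearMap.ker (ml y B) := (f.comp W.subtype).codRestrict _ (fun x => by
      have h1 : f (y • x.1) = 0 := x.2
      rw [LinearMap.mem_ker, ml_apply]
      rw [map_smul] at h1
      exact h1)
    let φ : W →ₗ[R] LinearMap.ker (ml y B) ⧸ LinearMap.range (kerMap y f) := (Submodule.mkQ _).comp v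
    have hle : LinearMap.ker ψ ≤ LinearMap.ker φ := by
      intro x hx
      have h1 : u x ∈ LinearMap.range (ml y (LinearMap.ker f)) := (Submodule.Quotient.mk_eq_zero _).1 hx
      obtain ⟨c, hc⟩ := h1
      have h2 : y • (c : A) = y • (x : A) := congrArg Subtype.val hc
      refine (Submodule.Quotient.mk_eq_zero _).2 ⟨⟨x.1 - c.1, ?_⟩, Subtype.ext ?_⟩
      · rw [LinearMap.mem_ker, ml_apply, smul_sub, h2, sub_self]
      · change f (x.1 - c.1) = f x.1
        rw [map_sub, show f c.1 = 0 from c.2, sub_zero]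
    have hW : Module.Finite R (W ⧸ LinearMap.ker ψ) := 
      fin_inj (f := ψ.quotKerEquivRange.toLinearMap) ψ.quotKerEquivRange.injective (fin_inj (Submodule.subtype_injective _) hCy)
    let w : (LinearMap.ker (ml y B) ⧸ LinearMap.range (kerMap y f)) →ₗ[R] B ⧸ LinearMap.range f :=
      Submodule.mapQ _ _ (LinearMap.ker (ml y B)).subtype (by rintro _ ⟨x, rfl⟩; exact ⟨x.1, rfl⟩)
    refine fin_exact (f := Submodule.liftQ _ φ hle) (g := w) ?_ hW hf
    intro b
    obtain ⟨b, rfl⟩ := Submodule.mkQ_surjective _ b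
    constructor
    · intro hb
      have : b.1 ∈ LinearMap.range f := (Submodule.Quotient.mk_eq_zero _).1 hb
      obtain ⟨a, ha⟩ := this
      have haW : a ∈ W := by
        change f (y • a) = 0
        rw [map_smul, ha]; exact b.2
      refine ⟨Submodule.mkQ _ ⟨a, haW⟩, ?_⟩
      change (Submodule.mkQ _) (v ⟨a, haW⟩) = _
      exact congrArg _ (Subtype.ext ha)
    · rintro ⟨x, hx⟩
      obtain ⟨x, rfl⟩ := Submodule.mkQ_surjective _ x
      rw [← hx]
      exact (Submodule.Quotient.mk_eq_zero _).2 ⟨x.1, rfl⟩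

lemma fin_coker_surj {A B : Type u} [AddCommGroup A] [Module R A] [AddCommGroup B] [Module R B]
    {f : A →ₗ[R] B} (hf : Function.Surjective f) : Module.Finite R (B ⧸ LinearMap.range f) := by
  rw [LinearMap.range_eq_top.2 hf]
  have : Subsingleton (B ⧸ (⊤ : Submodule R B)) := ⟨fun a b => by
    obtain ⟨a, rfl⟩ := Submodule.mkQ_surjective _ a
    obtain ⟨b, rfl⟩ := Submodule.mkQ_surjective _ b
    exact (Submodule.Quotient.eq _).2 trivial⟩
  exact fin_sub

lemma small_nice {I a : Ideal R} (hI : I ⊔ a ≤ maximalIdeal R) (hd : dm (I ⊔ a) = 0) {M : Type u} [AddCommGroup M] [Module R M]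
    (hM : Module.Finite R M) (hk : Kd a M) (i : ℕ) : Nice I (LC I i M) :=
  ⟨m_tors hI hd (hk.lc I i) (LC.torsion I i), (small_art hI hd hM hk i).2⟩

lemma ZC.lc_aux {I a : Ideal R} (hI : I ⊔ a ≤ maximalIdeal R) (hd : dm (I ⊔ a) = 0) (i : ℕ)
    (ih : ∀ {M : Type u} [AddCommGroup M] [Module R M] (hM : Module.Finite R M) (hk : Kd a M), ZC I i (LC I i M))
    (N : Type u) [AddCommGroup N] [Module R N] (hG : Gam I N = ⊥) (hN : Module.Finite R N) (hk' : Kd a N) : ZC I (i+1) (LC I (i+1) N) := by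
  have hfin : (associatedPrimes R N).Finite := associatedPrimes.finite R N
  refine ⟨hfin.toFinset, fun p hp => ?_, fun y hy hyS => ?_⟩
  · have := hfin.mem_toFinset.1 hp
    refine ⟨this.1, fun hle => ?_⟩
    obtain ⟨f, hf⟩ := ((isAssociatedPrime_iff_exists_injective_linearMap p N).1 this).2
    have h1 : f (Submodule.mkQ p 1) ∈ Gam I N := ⟨1, fun r hr => by
      rw [← map_smul, Kd.quot p r (hle (by simpa using hr)), map_zero]⟩
    rw [hG, Submodule.mem_bot] at h1
    have h2 := hf (h1.trans (map_zero f).symm)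
    exact this.1.ne_top ((Ideal.eq_top_iff_one _).2 ((Submodule.Quotient.mk_eq_zero _).1 h2))
  · have hinj : Function.Injective (ml y N) := by
      refine (injective_iff_map_eq_zero _).2 fun z hz => ?_
      by_contra hne
      have h1 : y ∈ ⋃ p ∈ associatedPrimes R N, (p : Set R) := by
        rw [biUnion_associatedPrimes_eq_zero_divisors]
        exact ⟨z, hne, hz⟩
      obtain ⟨p, hp, hyp⟩ := Set.mem_iUnion₂.1 h1
      exact hyS p (hfin.mem_toFinset.2 hp) hyp
    have s := SES.coker hinj
    obtain ⟨δ, h1, h2, h3⟩ := s.lcδ I i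
    rw [LC.map_ml] at h3
    let g : LC I i (N ⧸ LinearMap.range (ml y N)) →ₗ[R] LinearMap.ker (ml y (LC I (i+1) N)) := δ.codRestrict _ (fun x => (h3 _).2 ⟨x, rfl⟩)
    have hg : Function.Surjective g := by
      intro x
      obtain ⟨z, hz⟩ := (h3 x.1).1 x.2
      exact ⟨z, Subtype.ext hz⟩
    have hk'' : Kd a (N ⧸ LinearMap.range (ml y N)) := hk'.surj (Submodule.mkQ_surjective _)
    exact ZC.coker_fg (le_sup_left.trans hI) i (f := g) (small_nice hI hd inferInstance hk'' i) (fin_coker_surj hg) (ih inferInstance hk'')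

lemma ZC.lc {I a : Ideal R} (hI : I ⊔ a ≤ maximalIdeal R) (hd : dm (I ⊔ a) = 0) (i : ℕ) : ∀ {M : Type u} [AddCommGroup M] [Module R M]
    (hM : Module.Finite R M) (hk : Kd a M), ZC I i (LC I i M) := by
  classical
  induction i with
  | zero => intro M _ _ hM hk; exact fin_surj (LC.equiv0 M I).symm.surjective (inferInstanceAs (Module.Finite R (Gam I M)))
  | succ i ih =>
    intro M _ _ hM hk
    have s := SES.sub (Gam I M)
    have hb := s.lc_bij_of_tors I (Gam_torsion I) i
    refine ZC.inj (i+1) hb.1 ?_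
    have hk' : Kd a (M ⧸ Gam I M) := hk.surj (Submodule.mkQ_surjective _)
    have hG := Gam_quot (M := M) I
    have hM' : Module.Finite R (M ⧸ Gam I M) := inferInstance
    exact ZC.lc_aux hI hd i ih _ hG hM' hk'
end E4
end CLC

set_option linter.all false
namespace CLC
section E5
variable {R : Type u} [CommRing R] [IsNoetherianRing R] [IsLocalRing R]
open IsLocalRing

lemma surj_quot {I q : Ideal R} (hq : q.IsPrime) {y : R} (hy : y ∈ maximalIdeal R) (hyq : y ∉ q) {c : ℕ} (hc : dm q = c + 1) :
    ∃ q' : Ideal R, q'.IsPrime ∧ q ≤ q' ∧ dm q' = c ∧ ∃ g : ((R ⧸ q) ⧸ LinearMap.range (ml y (R ⧸ q))) →ₗ[R] R ⧸ q', 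
      Function.Surjective (LC.map I c g) := by
  obtain ⟨q', hq', hle, hd'⟩ := exists_prime_dm (span_le_m (prime_le hq) hy)
  have hdq' : dm q' = c := by have := dm_sup_lt hq hy hyq; omega
  have hqq' : q ≤ q' := le_sup_left.trans hle
  have hyq' : y ∈ q' := hle (Ideal.mem_sup_right (Ideal.mem_span_singleton_self y))
  have hker : LinearMap.range (ml y (R ⧸ q)) ≤ LinearMap.ker (Submodule.factor hqq') := by
    rintro _ ⟨z, rfl⟩
    rw [LinearMap.mem_ker, ml_apply, map_smul]
    exact Kd.quot q' y hyq' _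
  let g := Submodule.liftQ _ _ hker
  have hg : Function.Surjective g := by
    rw [← LinearMap.range_eq_top, Submodule.range_liftQ, LinearMap.range_eq_top]
    exact Submodule.factor_surjective hqq'
  refine ⟨q', hq', hqq', hdq', g, ?_⟩
  refine (SES.ker hg).lc_surj I c (lc_zero_of_primes I (c+1) (q ⊔ Ideal.span {y}) (fun p hp hle => groth I hp _ ?_) _ inferInstance
    ((Kd.coker (Kd.quot q)).inj (Submodule.subtype_injective _)))
  have := dm_anti hle (prime_le hp)
  omega

lemma not_ZC {I : Ideal R} (hI : I ≤ maximalIdeal R) (c : ℕ) : ∀ q : Ideal R, q.IsPrime → dm (I ⊔ q) = 0 → dm q = c + 1 →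
    ¬ ZC I c (LC I (c+1) (R ⧸ q)) := by
  classical
  induction c with
  | zero =>
    intro q hq hs hc hZ
    exact nonvanish hI _ q hq hs hc (not_fg_top hq hc (by omega) hZ)
  | succ c ih =>
    rintro q hq hs hc ⟨S, hS, hZ⟩
    have hIq : I ⊔ q ≤ maximalIdeal R := sup_le hI (prime_le hq)
    have hnot : ¬ I ≤ q := fun h => by rw [sup_eq_right.2 h] at hs; omega
    obtain ⟨h1, h2⟩ := small_art hIq hs (inferInstance : Module.Finite R (R ⧸ q)) (Kd.quot q) (c+1)
    obtain ⟨S', hS', hSx⟩ := lemAV I h2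
    obtain ⟨y, hyI, hyS⟩ := avoid I (insert q (S ∪ S')) (by
      intro p hp
      rcases Finset.mem_insert.1 hp with rfl | hp
      · exact ⟨hq, hnot⟩
      · exact (Finset.mem_union.1 hp).elim (hS p) (hS' p))
    have hyq : y ∉ q := hyS q (by simp)
    have hf := hSx y hyI fun p hp => hyS p (Finset.mem_insert_of_mem (Finset.mem_union_right _ hp))
    have hz := hZ y hyI fun p hp => hyS p (Finset.mem_insert_of_mem (Finset.mem_union_left _ hp))
    have s := SES.mlquot hq hyq
    obtain ⟨δ, hex, hex2, hex3⟩ := s.lcδ I (c+1)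
    rw [LC.map_ml] at hex hex3
    obtain ⟨q', hq', hqq', hd', g, hg⟩ := surj_quot (I := I) hq (hI hyI) hyq hc
    have hIq' : dm (I ⊔ q') = 0 := by
      have := dm_anti (sup_le_sup_left hqq' I) (sup_le hI (prime_le hq')); omega
    refine ih q' hq' hIq' hd' ?_
    refine ZC.coker_fg hI c (f := LC.map I (c+1) g) (small_nice hIq hs inferInstance (Kd.coker (Kd.quot q) |>.mono le_sup_left) _) (fin_coker_surj hg) ?_
    have hmem : ∀ x, δ x ∈ LinearMap.ker (ml y (LC I (c+1+1) (R ⧸ q))) := fun x => (hex3 (δ x)).2 ⟨x, rfl⟩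
    refine ZC.ker_fg c (f := δ.codRestrict (LinearMap.ker (ml y _)) hmem) ?_ hz
    have hkk := (LinearMap.ker_codRestrict _ δ hmem).trans (LinearMap.exact_iff.1 hex2)
    rw [hkk]
    refine fin_surj (f := (Submodule.liftQ (LinearMap.range (ml y _)) (LC.map I (c+1) (LinearMap.range (ml y (R ⧸ q))).mkQ).rangeRestrict ?_)) ?_ hf
    · rw [LinearMap.ker_rangeRestrict]
      exact le_of_eq (LinearMap.exact_iff.1 hex).symm
    · rw [← LinearMap.range_eq_top, Submodule.range_liftQ, LinearMap.range_rangeRestrict]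
end E5
end CLC

set_option linter.all false
namespace CLC
section E6
variable {R : Type u} [CommRing R] [IsNoetherianRing R] 

lemma krull1 {p q' q : Ideal R} (hp : p.IsPrime) (hq' : q'.IsPrime) (w : R) (hq : q ∈ (p ⊔ Ideal.span {w}).minimalPrimes)
    (h1 : p < q') (h2 : q' < q) : False := by
  have hsurj : Function.Surjective (Ideal.Quotient.mk p) := Ideal.Quotient.mk_surjective
  have hcm : ∀ a : Ideal R, p ≤ a → (a.map (Ideal.Quotient.mk p)).comap (Ideal.Quotient.mk p) = a := fun a ha => Ideal.comap_map_mk ha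
  have hqp : q.IsPrime := hq.1.1
  have p1 : (q'.map (Ideal.Quotient.mk p)).IsPrime := Ideal.map_isPrime_of_surjective hsurj (by rw [Ideal.mk_ker]; exact h1.le)
  have p2 : (q.map (Ideal.Quotient.mk p)).IsPrime := Ideal.map_isPrime_of_surjective hsurj (by rw [Ideal.mk_ker]; exact h1.le.trans h2.le)
  have p0 : (⊥ : Ideal (R ⧸ p)).IsPrime := Ideal.isPrime_bot
  have l1 : (⊥ : Ideal (R ⧸ p)) < q'.map (Ideal.Quotient.mk p) := by
    refine bot_lt_iff_ne_bot.2 fun h => h1.not_ge ?_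
    rw [Ideal.map_eq_bot_iff_le_ker, Ideal.mk_ker] at h
    exact h
  have l2 : q'.map (Ideal.Quotient.mk p) < q.map (Ideal.Quotient.mk p) := by
    refine lt_of_le_of_ne (Ideal.map_mono h2.le) fun h => h2.ne ?_
    rw [← hcm q' h1.le, h, hcm q (h1.le.trans h2.le)]
  have hmin : q.map (Ideal.Quotient.mk p) ∈ (Ideal.span {Ideal.Quotient.mk p w}).minimalPrimes := by
    refine ⟨⟨p2, ?_⟩, ?_⟩
    · rw [Ideal.span_singleton_le_iff_mem]
      exact Ideal.mem_map_of_mem _ (hq.1.2 (Ideal.mem_sup_right (Ideal.mem_span_singleton_self w)))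
    · rintro Q ⟨hQ, hwQ⟩ hle
      rw [Ideal.map_le_iff_le_comap]
      refine hq.2 ⟨Ideal.IsPrime.comap _, sup_le ?_ ?_⟩ ?_
      · intro x hx
        rw [Ideal.mem_comap, Ideal.Quotient.eq_zero_iff_mem.2 hx]; exact Q.zero_mem
      · rw [Ideal.span_singleton_le_iff_mem] at hwQ ⊢
        exact hwQ
      · rw [← hcm q (h1.le.trans h2.le)]
        exact Ideal.comap_mono hle
  have h := Ideal.height_le_one_of_isPrincipal_of_mem_minimalPrimes _ _ hmin
  have s1 := Ideal.height_strict_mono_of_isPrime_of_isPrime l1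
  have s2 := Ideal.height_strict_mono_of_isPrime_of_isPrime l2
  have := ENat.lt_one_iff_eq_zero.1 (s2.trans_le h)
  rw [this] at s1
  exact not_lt_zero s1

lemma LC.map_sum {I : Ideal R} {i : ℕ} {M N : Type u} [AddCommGroup M] [Module R M] [AddCommGroup N] [Module R N] {ι : Type*} (s : Finset ι)
    (f : ι → M →ₗ[R] N) (x : LC I i M) : LC.map I i (∑ j ∈ s, f j) x = ∑ j ∈ s, LC.map I i (f j) x := by
  classical
  induction s using Finset.induction_on with
  | empty => simp [LC.map_zero]
  | insert a s ha ih => rw [Finset.sum_insert ha, Finset.sum_insert ha, LC.map_add, ih]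

variable [IsLocalRing R]
open IsLocalRing TensorProduct

lemma lc_gen {I p : Ideal R} (hp : p.IsPrime) {k : ℕ} (h : V I p (k+1)) {N : Type u} [AddCommGroup N] [Module R N]
    (hN : Module.Finite R N) (hk : Kd p N) (G : Submodule R (LC I k N)) (hG : ∀ (φ : (R ⧸ p) →ₗ[R] N) x, LC.map I k φ x ∈ G) : G = ⊤ := by
  classical
  obtain ⟨n, s, hs⟩ := Module.Finite.exists_fin (R := R) (M := N)
  let φ : Fin n → (R ⧸ p) →ₗ[R] N := fun j => Submodule.liftQ p (LinearMap.toSpanSingleton R N (s j)) (fun r hr => hk r hr (s j))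
  let g : (Fin n → R ⧸ p) →ₗ[R] N := ∑ j, (φ j).comp (LinearMap.proj j)
  have hg : Function.Surjective g := by
    rw [← LinearMap.range_eq_top, eq_top_iff, ← hs, Submodule.span_le]
    rintro _ ⟨j, rfl⟩
    refine ⟨Pi.single j (Submodule.mkQ p 1), ?_⟩
    rw [LinearMap.sum_apply, Finset.sum_eq_single j]
    · simp only [LinearMap.comp_apply, LinearMap.proj_apply, Pi.single_eq_same]
      change (1 : R) • s j = s j
      rw [one_smul]
    · intro b _ hb
      simp only [LinearMap.comp_apply, LinearMap.proj_apply, Pi.single_eq_of_ne hb, map_zero]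
    · intro h; exact absurd (Finset.mem_univ j) h
  have hkk : Kd p (Fin n → R ⧸ p) := fun r hr y => funext fun j => Kd.quot p r hr (y j)
  rw [eq_top_iff]
  rintro x -
  obtain ⟨y, rfl⟩ := V.surj hp h inferInstance hkk hg x
  rw [LC.map_sum]
  refine Submodule.sum_mem _ fun j _ => ?_
  rw [LC.map_comp]
  exact hG _ _

lemma exists_hom {q : Ideal R} (hq : q.IsPrime) {W : Type u} [AddCommGroup W] [Module R W] (hW : Module.Finite R W)
    (hann : ∀ r : R, (∀ w : W, r • w = 0) → r ∈ q) : ∃ f : W →ₗ[R] R ⧸ q, f ≠ 0 := by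
  classical
  have h1 : (⟨q, hq⟩ : PrimeSpectrum R) ∈ Module.support R W := by
    rw [Module.support_eq_zeroLocus]
    exact fun r hr => hann r (Module.mem_annihilator.1 hr)
  rw [Module.mem_support_iff_nontrivial_residueField_tensorProduct] at h1
  let K := q.ResidueField
  obtain ⟨t, ht⟩ := exists_ne (0 : TensorProduct R K W)
  obtain ⟨l, hl⟩ : ∃ l : Module.Dual K (TensorProduct R K W), l t ≠ 0 := by
    by_contra! h
    exact ht ((Module.forall_dual_apply_eq_zero_iff K t).1 h)
  let g : W →ₗ[R] K := (l.restrictScalars R).comp (TensorProduct.mk R K W 1)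
  have hg : ∃ w, g w ≠ 0 := by
    by_contra! h
    apply hl
    clear ht hl
    induction t using TensorProduct.induction_on with
    | zero => exact map_zero _
    | add x y hx hy => rw [map_add, hx, hy, add_zero]
    | tmul k w => 
      have : (k ⊗ₜ[R] w : TensorProduct R K W) = k • ((1 : K) ⊗ₜ[R] w) := by rw [TensorProduct.smul_tmul', smul_eq_mul, mul_one]
      rw [this, map_smul, show l ((1 : K) ⊗ₜ[R] w) = 0 from h w, smul_zero]
  let ι : (R ⧸ q) →ₗ[R] K := (IsScalarTower.toAlgHom R (R ⧸ q) K).toLinearMap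
  have hι : Function.Injective ι := IsFractionRing.injective (R ⧸ q) K
  obtain ⟨s, hs⟩ := hW.1
  obtain ⟨b, hb⟩ := IsLocalization.exist_integer_multiples_of_finset (nonZeroDivisors (R ⧸ q)) (s.image g)
  obtain ⟨d, hd⟩ := Ideal.Quotient.mk_surjective b.1
  have hsm : ∀ k : K, d • k = b.1 • k := fun k => by rw [← hd]; exact (IsScalarTower.algebraMap_smul (R ⧸ q) d k).symm
  have hrange : ∀ w, (d • g) w ∈ LinearMap.range ι := by
    intro w
    have hle : (⊤ : Submodule R W) ≤ (LinearMap.range ι).comap (d • g) := by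
      rw [← hs, Submodule.span_le]
      intro w hw
      obtain ⟨c, hc⟩ := hb (g w) (Finset.mem_image_of_mem _ hw)
      refine ⟨c, ?_⟩
      rw [LinearMap.smul_apply, hsm]
      exact hc
    exact hle trivial
  refine ⟨(LinearEquiv.ofInjective ι hι).symm.toLinearMap.comp ((d • g).codRestrict _ hrange), fun h => ?_⟩
  obtain ⟨w, hw⟩ := hg
  have h2 := LinearMap.congr_fun h w
  have h3 : ((d • g).codRestrict _ hrange) w = 0 := (LinearEquiv.ofInjective ι hι).symm.injective (by rw [map_zero]; exact h2)
  have h4 : d • g w = 0 := congrArg Subtype.val h3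
  rw [hsm, Algebra.smul_def] at h4
  rcases mul_eq_zero.1 h4 with h5 | h5
  · exact nonZeroDivisors.coe_ne_zero b ((IsFractionRing.injective (R ⧸ q) K) (h5.trans (map_zero _).symm))
  · exact hw h5

lemma exists_z {J q : Ideal R} (hq : q ∈ J.minimalPrimes) : ∃ z, z ∉ q ∧ ∃ n, ∀ a ∈ q ^ (n+1), z * a ∈ J := by
  classical
  have hfin : (J.minimalPrimes).Finite := Ideal.finite_minimalPrimes_of_isNoetherianRing R J
  have hqp := hq.1.1
  have : ¬ ((hfin.toFinset.erase q).inf id ≤ q) := by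
    rw [Ideal.IsPrime.inf_le' hqp]
    rintro ⟨P, hP, hle⟩
    obtain ⟨h1, h2⟩ := Finset.mem_erase.1 hP
    rw [Set.Finite.mem_toFinset] at h2
    exact h1 (le_antisymm hle (hq.2 h2.1 hle))
  obtain ⟨z, hz, hzq⟩ := SetLike.not_le_iff_exists.1 this
  have hle : Ideal.span {z} * q ≤ J.radical := by
    rw [← Ideal.sInf_minimalPrimes]
    refine le_sInf fun P hP => ?_
    by_cases hPq : P = q
    · rw [hPq]; exact Ideal.mul_le_right (I := Ideal.span {z}) (J := q)
    · refine (Ideal.mul_le_left (I := Ideal.span {z}) (J := q)).trans ?_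
      rw [Ideal.span_singleton_le_iff_mem]
      exact (Finset.inf_le (f := id) (Finset.mem_erase.2 ⟨hPq, hfin.mem_toFinset.2 hP⟩) : _ ≤ P) hz
  obtain ⟨n, hn⟩ := Ideal.exists_pow_le_of_le_radical_of_fg hle (IsNoetherian.noetherian _)
  refine ⟨z ^ (n+1), fun h => hzq (hqp.mem_of_pow_mem _ h), n, fun a ha => hn (Ideal.pow_le_pow_right (Nat.le_succ n) ?_)⟩
  rw [mul_pow]
  exact Ideal.mul_mem_mul (Ideal.pow_mem_pow (Ideal.mem_span_singleton_self z) _) ha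


lemma surj_aux {A B C D : Type u} [AddCommGroup A] [Module R A] [AddCommGroup B] [Module R B] [AddCommGroup C] [Module R C] [AddCommGroup D] [Module R D]
    {δ : A →ₗ[R] B} {j : B →ₗ[R] D} {g : B →ₗ[R] C} {z : R} (hex : Function.Exact δ j) (hkill : ∀ x, j (z • x) = 0) (hg : Function.Surjective g)
    (hdiv : Function.Surjective (ml z C)) : Function.Surjective (g.comp δ) := by
  intro t
  obtain ⟨t, rfl⟩ := hdiv t
  obtain ⟨t, rfl⟩ := hg t
  obtain ⟨v, hv⟩ := (hex (z • t)).1 (hkill t)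
  exact ⟨v, by rw [LinearMap.comp_apply, hv, map_smul, ml_apply]⟩

/-- key step of faithfulness -/
lemma faith_aux {I p q1 : Ideal R} (hI : I ≤ maximalIdeal R) {c : ℕ} (hp : p.IsPrime) (hq1 : q1.IsPrime) (hV : V I p (c+1+1)) 
    (hd : dm (I ⊔ q1) = 0) (hc : dm q1 = c + 1) (hpq : p < q1) {z : R} (hz : z ∉ q1) {n : ℕ} 
    (h : ∀ a ∈ q1 ^ (n+1), ∀ t : LC I (c+1) (R ⧸ p), (z * a) • t = 0) : False := by
  have hIq1 : I ⊔ q1 ^ (n+1) ≤ maximalIdeal R := sup_le hI ((Ideal.pow_le_self (Nat.succ_ne_zero n)).trans (prime_le hq1))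
  have hd' : dm (I ⊔ q1 ^ (n+1)) = 0 := by
    rw [dm_eq_zero_iff hIq1]
    intro P hP hle
    exact (dm_eq_zero_iff (sup_le hI (prime_le hq1))).1 hd P hP (sup_le (le_sup_left.trans hle) (hP.le_of_pow_le (le_sup_right.trans hle)))
  obtain ⟨W, hWm⟩ : ∃ W : Submodule R (R ⧸ p), ∀ x, x ∈ W ↔ ∃ a ∈ q1 ^ (n+1), Submodule.mkQ p a = x := ⟨Submodule.map (Submodule.mkQ p) (q1 ^ (n+1)), fun x => Iff.rfl⟩
  have s := SES.sub W
  have hkW : Kd p W := (Kd.quot p).inj (Submodule.subtype_injective W)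
  have hkill : ∀ x : LC I (c+1) W, LC.map I (c+1) W.subtype (z • x) = 0 := by
    intro x
    let G : Submodule R (LC I (c+1) W) := LinearMap.ker ((LC.map I (c+1) W.subtype).comp (ml z _))
    have hG : G = ⊤ := by
      refine lc_gen hp hV inferInstance hkW G fun φ x => ?_
      obtain ⟨a, ha, hae⟩ := (hWm _).1 (φ (Submodule.mkQ p 1)).2
      have hcomp : W.subtype.comp φ = ml a (R ⧸ p) := by
        refine Submodule.linearMap_qext _ (LinearMap.ext_ring ?_)
        change (φ (Submodule.mkQ p 1)).1 = a • (Submodule.mkQ p 1)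
        rw [← hae, ← map_smul, smul_eq_mul, mul_one]
      change LC.map I (c+1) W.subtype (z • LC.map I (c+1) φ x) = 0
      rw [map_smul, ← LC.map_comp, hcomp, LC.map_ml, ml_apply, ← mul_smul]
      exact h a ha x
    have : x ∈ G := hG ▸ trivial
    exact this
  obtain ⟨f, hf⟩ := exists_hom hq1 (inferInstance : Module.Finite R W) (by
    intro r hr
    refine hpq.le ?_
    obtain ⟨w, hw, hwp⟩ := SetLike.exists_of_lt hpq
    have h1 := hr ⟨Submodule.mkQ p (w ^ (n+1)), (hWm _).2 ⟨w ^ (n+1), Ideal.pow_mem_pow hw _, rfl⟩⟩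
    have h2 : Submodule.mkQ p (r • w ^ (n+1)) = 0 := congrArg Subtype.val h1
    have h3 := (Submodule.Quotient.mk_eq_zero _).1 h2
    rw [smul_eq_mul] at h3
    exact (hp.mem_or_mem h3).resolve_right fun h => hwp (hp.mem_of_pow_mem _ h))
  -- surjectivity of H(f)
  have hgr : ∀ q : Ideal R, q.IsPrime → q1 < q → Subsingleton (LC I (c+1) (R ⧸ q)) := fun q hq hlt => groth I hq _ (by
    have := dm_lt hq1 hq hlt; omega)
  have hfs : Function.Surjective (LC.map I (c+1) f) := by
    have hB := V.surj hp hV inferInstance hkW (g := f.rangeRestrict) f.surjective_rangeRestrict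
    have hC : Function.Surjective (LC.map I (c+1) (LinearMap.range f).subtype) := by
      obtain ⟨w, hw⟩ : ∃ w, f w ≠ 0 := by
        by_contra! h; exact hf (LinearMap.ext h)
      obtain ⟨b, hb⟩ := Submodule.mkQ_surjective _ (f w)
      have hbq : b ∉ q1 := fun hb' => hw (hb ▸ (Submodule.Quotient.mk_eq_zero _).2 hb')
      refine (SES.sub (LinearMap.range f)).lc_surj' I (c+1) (lc_zero_of_primes I (c+1) (q1 ⊔ Ideal.span {b}) (fun q hq hle => hgr q hq ?_) _ inferInstance ?_)
      · exact lt_of_le_of_ne (le_sup_left.trans hle) fun h => hbq (h ▸ hle (Ideal.mem_sup_right (Ideal.mem_span_singleton_self b)))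
      · intro r hr y
        obtain ⟨y, rfl⟩ := Submodule.mkQ_surjective _ y
        obtain ⟨y, rfl⟩ := Submodule.mkQ_surjective _ y
        obtain ⟨r1, hr1, r2, hr2, rfl⟩ := Submodule.mem_sup.1 hr
        obtain ⟨e, rfl⟩ := Ideal.mem_span_singleton'.1 hr2
        rw [← map_smul]
        refine (Submodule.Quotient.mk_eq_zero _).2 ?_
        rw [add_smul, Kd.quot q1 r1 hr1, zero_add]
        refine ⟨(e * y) • w, ?_⟩
        rw [map_smul, ← hb, ← map_smul, ← map_smul]
        congr 1
        simp only [smul_eq_mul]; ring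
    have hfe : (LinearMap.range f).subtype.comp f.rangeRestrict = f := LinearMap.ext fun _ => rfl
    intro t
    obtain ⟨t, rfl⟩ := hC t
    obtain ⟨t, rfl⟩ := hB t
    have e2 := LC.map_comp (I := I) (i := c+1) f.rangeRestrict (LinearMap.range f).subtype t
    rw [hfe] at e2
    exact ⟨t, e2⟩
  obtain ⟨δ, h1, h2, h3⟩ := s.lcδ I c
  have hsurj := surj_aux h3 hkill hfs (div_top hq1 hz hgr)
  have hkQ : Kd (q1 ^ (n+1)) ((R ⧸ p) ⧸ W) := by
    intro r hr y
    obtain ⟨y, rfl⟩ := Submodule.mkQ_surjective _ y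
    obtain ⟨y, rfl⟩ := Submodule.mkQ_surjective _ y
    rw [← map_smul]
    refine (Submodule.Quotient.mk_eq_zero _).2 ((hWm _).2 ⟨r • y, ?_, map_smul _ _ _⟩)
    rw [smul_eq_mul]; exact Ideal.mul_mem_right _ _ hr
  refine not_ZC hI c q1 hq1 hd hc ?_
  exact ZC.coker_fg hI c (small_nice hIq1 hd' inferInstance hkQ c) (fin_coker_surj hsurj) (ZC.lc hIq1 hd' c inferInstance hkQ)

lemma faith {I q1 : Ideal R} (hI : I ≤ maximalIdeal R) {c : ℕ} (hq1 : q1.IsPrime) 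
    (hd : dm (I ⊔ q1) = 0) (hc : dm q1 = c + 1) (p : Ideal R) : p.IsPrime → V I p (c+1+1) → p ≤ q1 → 
      Module.annihilator R (LC I (c+1) (R ⧸ p)) ≤ p := by
  classical
  refine IsNoetherian.induction (R := R) (M := R) (P := fun p : Ideal R => p.IsPrime → V I p (c+1+1) → p ≤ q1 → 
      Module.annihilator R (LC I (c+1) (R ⧸ p)) ≤ p) (fun (p : Ideal R) ih => ?_) p
  intro hp hV hpq1
  by_contra hJp
  have hgr : ∀ q : Ideal R, q.IsPrime → q1 < q → Subsingleton (LC I (c+1) (R ⧸ q)) := fun q hq hlt => groth I hq _ (by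
    have := dm_lt hq1 hq hlt; omega)
  have hmono : ∀ q : Ideal R, p ≤ q → Module.annihilator R (LC I (c+1) (R ⧸ p)) ≤ Module.annihilator R (LC I (c+1) (R ⧸ q)) := by
    intro q hpq r hr
    rw [Module.mem_annihilator] at hr ⊢
    intro t
    obtain ⟨t, rfl⟩ := V.surj hp hV inferInstance (Kd.quot p) (Submodule.factor_surjective hpq) t
    rw [← map_smul, hr, map_zero]
  set J := Module.annihilator R (LC I (c+1) (R ⧸ p)) with hJ
  have hpJ : p ≤ J := fun r hr => Module.mem_annihilator.2 fun t => (Kd.quot p).lc I (c+1) r hr t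
  have hJq1 : J ≤ q1 := by
    intro r hr
    have hr := Module.mem_annihilator.1 (hmono q1 hpq1 hr)
    by_contra hrq
    refine nonvanish hI _ q1 hq1 hd hc (subsingleton_of_forall_eq 0 fun t => ?_)
    obtain ⟨t, rfl⟩ := div_top hq1 hrq hgr t
    exact hr t
  have hlt : p < q1 := lt_of_le_of_ne hpq1 fun h => hJp (h ▸ hJq1)
  by_cases hmin : q1 ∈ J.minimalPrimes
  · obtain ⟨z, hz, n, hn⟩ := exists_z hmin
    exact faith_aux hI hp hq1 hV hd hc hlt hz fun a ha t => Module.mem_annihilator.1 (hn a ha) t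
  · have hfin : (J.minimalPrimes).Finite := Ideal.finite_minimalPrimes_of_isNoetherianRing R J
    obtain ⟨w, hw, hwS⟩ := avoid q1 hfin.toFinset (by
      intro P hP
      rw [Set.Finite.mem_toFinset] at hP
      refine ⟨hP.1.1, fun h => hmin ?_⟩
      rwa [le_antisymm h (hP.2 ⟨hq1, hJq1⟩ h)])
    have hwp : w ∉ p := by
      obtain ⟨q4, hq4, h4⟩ := Ideal.exists_minimalPrimes_le hJq1
      exact fun h => hwS q4 (hfin.mem_toFinset.2 hq4) (hq4.1.2 (hpJ h))
    have hle1 : p ⊔ Ideal.span {w} ≤ q1 := sup_le hpq1 ((Ideal.span_singleton_le_iff_mem _).2 hw)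
    obtain ⟨q3, hq3, h31⟩ := Ideal.exists_minimalPrimes_le hle1
    have hwq3 : w ∈ q3 := hq3.1.2 (Ideal.mem_sup_right (Ideal.mem_span_singleton_self w))
    have hpq3 : p ≤ q3 := le_sup_left.trans hq3.1.2
    have hpq3' : p < q3 := lt_of_le_of_ne hpq3 fun h => hwp (h ▸ hwq3)
    have hq3p := hq3.1.1
    have hJ3 : J ≤ q3 := (hmono q3 hpq3).trans (ih q3 hpq3' hq3p (hV.mono hp hq3p hpq3) h31)
    obtain ⟨q5, hq5, h53⟩ := Ideal.exists_minimalPrimes_le hJ3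
    have hwq5 := hwS q5 (hfin.mem_toFinset.2 hq5)
    refine krull1 hp hq5.1.1 w hq3 (lt_of_le_of_ne (hpJ.trans hq5.1.2) fun h => hJp (h ▸ hq5.1.2)) (lt_of_le_of_ne h53 fun h => hwq5 (h ▸ hwq3))
end E6
end CLC

set_option linter.all false
namespace CLC
section E7
variable {R : Type u} [CommRing R]

/-- The map `(e_n) ↦ (e_n - x e_{n+1})` on sequences. -/
def dcm (x : R) (E : Type*) [AddCommGroup E] [Module R E] : (ℕ → E) →ₗ[R] (ℕ → E) where
  toFun e n := e n - x • e (n+1)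
  map_add' e f := by funext n; simp only [Pi.add_apply, smul_add]; abel
  map_smul' r e := by funext n; simp only [Pi.smul_apply, RingHom.id_apply, smul_sub, smul_comm x r]

def DC (x : R) (E : Type*) [AddCommGroup E] [Module R E] : Prop := Function.Bijective (dcm x E)

lemma dcm_apply (x : R) {E : Type*} [AddCommGroup E] [Module R E] (e : ℕ → E) (n : ℕ) :
   dcm x E e n = e n - x • e (n+1) := rfl

lemma dcm_nat (x : R) {E F : Type*} [AddCommGroup E] [Module R E] [AddCommGroup F] [Module R F] (f : E →ₗ[R] F) :
    (f.compLeft ℕ) ∘ₗ dcm x E = dcm x F ∘ₗ f.compLeft ℕ := by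
  refine LinearMap.ext fun e => funext fun n => ?_
  change f (e n - x • e (n+1)) = f (e n) - x • f (e (n+1))
  rw [map_sub, map_smul]

lemma compLeft_exact {E F G : Type*} [AddCommGroup E] [Module R E] [AddCommGroup F] [Module R F] [AddCommGroup G] [Module R G]
    {f : E →ₗ[R] F} {g : F →ₗ[R] G} (h : Function.Exact f g) : Function.Exact (f.compLeft ℕ) (g.compLeft ℕ) := by
  intro y
  constructor
  · intro hy
    have : ∀ n, ∃ x, f x = y n := fun n => (h (y n)).1 (congrFun hy n)
    choose x hx using this
    exact ⟨x, funext hx⟩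
  · rintro ⟨x, rfl⟩
    funext n
    exact (h _).2 ⟨x n, rfl⟩

lemma DC.five {x : R} {A B C D F : Type*} [AddCommGroup A] [Module R A] [AddCommGroup B] [Module R B]
    [AddCommGroup C] [Module R C] [AddCommGroup D] [Module R D] [AddCommGroup F] [Module R F]
    {f₁ : A →ₗ[R] B} {f₂ : B →ₗ[R] C} {f₃ : C →ₗ[R] D} {f₄ : D →ₗ[R] F}
    (h1 : Function.Exact f₁ f₂) (h2 : Function.Exact f₂ f₃) (h3 : Function.Exact f₃ f₄)
    (hA : DC x A) (hB : DC x B) (hD : DC x D) (hF : DC x F) : DC x C :=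
  LinearMap.bijective_of_surjective_of_bijective_of_bijective_of_injective
    (f₁.compLeft ℕ) (f₂.compLeft ℕ) (f₃.compLeft ℕ) (f₄.compLeft ℕ) (f₁.compLeft ℕ) (f₂.compLeft ℕ) (f₃.compLeft ℕ) (f₄.compLeft ℕ)
    (dcm x A) (dcm x B) (dcm x C) (dcm x D) (dcm x F) (dcm_nat x f₁) (dcm_nat x f₂) (dcm_nat x f₃) (dcm_nat x f₄)
    (compLeft_exact h1) (compLeft_exact h2) (compLeft_exact h3) (compLeft_exact h1) (compLeft_exact h2) (compLeft_exact h3)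
    hA.2 hB hD hF.1

lemma DC.of_sub {x : R} {A : Type*} [AddCommGroup A] [Module R A] (h : Subsingleton A) : DC x A :=
  ⟨fun a b _ => Subsingleton.elim a b, fun a => ⟨a, Subsingleton.elim _ _⟩⟩

lemma DC.congr {x : R} {A B : Type*} [AddCommGroup A] [Module R A] [AddCommGroup B] [Module R B] (e : A ≃ₗ[R] B)
    (h : DC x A) : DC x B := by
  have key : ∀ b : ℕ → B, dcm x B b = fun n => e (dcm x A (fun n => e.symm (b n)) n) := by
    intro b; funext n; simp [dcm_apply]
  constructor
  · intro b b' hb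
    rw [key, key] at hb
    have h1 : (fun n => e.symm (b n)) = fun n => e.symm (b' n) := h.1 (funext fun n => e.injective (congrFun hb n))
    exact funext fun n => e.symm.injective (congrFun h1 n)
  · intro b
    obtain ⟨a, ha⟩ := h.2 (fun n => e.symm (b n))
    refine ⟨fun n => e (a n), ?_⟩
    rw [key]
    funext n
    simp [ha]

lemma DC.hom {x : R} {T Y : Type*} [AddCommGroup T] [Module R T] [AddCommGroup Y] [Module R Y]
    (hT : ∀ t : T, ∃ k : ℕ, x ^ k • t = 0) : DC x (T →ₗ[R] Y) := by
  constructor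
  · rw [injective_iff_map_eq_zero]
    intro e he
    have h1 : ∀ n, e n = x • e (n+1) := fun n => sub_eq_zero.1 (congrFun he n)
    have h2 : ∀ k n, e n = x ^ k • e (n+k) := by
      intro k
      induction k with
      | zero => intro n; simp
      | succ k ih => intro n; rw [ih n, h1 (n+k), smul_smul, ← pow_succ, add_assoc]
    funext n
    refine LinearMap.ext fun t => ?_
    obtain ⟨k, hk⟩ := hT t
    rw [h2 k n, LinearMap.smul_apply, ← map_smul, hk, map_zero]; rfl
  · intro f
    choose k hk using hT
    let S : ℕ → ℕ → T → Y := fun K n t => ∑ m ∈ Finset.range K, f (n+m) (x^m • t)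
    have hS : ∀ K t, k t ≤ K → ∀ n, S K n t = S (k t) n t := by
      intro K t hK n
      refine (Finset.sum_subset (Finset.range_mono hK) ?_).symm
      intro m _ hm
      have hm' : k t ≤ m := by simpa using hm
      obtain ⟨j, rfl⟩ := Nat.exists_eq_add_of_le hm'
      rw [add_comm (k t) j, pow_add, mul_smul, hk t, smul_zero, map_zero]
    let e : ℕ → (T →ₗ[R] Y) := fun n =>
      { toFun := fun t => S (k t) n t
        map_add' := by
          intro a b
          have h1 : k a ≤ max (max (k a) (k b)) (k (a+b)) := (le_max_left _ _).trans (le_max_left _ _)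
          have h2 : k b ≤ max (max (k a) (k b)) (k (a+b)) := (le_max_right _ _).trans (le_max_left _ _)
          rw [← hS _ _ h1, ← hS _ _ h2, ← hS _ _ (le_max_right (max (k a) (k b)) (k (a+b)))]
          simp only [S, smul_add, map_add, Finset.sum_add_distrib]
        map_smul' := by
          intro r a
          rw [← hS _ _ (le_max_left (k a) (k (r • a))), ← hS _ _ (le_max_right (k a) (k (r • a)))]
          simp only [S, Finset.smul_sum, RingHom.id_apply]
          refine Finset.sum_congr rfl fun m _ => ?_
          rw [smul_comm, map_smul] }
    refine ⟨e, funext fun n => LinearMap.ext fun t => ?_⟩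
    change S (k t) n t - x • S (k t) (n+1) t = f n t
    rw [← hS (k t + 1) t (Nat.le_succ _) n]
    simp only [S, Finset.sum_range_succ', Finset.smul_sum]
    have : ∀ m ∈ Finset.range (k t), f (n + (m+1)) (x^(m+1) • t) = x • f (n+1+m) (x^m • t) := by
      intro m _
      rw [← map_smul, smul_smul, ← pow_succ', add_assoc n 1 m, add_comm 1 m]
    rw [Finset.sum_congr rfl this]
    simp

lemma DC.ext {x : R} {T : Type u} [AddCommGroup T] [Module R T] (hT : ∀ t : T, ∃ k : ℕ, x ^ k • t = 0) (i : ℕ) :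
    ∀ (Y : Type u) [AddCommGroup Y] [Module R Y], DC x (EX R T Y i) := by
  induction i with
  | zero => 
    intro Y _ _
    exact (DC.hom hT).congr (EX.hom₀ T Y).symm
  | succ i ih =>
    intro Y _ _
    obtain ⟨J, _, _, f, hJ, hf⟩ := exists_inj (R := R) Y
    obtain ⟨δ, h⟩ := (SES.coker hf).exδ T
    have hsub : Subsingleton (EX R T J (i+1)) := EX.subsingleton_inj i
    refine DC.five (f₄ := (0 : EX R T J (i+1) →ₗ[R] PUnit.{1})) (h i).2.1 (h i).2.2 ?_ (ih _) (ih _) (DC.of_sub hsub) (DC.of_sub inferInstance)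
    intro y
    exact ⟨fun _ => ⟨0, Subsingleton.elim _ _⟩, fun _ => rfl⟩

lemma dc_ring [IsLocalRing R] [IsAdicComplete (IsLocalRing.maximalIdeal R) R] {x : R} (hx : x ∈ IsLocalRing.maximalIdeal R)
    : Function.Surjective (dcm x R) := by
  intro f
  let m := IsLocalRing.maximalIdeal R
  let S : ℕ → ℕ → R := fun n M => ∑ k ∈ Finset.range M, x^k * f (n+k)
  have hS : ∀ n M, S n (M+1) = f n + x * S (n+1) M := by
    intro n M
    simp only [S, Finset.sum_range_succ', Finset.mul_sum]
    have : ∀ k ∈ Finset.range M, x^(k+1) * f (n+(k+1)) = x * (x^k * f (n+1+k)) := by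
      intro k _
      rw [add_assoc n 1 k, add_comm 1 k]; ring
    rw [Finset.sum_congr rfl this]
    simp [add_comm]
  have hS2 : ∀ n M K, M ≤ K → S n M ≡ S n K [SMOD (m ^ M • ⊤ : Submodule R R)] := by
    intro n M K hMK
    induction K, hMK using Nat.le_induction with
    | base => exact SModEq.rfl
    | succ K hK ih =>
      refine ih.trans ?_
      rw [SModEq.comm, SModEq.sub_mem]
      simp only [S, Finset.sum_range_succ, add_sub_cancel_left]
      rw [smul_eq_mul, Ideal.mul_top]
      exact Ideal.mul_mem_right _ _ (Ideal.pow_le_pow_right hK (Ideal.pow_mem_pow hx K))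
  have : ∀ n, ∃ L : R, ∀ M, S n M ≡ L [SMOD (m ^ M • ⊤ : Submodule R R)] := fun n =>
    IsPrecomplete.prec' (S n) (fun {a b} hab => hS2 n a b hab)
  choose L hL using this
  refine ⟨L, funext fun n => ?_⟩
  rw [dcm_apply, ← sub_eq_zero]
  refine IsHausdorff.haus' (I := m) _ fun M => ?_
  rw [SModEq.zero]
  have h1 := (SModEq.sub_mem.1 (hL n (M+1)))
  have h2 := (SModEq.sub_mem.1 (hL (n+1) M))
  rw [smul_eq_mul, Ideal.mul_top] at h1 h2 ⊢
  have h3 := Ideal.pow_le_pow_right (Nat.le_succ M) h1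
  have e : L n - x • L (n+1) - f n = x * (S (n+1) M - L (n+1)) - (S n (M+1) - L n) := by
    rw [hS, smul_eq_mul]; ring
  rw [e]
  exact Ideal.sub_mem _ (Ideal.mul_mem_left _ _ h2) h3

lemma nak_dc [IsNoetherianRing R] [IsLocalRing R] [IsAdicComplete (IsLocalRing.maximalIdeal R) R] {x : R} (hx : x ∈ IsLocalRing.maximalIdeal R)
    {E : Type*} [AddCommGroup E] [Module R E] (hE : Function.Injective (dcm x E)) 
    {F : Type*} [AddCommGroup F] [Module R F] (h : Module.Finite R F) (g : E →ₗ[R] F)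
    (hg : ∀ e, g e = 0 → ∃ e', e = x • e') : Module.Finite R E := by
  have hr : Module.Finite R (LinearMap.range g) := Module.Finite.of_injective _ (LinearMap.range g).subtype_injective
  obtain ⟨n, s, hs⟩ := Module.Finite.exists_fin (R := R) (M := LinearMap.range g)
  choose t ht using fun i => g.surjective_rangeRestrict (s i)
  have step : ∀ e : E, ∃ (r : Fin n → R) (e' : E), e = ∑ i, r i • t i + x • e' := by
    intro e
    have : g.rangeRestrict e ∈ Submodule.span R (Set.range s) := by rw [hs]; trivial
    obtain ⟨r, hr⟩ := (Submodule.mem_span_range_iff_exists_fun R).1 this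
    have : g.rangeRestrict (e - ∑ i, r i • t i) = 0 := by
      rw [map_sub, map_sum, ← hr, sub_eq_zero]
      exact Finset.sum_congr rfl fun i _ => by rw [map_smul, ht]
    obtain ⟨e', he'⟩ := hg _ (congrArg Subtype.val this)
    exact ⟨r, e', by rw [← he']; abel⟩
  choose r nx hst using step
  classical
  refine ⟨⟨Finset.univ.image t, ?_⟩⟩
  rw [eq_top_iff]
  rintro e -
  let sq : ℕ → E := fun n => nx^[n] e
  have h1 : ∀ k, dcm x E sq k = ∑ i, r (sq k) i • t i := by
    intro k
    rw [dcm_apply, sub_eq_iff_eq_add]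
    have : sq (k+1) = nx (sq k) := Function.iterate_succ_apply' nx k e
    rw [this]
    exact hst _
  choose c hc using fun i => dc_ring hx (fun k => r (sq k) i)
  have h2 : dcm x E (fun k => ∑ i, c i k • t i) = dcm x E sq := by
    funext k
    rw [h1, dcm_apply, Finset.smul_sum, ← Finset.sum_sub_distrib]
    refine Finset.sum_congr rfl fun i _ => ?_
    have := congrFun (hc i) k
    rw [dcm_apply] at this
    rw [← this, smul_smul, sub_smul, smul_eq_mul]
  have h3 := congrFun (hE h2) 0
  change _ = e at h3
  rw [← h3]
  exact Submodule.sum_mem _ fun i _ => Submodule.smul_mem _ _ (Submodule.subset_span (by simp))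
end E7
end CLC

set_option linter.all false
namespace CLC
section E8
open Limits Pretriangulated
universe v w
variable {R : Type u} [CommRing R]

lemma fin_exactU [IsNoetherianRing R] {A B C : Type*} [AddCommGroup A] [Module R A] [AddCommGroup B] [Module R B]
    [AddCommGroup C] [Module R C] {f : A →ₗ[R] B} {g : B →ₗ[R] C} (h : Function.Exact f g)
    (hA : Module.Finite R A) (hC : Module.Finite R C) : Module.Finite R B := by
  refine ⟨Submodule.fg_of_fg_map_of_fg_inf_ker g ?_ ?_⟩
  · exact (isNoetherian_def.1 inferInstance) _
  · rw [top_inf_eq, LinearMap.exact_iff.1 h, LinearMap.range_eq_map]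
    exact (Module.finite_def.1 hA).map f

variable {C : Type w} [Category.{v} C] [HasZeroObject C] [HasShift C ℤ] [Preadditive C] [Linear R C]
  [∀ n : ℤ, (shiftFunctor C n).Additive] [Pretriangulated C] 

/-- Precomposition -/
def pc (R : Type u) [CommRing R] [Linear R C] {X Y : C} (f : X ⟶ Y) (W : C) : (Y ⟶ W) →ₗ[R] (X ⟶ W) := Linear.leftComp R W f
/-- Postcomposition -/
def qc (R : Type u) [CommRing R] [Linear R C] (W : C) {X Y : C} (f : X ⟶ Y) : (W ⟶ X) →ₗ[R] (W ⟶ Y) := Linear.rightComp R W f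

lemma pc_apply {X Y : C} (f : X ⟶ Y) (W : C) (g : Y ⟶ W) : pc R f W g = f ≫ g := rfl
lemma qc_apply (W : C) {X Y : C} (f : X ⟶ Y) (g : W ⟶ X) : qc R W f g = g ≫ f := rfl

lemma pc_exact {T : Triangle C} (hT : T ∈ distTriang C) (W : C) : Function.Exact (pc R T.mor₂ W) (pc R T.mor₁ W) := by
  intro f
  constructor
  · intro hf
    obtain ⟨g, hg⟩ := Triangle.yoneda_exact₂ T hT f hf
    exact ⟨g, hg.symm⟩
  · rintro ⟨g, rfl⟩
    change T.mor₁ ≫ T.mor₂ ≫ g = 0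
    rw [← Category.assoc, comp_distTriang_mor_zero₁₂ T hT, zero_comp]

lemma qc_exact {T : Triangle C} (hT : T ∈ distTriang C) (W : C) : Function.Exact (qc R W T.mor₁) (qc R W T.mor₂) := by
  intro f
  constructor
  · intro hf
    obtain ⟨g, hg⟩ := Triangle.coyoneda_exact₂ T hT f hf
    exact ⟨g, hg.symm⟩
  · rintro ⟨g, rfl⟩
    change (g ≫ T.mor₁) ≫ T.mor₂ = 0
    rw [Category.assoc, comp_distTriang_mor_zero₁₂ T hT, comp_zero]

variable [∀ n : ℤ, (shiftFunctor C n).Linear R]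

lemma isoPost (X : C) {Y Z : C} (e : Y ≅ Z) : Nonempty ((X ⟶ Y) ≃ₗ[R] (X ⟶ Z)) :=
  ⟨LinearEquiv.ofLinear (qc R X e.hom) (qc R X e.inv) (by ext f; simp [qc_apply]) (by ext f; simp [qc_apply])⟩
lemma isoPre {X Y : C} (e : X ≅ Y) (Z : C) : Nonempty ((X ⟶ Z) ≃ₗ[R] (Y ⟶ Z)) :=
  ⟨LinearEquiv.ofLinear (pc R e.inv Z) (pc R e.hom Z) (by ext f; simp [pc_apply]) (by ext f; simp [pc_apply])⟩

lemma shiftEquiv1 (X Y : C) (n : ℤ) : Nonempty ((X ⟶ Y) ≃ₗ[R] (X⟦n⟧ ⟶ Y⟦n⟧)) :=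
  ⟨LinearEquiv.ofBijective ((shiftFunctor C n).mapLinearMap R (X := X) (Y := Y))
    ((Functor.FullyFaithful.ofFullyFaithful (shiftFunctor C n)).map_bijective X Y)⟩

/-- `Hom(X[k], W[i]) = Hom(X, W[i-k])` -/
lemma shiftL (X W : C) (k i : ℤ) : Nonempty ((X ⟶ W⟦i - k⟧) ≃ₗ[R] (X⟦k⟧ ⟶ W⟦i⟧)) := by
  obtain ⟨e1⟩ := shiftEquiv1 (R := R) X (W⟦i - k⟧) k
  obtain ⟨e2⟩ := isoPost (R := R) (X⟦k⟧) ((shiftFunctorAdd' C (i-k) k i (by omega)).app W).symm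
  exact ⟨e1.trans e2⟩

lemma shiftR (X W : C) (k i : ℤ) : Nonempty ((W⟦i - k⟧ ⟶ X) ≃ₗ[R] (W⟦i⟧ ⟶ X⟦k⟧)) := by
  obtain ⟨e1⟩ := shiftEquiv1 (R := R) (W⟦i - k⟧) X k
  obtain ⟨e2⟩ := isoPre (R := R) ((shiftFunctorAdd' C (i-k) k i (by omega)).app W).symm (X⟦k⟧)
  exact ⟨e1.trans e2⟩

/-- all `Hom(X, W[i])` f.g. -/
def FL (R : Type u) [CommRing R] [Linear R C] (W X : C) : Prop := ∀ i : ℤ, Module.Finite R (X ⟶ W⟦i⟧)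
/-- all `Hom(S[i], X)` f.g. -/
def FR (R : Type u) [CommRing R] [Linear R C] (S X : C) : Prop := ∀ i : ℤ, Module.Finite R (S⟦i⟧ ⟶ X)
def DL [Linear R C] (x : R) (W X : C) : Prop := ∀ i : ℤ, DC x (X ⟶ W⟦i⟧)

lemma FL.shift {W X : C} (h : FL R W X) (k : ℤ) : FL R W (X⟦k⟧) := fun i => by
  obtain ⟨e⟩ := shiftL (R := R) X W k i
  have := h (i-k)
  exact Module.Finite.equiv e
lemma FL.unshift {W X : C} (k : ℤ) (h : FL R W (X⟦k⟧)) : FL R W X := fun i => by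
  obtain ⟨e⟩ := shiftL (R := R) X W k (i+k)
  have := h (i+k)
  rw [add_sub_cancel_right] at e
  exact Module.Finite.equiv e.symm
lemma FR.shift {W X : C} (h : FR R W X) (k : ℤ) : FR R W (X⟦k⟧) := fun i => by
  obtain ⟨e⟩ := shiftR (R := R) X W k i
  have := h (i-k)
  exact Module.Finite.equiv e
lemma DL.shift {x : R} {W X : C} (h : DL x W X) (k : ℤ) : DL x W (X⟦k⟧) := fun i => by
  obtain ⟨e⟩ := shiftL (R := R) X W k i
  exact (h (i-k)).congr e
lemma FL.iso {W X Y : C} (h : FL R W X) (e : X ≅ Y) : FL R W Y := fun i => by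
  obtain ⟨e⟩ := isoPre (R := R) e (W⟦i⟧)
  have := h i
  exact Module.Finite.equiv e
lemma FR.iso {W X Y : C} (h : FR R W X) (e : X ≅ Y) : FR R W Y := fun i => by
  obtain ⟨e⟩ := isoPost (R := R) (W⟦i⟧) e
  have := h i
  exact Module.Finite.equiv e

lemma FL.mid [IsNoetherianRing R] {W : C} {T : Triangle C} (hT : T ∈ distTriang C) (h1 : FL R W T.obj₁) (h3 : FL R W T.obj₃) :
    FL R W T.obj₂ := fun i => fin_exactU (pc_exact hT _) (h3 i) (h1 i)
lemma FR.mid [IsNoetherianRing R] {W : C} {T : Triangle C} (hT : T ∈ distTriang C) (h1 : FR R W T.obj₁) (h3 : FR R W T.obj₃) :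
    FR R W T.obj₂ := fun i => fin_exactU (qc_exact hT _) (h1 i) (h3 i)
lemma FR.third [IsNoetherianRing R] {W : C} {T : Triangle C} (hT : T ∈ distTriang C) (h1 : FR R W T.obj₁) (h3 : FR R W T.obj₂) :
    FR R W T.obj₃ := FR.mid (rot_of_distTriang T hT) h3 (h1.shift 1)
lemma DL.third {x : R} {W : C} {T : Triangle C} (hT : T ∈ distTriang C) (h1 : DL x W T.obj₁) (h2 : DL x W T.obj₂) :
    DL x W T.obj₃ := fun i => 
  DC.five (pc_exact (rot_of_distTriang _ (rot_of_distTriang T hT)) (W⟦i⟧)) (pc_exact (rot_of_distTriang T hT) (W⟦i⟧)) (pc_exact hT (W⟦i⟧))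
    (h2.shift 1 i) (h1.shift 1 i) (h2 i) (h1 i)

/-- cone descent -/
lemma FL.of_cone [IsNoetherianRing R] [IsLocalRing R] [IsAdicComplete (IsLocalRing.maximalIdeal R) R] {x : R}
    (hx : x ∈ IsLocalRing.maximalIdeal R) {W X Y : C} {g : X ⟶ Y} {h : Y ⟶ X⟦(1:ℤ)⟧}
    (hT : Triangle.mk (x • 𝟙 X) g h ∈ distTriang C) (hX : DL x W X) (hY : FL R W Y) : FL R W X := by
  refine FL.unshift 1 fun i => ?_
  refine nak_dc hx (hX.shift 1 i).1 (hY i) (pc R h (W⟦i⟧)) fun e he => ?_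
  obtain ⟨e', he'⟩ : ∃ e' : X⟦(1:ℤ)⟧ ⟶ W⟦i⟧, e = (-((x • 𝟙 X)⟦(1:ℤ)⟧')) ≫ e' := Triangle.yoneda_exact₂ _ (rot_of_distTriang _ (rot_of_distTriang _ hT)) e he
  refine ⟨-e', ?_⟩
  rw [he', Functor.map_smul, CategoryTheory.Functor.map_id, Preadditive.neg_comp, Linear.smul_comp, Category.id_comp, smul_neg]

lemma cone_kill {x a : R} {X Y : C} {g : X ⟶ Y} {h : Y ⟶ X⟦(1:ℤ)⟧}
    (hT : Triangle.mk (x • 𝟙 X) g h ∈ distTriang C) (ha : a • 𝟙 X = 0) : (a * a) • 𝟙 Y = 0 := by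
  have ha1 : a • 𝟙 (X⟦(1:ℤ)⟧) = 0 := by
    rw [← CategoryTheory.Functor.map_id, ← Functor.map_smul, ha, Functor.map_zero]
  have h1 : (a • 𝟙 Y) ≫ h = 0 := by
    rw [Linear.smul_comp, Category.id_comp, ← Category.comp_id h, ← Linear.comp_smul, ha1, comp_zero]
  obtain ⟨u, hu⟩ : ∃ u : Y ⟶ X, a • 𝟙 Y = u ≫ g := Triangle.coyoneda_exact₃ _ hT (a • 𝟙 Y) h1
  have h2 : a • g = 0 := by
    rw [← Category.id_comp g, ← Linear.smul_comp, ha, zero_comp]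
  rw [mul_smul, hu, ← Linear.comp_smul, h2, comp_zero]

lemma cone_kill' {x : R} {X Y : C} {g : X ⟶ Y} {h : Y ⟶ X⟦(1:ℤ)⟧}
    (hT : Triangle.mk (x • 𝟙 X) g h ∈ distTriang C) : (x * x) • 𝟙 Y = 0 := by
  have h0 : x • g = 0 := by
    have := comp_distTriang_mor_zero₁₂ _ hT
    change (x • 𝟙 X) ≫ g = 0 at this
    rwa [Linear.smul_comp, Category.id_comp] at this
  have h1' : x • h = 0 := by
    have := comp_distTriang_mor_zero₃₁ _ hT
    change h ≫ (x • 𝟙 X)⟦(1:ℤ)⟧' = 0 at this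
    rwa [Functor.map_smul, CategoryTheory.Functor.map_id, Linear.comp_smul, Category.comp_id] at this
  have h1 : (x • 𝟙 Y) ≫ h = 0 := by
    rw [Linear.smul_comp, Category.id_comp, h1']
  obtain ⟨u, hu⟩ : ∃ u : Y ⟶ X, x • 𝟙 Y = u ≫ g := Triangle.coyoneda_exact₃ _ hT (x • 𝟙 Y) h1
  rw [mul_smul, hu, ← Linear.comp_smul, h0, comp_zero]
end E8
end CLC

set_option linter.all false
namespace CLC
section E9
open Limits Pretriangulated
universe w
variable {R : Type u} [CommRing R]

lemma ext_fg_of_pow [IsNoetherianRing R] (I : Ideal R) (k : ℕ) (T : Type u) [AddCommGroup T] [Module R T]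
    (hT : ∀ i, Module.Finite R (EX R (R ⧸ I) T i)) (i : ℕ) : ∀ (k : ℕ) (A : Type u) [AddCommGroup A] [Module R A],
    Module.Finite R A → Kd (I ^ k) A → Module.Finite R (EX R A T i) := by
  have hgen : ∀ i, (∀ p : Ideal R, p.IsPrime → I ≤ p → Module.Finite R (EX R (R ⧸ p) T i)) → ∀ (k : ℕ) (A : Type u) [AddCommGroup A] [Module R A],
    Module.Finite R A → Kd (I ^ k) A → Module.Finite R (EX R A T i) := by
    intro i h k A _ _ hA hk
    refine fg_ind (I ^ k) (P := fun A _ _ => Module.Finite R (EX R A T i)) ?_ ?_ ?_ ?_ A hA hk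
    · intro M _ _ hM
      have := EX.sub_of_sub' (R := R) (X := M) (M := T) i
      exact inferInstance
    · intro M N _ _ _ _ e hM
      exact Module.Finite.equiv (EX.congr' T i e)
    · intro p hp hpk
      exact h p hp (hp.le_of_pow_le hpk)
    · intro M N L _ _ _ _ _ _ f g s hM hL
      obtain ⟨δ, h1, h2, h3⟩ := EX.les' s.inj s.surj s.exact T i
      exact fin_exact h1 hL hM
  induction i with
  | zero => 
    refine hgen 0 fun p hp hIp => ?_
    have hs : Function.Surjective (Submodule.factor hIp : (R ⧸ I) →ₗ[R] (R ⧸ p)) := Submodule.factor_surjective hIp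
    exact fin_inj (EX.pre0_inj hs) (hT 0)
  | succ i ih =>
    refine hgen (i+1) fun p hp hIp => ?_
    have hs : Function.Surjective (Submodule.factor hIp : (R ⧸ I) →ₗ[R] (R ⧸ p)) := Submodule.factor_surjective hIp
    have s := SES.ker hs
    obtain ⟨δ, h1, h2, h3⟩ := EX.les' s.inj s.surj s.exact T i
    refine fin_exact h3 ?_ (hT (i+1))
    refine ih 1 _ (Module.Finite.of_injective _ s.inj) ?_
    rw [pow_one]
    exact (Kd.quot I).inj s.inj

variable [HasDerivedCategory.{w} (ModuleCat.{u} R)]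

noncomputable def sg (A : ModuleCat.{u} R) : DerivedCategory (ModuleCat.{u} R) := (DerivedCategory.singleFunctor (ModuleCat.{u} R) 0).obj A

noncomputable abbrev tt : Triangulated.TStructure (DerivedCategory (ModuleCat.{u} R)) := DerivedCategory.TStructure.t

lemma sg_ge (A : ModuleCat.{u} R) : tt.IsGE (sg A) 0 := 
  inferInstanceAs (((DerivedCategory.singleFunctor (ModuleCat.{u} R) 0).obj A).IsGE 0)
lemma sg_le (A : ModuleCat.{u} R) : tt.IsLE (sg A) 0 := 
  inferInstanceAs (((DerivedCategory.singleFunctor (ModuleCat.{u} R) 0).obj A).IsLE 0)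

lemma exlin (A B : Type u) [AddCommGroup A] [Module R A] [AddCommGroup B] [Module R B] (n : ℕ) :
   Nonempty (EX R A B n ≃ₗ[R] (sg (ModuleCat.of R A) ⟶ (sg (ModuleCat.of R B))⟦(n:ℤ)⟧)) :=
  ⟨Abelian.Ext.homLinearEquiv⟩

lemma sg_neg (A B : ModuleCat.{u} R) (i : ℤ) (hi : i < 0) : Subsingleton (sg A ⟶ (sg B)⟦i⟧) := by
  have h1 := sg_le A
  have h2 := sg_ge B
  have h3 : tt.IsGE ((sg B)⟦i⟧) (-i) := tt.isGE_shift (sg B) 0 i (-i)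
  refine ⟨fun f g => ?_⟩
  rw [tt.zero f 0 (-i) (by omega), tt.zero g 0 (-i) (by omega)]

lemma fin_sg (A B : Type u) [AddCommGroup A] [Module R A] [AddCommGroup B] [Module R B]
    (h : ∀ n, Module.Finite R (EX R A B n)) : FL R (sg (ModuleCat.of R B)) (sg (ModuleCat.of R A)) := fun i => by
  by_cases hi : i < 0
  · have := sg_neg (ModuleCat.of R A) (ModuleCat.of R B) i hi
    infer_instance
  · obtain ⟨n, rfl⟩ := Int.eq_ofNat_of_zero_le (not_lt.1 hi)
    obtain ⟨e⟩ := exlin (R := R) A B n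
    have := h n
    exact Module.Finite.equiv e

lemma dc_sg {x : R} (A B : Type u) [AddCommGroup A] [Module R A] [AddCommGroup B] [Module R B]
    (hT : ∀ t : A, ∃ k : ℕ, x ^ k • t = 0) : DL x (sg (ModuleCat.of R B)) (sg (ModuleCat.of R A)) := fun i => by
  by_cases hi : i < 0
  · exact DC.of_sub (sg_neg (ModuleCat.of R A) (ModuleCat.of R B) i hi)
  · obtain ⟨n, rfl⟩ := Int.eq_ofNat_of_zero_le (not_lt.1 hi)
    obtain ⟨e⟩ := exlin (R := R) A B n
    exact (DC.ext hT n B).congr e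

lemma FR_of_FL {X Y : DerivedCategory (ModuleCat.{u} R)} (h : FL R X Y) : FR R Y X := fun i => by
  obtain ⟨e1⟩ := shiftL (R := R) Y X i 0
  obtain ⟨e2⟩ := isoPost (R := R) (Y⟦i⟧) ((shiftFunctorZero _ ℤ).app X)
  have := h (0 - i)
  exact Module.Finite.equiv (e1.trans e2)

lemma sg_kill {A : ModuleCat.{u} R} {r : R} (h : r • 𝟙 (sg A) = 0) (a : A) : r • a = 0 := by
  have h1 : (DerivedCategory.singleFunctor (ModuleCat.{u} R) 0).map (r • 𝟙 A) = (DerivedCategory.singleFunctor (ModuleCat.{u} R) 0).map 0 := by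
    rw [Functor.map_smul, CategoryTheory.Functor.map_id, Functor.map_zero]
    exact h
  have h2 := (DerivedCategory.singleFunctor (ModuleCat.{u} R) 0).map_injective h1
  have h3 := congrArg (fun f : A ⟶ A => f.hom a) h2
  exact h3

lemma trunc [IsNoetherianRing R] (I : Ideal R) (T : Type u) [AddCommGroup T] [Module R T]
    (hT : ∀ i, Module.Finite R (EX R (R ⧸ I) T i)) (M : ℕ) (n : ℕ) : ∀ X : DerivedCategory (ModuleCat.{u} R),
    tt.IsGE X 0 → tt.IsLE X ((n:ℤ)-1) → FR R (sg (ModuleCat.of R (R ⧸ I))) X → (∀ a ∈ I ^ M, a • 𝟙 X = 0) →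
    FL R (sg (ModuleCat.of R T)) X := by
  induction n with
  | zero =>
    intro X h1 h2 _ _ i
    have h0 : IsZero X := tt.isZero X (((0:ℕ):ℤ)-1) 0 (by omega)
    have : Subsingleton (X ⟶ (sg (ModuleCat.of R T))⟦i⟧) := ⟨fun f g => h0.eq_of_src f g⟩
    infer_instance
  | succ n ih =>
    intro X h1 h2 hF hk
    obtain ⟨P, Q, hP, hQ, f, g, h, hd⟩ := tt.exists_triangle X 0 1 rfl
    rw [tt.le_iff_isLE] at hP
    rw [tt.ge_iff_isGE] at hQ
    have hP1 : tt.IsLE (P⟦(1:ℤ)⟧) (-1) := tt.isLE_shift P 0 1 (-1)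
    have hQ1 : tt.IsGE (Q⟦(-1:ℤ)⟧) 2 := tt.isGE_shift Q 1 (-1) 2
    have hPg : tt.IsGE P 0 := tt.isGE₂ _ (inv_rot_of_distTriang _ hd) 0 (tt.isGE_of_ge (Q⟦(-1:ℤ)⟧) 0 2) h1
    have hQl : tt.IsLE Q ((n+1:ℕ)-1:ℤ) := tt.isLE₂ _ (rot_of_distTriang _ hd) _ h2 (tt.isLE_of_le (P⟦(1:ℤ)⟧) (-1) _ (by push_cast; omega))
    have hkQ : ∀ a ∈ I ^ M, a • 𝟙 Q = 0 := by
      intro a ha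
      have e1 : g ≫ (a • 𝟙 Q) = 0 := by
        rw [Linear.comp_smul, Category.comp_id, ← Category.id_comp g, ← Linear.smul_comp, hk a ha, zero_comp]
      obtain ⟨v, hv⟩ : ∃ v : P⟦(1:ℤ)⟧ ⟶ Q, a • 𝟙 Q = h ≫ v := Triangle.yoneda_exact₃ _ hd _ e1
      rw [hv, tt.zero v (-1) 1 (by omega), comp_zero]
    have hkP : ∀ a ∈ I ^ M, a • 𝟙 P = 0 := by
      intro a ha
      have e0 : (a • 𝟙 P) ≫ f = 0 := by
        rw [Linear.smul_comp, Category.id_comp, ← Category.comp_id f, ← Linear.comp_smul, hk a ha, comp_zero]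
      have e1 : (a • 𝟙 P)⟦(1:ℤ)⟧' ≫ f⟦(1:ℤ)⟧' = 0 := by
        rw [← Functor.map_comp, e0, Functor.map_zero]
      obtain ⟨v, hv⟩ : ∃ v : P⟦(1:ℤ)⟧ ⟶ Q, (a • 𝟙 P)⟦(1:ℤ)⟧' = v ≫ h := Triangle.coyoneda_exact₁ _ hd _ e1
      rw [tt.zero v (-1) 1 (by omega), zero_comp, ← Functor.map_zero (shiftFunctor _ (1:ℤ))] at hv
      exact (shiftFunctor (DerivedCategory (ModuleCat.{u} R)) (1:ℤ)).map_injective hv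
    obtain ⟨A, ⟨e⟩⟩ : ∃ A : ModuleCat.{u} R, Nonempty (P ≅ sg A) := DerivedCategory.exists_iso_singleFunctor_obj_of_isGE_of_isLE P 0
    have hkA : Kd (I ^ M) A := by
      intro a ha y
      refine sg_kill ?_ y
      have : a • 𝟙 (sg A) = e.inv ≫ (a • 𝟙 P) ≫ e.hom := by simp
      rw [this, hkP a ha, zero_comp, comp_zero]
    have hfA : Module.Finite R A := by
      refine fin_of_kl_of_pow I ?_ (k := M) hkA
      rw [fin_kl_iff]
      obtain ⟨e1⟩ := exlin (R := R) (R ⧸ I) A 0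
      obtain ⟨e2⟩ : Nonempty ((sg (ModuleCat.of R (R ⧸ I)) ⟶ (sg A)⟦((0:ℕ):ℤ)⟧) ≃ₗ[R] (sg (ModuleCat.of R (R ⧸ I)) ⟶ sg A)) := isoPost (R := R) (sg (ModuleCat.of R (R ⧸ I))) ((shiftFunctorZero _ ℤ).app (sg A))
      obtain ⟨e3⟩ := isoPre (R := R) ((shiftFunctorZero _ ℤ).app (sg (ModuleCat.of R (R ⧸ I)))) X
      have hfin : Module.Finite R (sg (ModuleCat.of R (R ⧸ I)) ⟶ X) := by
        have := hF 0
        exact Module.Finite.equiv e3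
      have hfin2 : Module.Finite R (sg (ModuleCat.of R (R ⧸ I)) ⟶ sg A) := by
        refine Module.Finite.of_injective (qc R (sg (ModuleCat.of R (R ⧸ I))) (e.inv ≫ f)) ?_
        rw [injective_iff_map_eq_zero]
        intro z hz
        rw [qc_apply, ← Category.assoc] at hz
        have hle := sg_le (ModuleCat.of R (R ⧸ I))
        obtain ⟨v, hv⟩ : ∃ v : sg (ModuleCat.of R (R ⧸ I)) ⟶ Q⟦(-1:ℤ)⟧, z ≫ e.inv = v ≫ (show Q⟦(-1:ℤ)⟧ ⟶ P from (Triangle.mk f g h).invRotate.mor₁) :=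
          Triangle.coyoneda_exact₂ _ (inv_rot_of_distTriang _ hd) _ hz
        rw [tt.zero v 0 2 (by omega), zero_comp] at hv
        rw [← Category.comp_id z, ← e.inv_hom_id, ← Category.assoc, hv, zero_comp]
      have : Module.Finite R (sg (ModuleCat.of R (R ⧸ I)) ⟶ (sg A)⟦((0:ℕ):ℤ)⟧) := Module.Finite.equiv e2.symm
      exact Module.Finite.equiv e1.symm
    have hLP : FL R (sg (ModuleCat.of R T)) P := 
      (fin_sg A T fun i => ext_fg_of_pow I M T hT i M A hfA hkA).iso e.symm
    have hRP : FR R (sg (ModuleCat.of R (R ⧸ I))) P := 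
      (FR_of_FL (fin_sg (R ⧸ I) A fun i => EX.finite i)).iso e.symm
    have hRQ : FR R (sg (ModuleCat.of R (R ⧸ I))) Q := FR.third hd hRP hF
    have hLQ : FL R (sg (ModuleCat.of R T)) Q := by
      refine FL.unshift 1 (ih _ (tt.isGE_shift Q 1 1 0) (tt.isLE_shift Q (((n+1:ℕ):ℤ)-1) 1 _ ?_) (hRQ.shift 1) ?_)
      · push_cast; ring
      · intro a ha
        rw [← CategoryTheory.Functor.map_id, ← Functor.map_smul, hkQ a ha, Functor.map_zero]
    exact FL.mid hd hLP hLQ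

lemma chain [IsNoetherianRing R] [IsLocalRing R] [IsAdicComplete (IsLocalRing.maximalIdeal R) R] (I : Ideal R)
    (hI : I ≤ IsLocalRing.maximalIdeal R) (T : Type u) [AddCommGroup T] [Module R T]
    (hT : ∀ i, Module.Finite R (EX R (R ⧸ I) T i)) (l : List R) : ∀ (X : DerivedCategory (ModuleCat.{u} R)) (c : Set R),
    (∃ a, tt.IsGE X a) → (∃ b, tt.IsLE X b) → FR R (sg (ModuleCat.of R (R ⧸ I))) X → (∀ x ∈ I, DL x (sg (ModuleCat.of R T)) X) →
    (∀ x ∈ c, ∃ N : ℕ, x ^ N • 𝟙 X = 0) → I = Ideal.span (c ∪ {x | x ∈ l}) → FL R (sg (ModuleCat.of R T)) X := by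
  induction l with
  | nil =>
    rintro X c ⟨a, ha⟩ ⟨b, hb⟩ hF hD hc hsp
    obtain ⟨M, hM⟩ : ∃ M, ∀ r ∈ I ^ M, r • 𝟙 X = 0 := by
      let K : Ideal R := { carrier := {r | r • 𝟙 X = 0}
                           zero_mem' := zero_smul _ _
                           add_mem' := fun {p q} hp hq => by
                             change (p + q) • 𝟙 X = 0
                             rw [add_smul, show p • 𝟙 X = 0 from hp, show q • 𝟙 X = 0 from hq, add_zero]
                           smul_mem' := fun p q hq => by
                             change (p * q) • 𝟙 X = 0
                             rw [mul_smul, show q • 𝟙 X = 0 from hq, smul_zero] }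
      have : I ≤ K.radical := by
        rw [hsp, Ideal.span_le]
        rintro x (hx | hx)
        · exact hc x hx
        · simp at hx
      obtain ⟨M, hM⟩ := Ideal.exists_pow_le_of_le_radical_of_fg this (IsNoetherian.noetherian I)
      exact ⟨M, fun r hr => hM hr⟩
    refine FL.unshift a (trunc I T hT M ((b - a + 1).toNat) (X⟦a⟧) (tt.isGE_shift X a a 0) ?_ (hF.shift a) ?_)
    · have := tt.isLE_shift X b a (b - a)
      exact tt.isLE_of_le (X⟦a⟧) (b - a) _ (by omega)
    · intro r hr
      rw [← CategoryTheory.Functor.map_id, ← Functor.map_smul, hM r hr, Functor.map_zero]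
  | cons x l ih =>
    rintro X c ⟨a, ha⟩ ⟨b, hb⟩ hF hD hc hsp
    have hxI : x ∈ I := by rw [hsp]; exact Ideal.subset_span (Or.inr (by simp))
    obtain ⟨Y, g, h, hd⟩ := distinguished_cocone_triangle (x • 𝟙 X)
    refine FL.of_cone (hI hxI) hd (hD x hxI) (ih Y (insert x c) ?_ ?_ (FR.third hd hF hF) (fun y hy => DL.third hd (hD y hy) (hD y hy)) ?_ ?_)
    · refine ⟨a-1, tt.isGE₂ _ (rot_of_distTriang _ hd) _ (tt.isGE_of_ge X (a-1) a) (tt.isGE_shift X a 1 (a-1))⟩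
    · have := tt.isLE_shift X b 1 (b-1)
      refine ⟨b, tt.isLE₂ _ (rot_of_distTriang _ hd) _ hb (tt.isLE_of_le (X⟦(1:ℤ)⟧) (b-1) b)⟩
    · rintro y (rfl | hy)
      · exact ⟨2, by rw [pow_two]; exact cone_kill' hd⟩
      · obtain ⟨N, hN⟩ := hc y hy
        exact ⟨N + N, by rw [pow_add]; exact cone_kill hd hN⟩
    · rw [hsp]
      congr 1
      ext y
      simp only [Set.mem_union, Set.mem_setOf_eq, List.mem_cons, Set.mem_insert_iff]
      tauto
end E9

section E9b
variable {R : Type u} [CommRing R]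
theorem endFG [IsNoetherianRing R] [IsLocalRing R] [IsAdicComplete (IsLocalRing.maximalIdeal R) R] {I : Ideal R}
    (hI : I ≤ IsLocalRing.maximalIdeal R) (T T0 : Type u) [AddCommGroup T] [Module R T] [AddCommGroup T0] [Module R T0]
    (h1 : Cof I T) (h2 : Cof I T0) : Module.Finite R (T →ₗ[R] T0) := by
  letI := HasDerivedCategory.standard (ModuleCat.{u} R)
  obtain ⟨s, hs⟩ := IsNoetherian.noetherian I
  have key := chain I hI T0 h2.2 s.toList (sg (ModuleCat.of R T)) ∅ ⟨0, sg_ge _⟩ ⟨0, sg_le _⟩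
    (FR_of_FL (fin_sg (R ⧸ I) T h1.2)) (fun x hx => dc_sg T T0 fun t => by
      obtain ⟨k, hk⟩ := h1.1 t
      exact ⟨k, hk _ (Ideal.pow_mem_pow hx k)⟩) (by simp) (by
      rw [← hs]; congr 1; ext; simp) ((0:ℕ):ℤ)
  obtain ⟨e⟩ := exlin (R := R) T T0 0
  have := Module.Finite.equiv e.symm
  exact Module.Finite.equiv (EX.hom₀ T T0)
end E9b
end CLC

set_option linter.all false
namespace CLC
section F1
variable {R : Type u} [CommRing R]
open IsLocalRing

/-- `p ⊂ q` is an immediate inclusion of primes -/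
def Imm (p q : Ideal R) : Prop := p < q ∧ ∀ r : Ideal R, r.IsPrime → p < r → r ≤ q → r = q

lemma det_alg {T : Type u} [AddCommGroup T] [Module R T] {x s : R} {q : Ideal R} (hq : q.IsPrime) (hx : x ∈ q)
    (hk : ∀ t : T, x • t = 0 → s • t = 0) (hc : ∀ t : T, ∃ t', x • t' = s • t) (hN : Module.Finite R (T →ₗ[R] T))
    (hA : Module.annihilator R T ≤ q) : s ∈ q := by
  choose g hg using hc
  obtain ⟨φ, hφ⟩ : ∃ φ : T →ₗ[R] T, ∀ t, x • φ t = (s^2) • t := by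
    refine ⟨{ toFun := fun t => s • g t, map_add' := fun a b => ?_, map_smul' := fun r a => ?_ }, fun t => ?_⟩
    · have := hk (g (a + b) - g a - g b) (by rw [smul_sub, smul_sub, hg, hg, hg, smul_add]; abel)
      rw [smul_sub, smul_sub] at this
      rw [sub_sub, sub_eq_zero] at this; exact this
    · have := hk (g (r • a) - r • g a) (by rw [smul_sub, hg, smul_comm x r, hg, smul_comm r s, sub_self])
      rw [smul_sub, sub_eq_zero] at this
      simp only [RingHom.id_apply]
      rw [this, smul_comm]
    · show x • s • g t = _
      rw [smul_comm, hg, ← mul_smul, pow_two]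
  obtain ⟨P, hP, -, hco, h0⟩ := LinearMap.exists_monic_and_natDegree_eq_and_coeff_mem_pow_and_aeval_eq_zero R
    (algebraMap R (Module.End R (T →ₗ[R] T)) (s^2)) (Ideal.span {x}) (by
      rintro _ ⟨ψ, rfl⟩
      have : (algebraMap R (Module.End R (T →ₗ[R] T)) (s^2)) ψ = x • (φ.comp ψ) := by
        rw [Module.algebraMap_end_apply]
        ext t
        exact (hφ (ψ t)).symm
      rw [this]
      exact Submodule.smul_mem_smul (Ideal.mem_span_singleton_self x) trivial)
  rw [Polynomial.aeval_algebraMap_apply_eq_algebraMap_eval] at h0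
  have h1 : P.eval (s^2) ∈ q := hA (Module.mem_annihilator.2 fun t => by
    have := congrArg (fun F : Module.End R (T →ₗ[R] T) => F LinearMap.id t) h0
    simpa using this)
  rw [Polynomial.eval_eq_sum_range, Finset.sum_range_succ, hP.coeff_natDegree, one_mul] at h1
  have h2 := (Ideal.add_mem_iff_right q (Ideal.sum_mem _ fun k hk => Ideal.mul_mem_right _ _ (by
    have hk' := Finset.mem_range.1 hk
    exact (Ideal.pow_le_self (by omega)).trans ((Ideal.span_singleton_le_iff_mem q).2 hx) (hco k)))).1 h1
  exact hq.mem_of_pow_mem _ (hq.mem_of_pow_mem _ h2)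

variable [IsNoetherianRing R]

lemma kill {I p q : Ideal R} (hq : q.IsPrime) (hpq : Imm p q) {x : R} (hx : x ∉ p) (i : ℕ) (h : Subsingleton (LC I i (R ⧸ q))) :
    ∃ s, s ∉ q ∧ ∀ t : LC I i ((R ⧸ p) ⧸ LinearMap.range (ml x (R ⧸ p))), s • t = 0 := by
  let P : ∀ (M : Type u) [AddCommGroup M] [Module R M], Prop := fun M _ _ => ∃ s, s ∉ q ∧ ∀ t : LC I i M, s • t = 0
  have h1 : (1 : R) ∉ q := fun h => hq.ne_top ((Ideal.eq_top_iff_one q).2 h)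
  have key := fg_ind (p ⊔ Ideal.span {x}) (P := P) ?_ ?_ ?_ ?_ ((R ⧸ p) ⧸ LinearMap.range (ml x (R ⧸ p))) inferInstance (Kd.coker (Kd.quot p))
  · exact key
  · intro M _ _ h; exact ⟨1, h1, fun t => have := LC.sub_of_sub (M := M) I i; Subsingleton.elim _ _⟩
  · rintro M N _ _ _ _ e ⟨s, hs, h⟩
    exact ⟨s, hs, fun t => (LC.congr I i e).symm.injective (by rw [_root_.map_smul, h, _root_.map_zero])⟩
  · intro p2 hp2 hle
    by_cases hle2 : p2 ≤ q
    · have hlt : p < p2 := lt_of_le_of_ne (le_sup_left.trans hle) fun h => hx (h ▸ hle (Ideal.mem_sup_right (Ideal.mem_span_singleton_self x)))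
      obtain rfl := hpq.2 p2 hp2 hlt hle2
      exact ⟨1, h1, fun t => Subsingleton.elim _ _⟩
    · obtain ⟨s, hs, hsq⟩ := SetLike.not_le_iff_exists.1 hle2
      exact ⟨s, hsq, (Kd.quot p2).lc I i s hs⟩
  · rintro M N L _ _ _ _ _ _ f g s ⟨s1, hs1, h1⟩ ⟨s2, hs2, h2⟩
    refine ⟨s1 * s2, fun h => (hq.mem_or_mem h).elim hs1 hs2, fun t => ?_⟩
    obtain ⟨δ, he, -, -⟩ := s.lcδ I i
    obtain ⟨y, hy⟩ := (he (s2 • t)).1 (by rw [_root_.map_smul, h2])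
    rw [mul_smul, ← hy, ← _root_.map_smul, h1, _root_.map_zero]

variable [IsLocalRing R]

lemma exists_imm {p P : Ideal R} (hP : P.IsPrime) (h : p < P) : ∃ q : Ideal R, q.IsPrime ∧ Imm p q ∧ q ≤ P := by
  classical
  have hex : ∃ n, ∃ q : Ideal R, q.IsPrime ∧ p < q ∧ q ≤ P ∧ dm p + 1 ≤ dm q + n + 1 := ⟨dm p, P, hP, h, le_rfl, by omega⟩
  have hfin : ∃ q : Ideal R, (q.IsPrime ∧ p < q ∧ q ≤ P) ∧ ∀ r : Ideal R, (r.IsPrime ∧ p < r ∧ r ≤ P) → r < q → False := by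
    have hs := Nat.find_spec hex
    obtain ⟨q, hq, h1, h2, h3⟩ := hs
    -- descending chain: choose `q` with maximal dimension
    have hb : ∃ n, ∀ r : Ideal R, (r.IsPrime ∧ p < r ∧ r ≤ P) → dm r ≤ n := 
      ⟨dm p, fun r hr => dm_anti hr.2.1.le (prime_le hr.1)⟩
    have hs := Nat.find_spec hb
    by_contra hno
    push Not at hno
    have : ∀ n, ∃ q : Ideal R, (q.IsPrime ∧ p < q ∧ q ≤ P) ∧ n ≤ dm q := by
      intro n
      induction n with
      | zero => exact ⟨P, ⟨hP, h, le_rfl⟩, by omega⟩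
      | succ n ih =>
        obtain ⟨q, hq, hn⟩ := ih
        obtain ⟨r, hr, hlt, -⟩ := hno q hq
        exact ⟨r, hr, by have := dm_lt hr.1 hq.1 hlt; omega⟩
    obtain ⟨q, hq, hn⟩ := this (Nat.find hb + 1)
    have := hs q hq
    omega
  obtain ⟨q, hq, hm⟩ := hfin
  refine ⟨q, hq.1, ⟨hq.2.1, fun r hr hpr hrq => ?_⟩, hq.2.2⟩
  by_contra hne
  exact hm r ⟨hr, hpr, hrq.trans hq.2.2⟩ (lt_of_le_of_ne hrq hne)

lemma chainV {I a : Ideal R} (C : ∀ p1 q1 : Ideal R, p1.IsPrime → q1.IsPrime → a ≤ p1 → Imm p1 q1 → ∀ k, V I q1 k → V I p1 (k+1))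
    {P : Ideal R} (hP : P.IsPrime) {k : ℕ} (hV : V I P k) (n : ℕ) : ∀ p : Ideal R, p.IsPrime → a ≤ p → p ≤ P → dm p ≤ dm P + n → 
      V I p (k + n) := by
  induction n with
  | zero =>
    intro p hp ha hle hd
    rcases eq_or_lt_of_le hle with h | h
    · rw [h]; exact hV
    · have := dm_lt hp hP h; omega
  | succ n ih =>
    intro p hp ha hle hd
    rcases eq_or_lt_of_le hle with h | h
    · rw [h]; exact hV.mono_k (by omega)
    · obtain ⟨q, hq, him, hqP⟩ := exists_imm hP h
      have := dm_lt hp hq him.1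
      exact C p q hp hq ha him (k + n) (ih q hq (ha.trans him.1.le) hqP (by omega))

lemma V_self {I P : Ideal R} (h : I ≤ P) : V I P 1 := fun i hi => by
  obtain ⟨i, rfl⟩ : ∃ j, i = j + 1 := ⟨i - 1, by omega⟩
  exact LC.tors_vanish I i _ fun y => ⟨1, fun a ha => Kd.quot P a (h (by simpa using ha)) y⟩

lemma V_ne_zero {I q : Ideal R} (hI : I ≤ maximalIdeal R) (hq : q.IsPrime) {k : ℕ} (h : V I q k) : k ≠ 0 := by
  rintro rfl
  exact lc0_ne hI (h.mono hq (maximalIdeal.isMaximal R).isPrime (prime_le hq) 0 le_rfl)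

end F1
end CLC

set_option linter.all false
namespace CLC
section F2
variable {R : Type u} [CommRing R] [IsNoetherianRing R] [IsLocalRing R]
open IsLocalRing

lemma cousin_faith {I p : Ideal R} (hI : I ≤ maximalIdeal R) (hp : p.IsPrime) {c : ℕ} (hV : V I p (c+1+1))
    (hne : ¬ Subsingleton (LC I (c+1) (R ⧸ p)))
    (C : ∀ p1 q1 : Ideal R, p1.IsPrime → q1.IsPrime → p < p1 → Imm p1 q1 → ∀ k, V I q1 k → V I p1 (k+1)) :
    Module.annihilator R (LC I (c+1) (R ⧸ p)) ≤ p := by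
  obtain ⟨p', ⟨hp', hpp', hne'⟩, hmax⟩ := (wellFounded_gt (α := Ideal R)).has_min
    {a : Ideal R | a.IsPrime ∧ p ≤ a ∧ ¬ Subsingleton (LC I (c+1) (R ⧸ a))} ⟨p, hp, le_rfl, hne⟩
  have hmax' : ∀ q : Ideal R, q.IsPrime → p' < q → Subsingleton (LC I (c+1) (R ⧸ q)) := fun q hq hlt => by
    by_contra h
    exact hmax q ⟨hq, hpp'.trans hlt.le, h⟩ hlt
  have hV' : V I p' (c+1+1) := hV.mono hp hp' hpp'
  have hVq : ∀ q : Ideal R, q.IsPrime → p' < q → V I q (c+1) := fun q hq hlt i hi => by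
    rcases eq_or_lt_of_le hi with h | h
    · subst h; exact hmax' q hq hlt
    · exact (hV'.mono hp' hq hlt.le) i h
  rcases eq_or_lt_of_le hpp' with h | h
  · subst h
    intro y hy
    by_contra hyp
    have hs := div_top (I := I) (c := c+1) hp hyp hmax'
    refine hne (subsingleton_of_forall_eq 0 fun t => ?_)
    obtain ⟨t, rfl⟩ := hs t
    exact Module.mem_annihilator.1 hy t
  · have hIp' : I ⊔ p' ≤ maximalIdeal R := sup_le hI (prime_le hp')
    by_cases he : dm (I ⊔ p') = 0
    · have h1 := dim_ineq hI 0 p' (c+1) hp' hV' (by omega)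
      have h2 : c + 1 ≤ dm p' := by
        by_contra hlt
        exact hne' (V_groth I hp' (c+1) (by omega))
      exact faith hI hp' he (by omega) p hp hV hpp'
    · exfalso
      have hpm : p' ≠ maximalIdeal R := by
        intro h
        apply he
        rw [h, sup_eq_right.2 hI]
        exact (dm_eq_zero (maximalIdeal.isMaximal R).isPrime).2 rfl
      obtain ⟨y, hym, hyp, hy⟩ := exists_avoid_min hIp' he p' hp' hpm
      have hy' : ∀ P ∈ (I ⊔ p').minimalPrimes, y ∉ P := fun P hP => hy P hP (min_dm_ne hIp' he hP)
      obtain ⟨q', hq', hle, hdq⟩ := exists_prime_dm (span_le_m (prime_le hp') hym)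
      have h1 := dm_sup_lt hp' hym hyp
      have h2 := dm_succ_le hIp' hym hy'
      have hlt : p' < q' := lt_of_le_of_ne (le_sup_left.trans hle) fun h => hyp (h ▸ hle (Ideal.mem_sup_right (Ideal.mem_span_singleton_self y)))
      have h3 : dm (I ⊔ q') ≤ dm (I ⊔ p' ⊔ Ideal.span {y}) := dm_anti (by
        rw [sup_assoc]; exact sup_le_sup_left hle I) (sup_le hI (prime_le hq'))
      have h4 := dim_ineq hI _ q' c hq' (hVq q' hq' hlt) le_rfl
      obtain ⟨P, hP, hPle, hPd⟩ := exists_prime_dm hIp'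
      have h5 := chainV (I := I) (a := p') (fun p1 q1 a b d e k f => C p1 q1 a b (lt_of_lt_of_le h d) e k f) hP
        (V_self (le_sup_left.trans hPle)) c p' hp' le_rfl (le_sup_right.trans hPle) (by omega)
      exact hne' (h5 (c+1) (by omega))

lemma lc_ker_coker {I p q : Ideal R} (hp : p.IsPrime) (hq : q.IsPrime) (hpq : Imm p q) {x : R} (hx : x ∉ p) {c : ℕ} 
    (hV : V I q c) : ∃ s, s ∉ q ∧ (∀ t : LC I (c+1) (R ⧸ p), x • t = 0 → s • t = 0) ∧ 
      ∀ t : LC I (c+1) (R ⧸ p), ∃ t', x • t' = s • t := by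
  obtain ⟨s1, hs1, h1⟩ := kill (I := I) hq hpq hx c (hV c le_rfl)
  obtain ⟨s2, hs2, h2⟩ := kill (I := I) hq hpq hx (c+1) (hV (c+1) (by omega))
  have s := SES.mlquot hp hx
  refine ⟨s1 * s2, fun h => (hq.mem_or_mem h).elim hs1 hs2, fun t ht => ?_, fun t => ?_⟩
  · obtain ⟨δ, -, -, he⟩ := s.lcδ I c
    rw [LC.map_ml] at he
    obtain ⟨w, rfl⟩ := (he t).1 ht
    rw [mul_comm, mul_smul, ← _root_.map_smul, h1, _root_.map_zero, smul_zero]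
  · obtain ⟨δ, he, -, -⟩ := s.lcδ I (c+1)
    rw [LC.map_ml] at he
    obtain ⟨w, hw⟩ := (he ((s1*s2) • t)).1 (by rw [_root_.map_smul, mul_smul, h2, smul_zero])
    exact ⟨w, hw⟩

theorem cousin [IsAdicComplete (maximalIdeal R) R] {I : Ideal R} (hI : I ≤ maximalIdeal R) (hc : Cls I) (p : Ideal R) : 
    ∀ q : Ideal R, p.IsPrime → q.IsPrime → Imm p q → ∀ k, V I q k → V I p (k+1) := by
  classical
  refine IsNoetherian.induction (R := R) (M := R) (P := fun p : Ideal R => 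
    ∀ q : Ideal R, p.IsPrime → q.IsPrime → Imm p q → ∀ k, V I q k → V I p (k+1)) (fun (p : Ideal R) ih => ?_) p
  intro q hp hq hpq k hV
  by_contra hno
  have hex : ∃ n, V I p n := ⟨_, V_groth I hp⟩
  have hs := Nat.find_spec hex
  have hk := V_ne_zero hI hq hV
  have hgt : k + 1 < Nat.find hex := by
    by_contra h
    exact hno (hs.mono_k (by omega))
  obtain ⟨c, hcn⟩ : ∃ c, Nat.find hex = c + 1 + 1 := ⟨Nat.find hex - 2, by omega⟩
  rw [hcn] at hs hgt
  have hne : ¬ Subsingleton (LC I (c+1) (R ⧸ p)) := by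
    intro h
    refine Nat.find_min hex (m := c+1) (by omega) fun i hi => ?_
    rcases eq_or_lt_of_le hi with h' | h'
    · subst h'; exact h
    · exact hs i h'
  have hA := cousin_faith hI hp hs hne fun p1 q1 a b d e k f => ih p1 d q1 a b e k f
  obtain ⟨x, hxq, hxp⟩ := SetLike.exists_of_lt hpq.1
  obtain ⟨s, hsq, h1, h2⟩ := lc_ker_coker (I := I) hp hq hpq hxp (c := c) (hV.mono_k (by omega))
  have hcof := hc (R ⧸ p) inferInstance (c+1)
  exact hsq (det_alg hq hxq h1 h2 (endFG hI _ _ hcof hcof) (hA.trans hpq.1.le))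

/-- dimension formula for immediate inclusions -/
theorem cat [IsAdicComplete (maximalIdeal R) R] {p q : Ideal R} (hp : p.IsPrime) (hq : q.IsPrime) (hpq : Imm p q) : 
    dm p ≤ dm q + 1 := by
  by_cases h0 : dm q = 0
  · have hqm := (dm_eq_zero hq).1 h0
    by_cases hp0 : dm p = 0
    · omega
    · obtain ⟨r, hr, hlt, hd⟩ := exists_dm_pred hp hp0
      have : r = q := hpq.2 r hr hlt (hqm ▸ prime_le hr)
      subst this; omega
  · obtain ⟨J, hJ, hqJ, hdJ⟩ := exists_dm_one hq h0
    have hJm := prime_le hJ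
    have hc : Cls J := cls_of J hJm fun p0 hp0 => Or.inr (by
      have : p0.IsPrime := hp0.1.1
      exact (dm_anti le_sup_left (sup_le hJm (prime_le this))).trans hdJ.le)
    have hV := chainV (I := J) (a := ⊥) (fun p1 q1 a b d e k f => cousin hJm hc p1 q1 a b e k f) hJ
      (V_self (le_refl J)) (dm q - 1) q hq bot_le hqJ (by omega)
    have hV2 := cousin hJm hc p q hp hq hpq _ hV
    have := dim_ineq hJm 1 p _ hp hV2 (by rw [sup_eq_left.2 (hpq.1.le.trans hqJ)]; omega)
    omega

end F2
end CLC

set_option linter.all false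
namespace CLC
section F3
variable {R : Type u} [CommRing R] [IsNoetherianRing R] [IsLocalRing R]
open IsLocalRing

lemma cut {J a : Ideal R} (hJ : J ≤ maximalIdeal R) (ha : a ≤ maximalIdeal R) {t : ℕ} (h1 : dm (J ⊔ a) ≤ t) (h2 : dm a ≤ t + 1) :
    ∃ u ∈ J, dm (a ⊔ Ideal.span {u}) ≤ t := by
  have hfin : a.minimalPrimes.Finite := Ideal.finite_minimalPrimes_of_isNoetherianRing R a
  have hS : ({P ∈ a.minimalPrimes | dm P = t + 1}).Finite := hfin.subset fun P hP => hP.1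
  obtain ⟨u, hu, hav⟩ : ∃ u ∈ J, ∀ P ∈ hS.toFinset, u ∉ P := by
    refine avoid J _ fun P hP => ?_
    rw [Set.Finite.mem_toFinset] at hP
    have hPp : P.IsPrime := hP.1.1.1
    refine ⟨hPp, fun hle => ?_⟩
    have := dm_anti (sup_le hle hP.1.1.2) (prime_le hPp)
    have := hP.2
    omega
  refine ⟨u, hu, ?_⟩
  obtain ⟨Q, hQ, hle, hd⟩ := exists_prime_dm (span_le_m ha (hJ hu))
  rw [← hd]
  obtain ⟨P, hP, hPQ⟩ := Ideal.exists_minimalPrimes_le (le_sup_left.trans hle)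
  have hPp : P.IsPrime := hP.1.1
  have h3 : dm P ≤ t + 1 := (dm_anti hP.1.2 (prime_le hPp)).trans h2
  rcases eq_or_lt_of_le hPQ with h | h
  · by_contra hlt
    refine hav P (hS.mem_toFinset.2 ⟨hP, by rw [h] at h3 ⊢; omega⟩) ?_
    rw [h]; exact hle (Ideal.mem_sup_right (Ideal.mem_span_singleton_self u))
  · have := dm_lt hPp hQ h
    omega

lemma mem_of_span {a Q : Ideal R} {x : R} (h : a ⊔ Ideal.span {x} ≤ Q) : x ∈ Q := h (Ideal.mem_sup_right (Ideal.mem_span_singleton_self x))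
lemma span_le {a Q : Ideal R} {x : R} (h : a ≤ Q) (hx : x ∈ Q) : a ⊔ Ideal.span {x} ≤ Q := sup_le h ((Ideal.span_singleton_le_iff_mem Q).2 hx)

lemma exists_below {p P : Ideal R} (hp : p.IsPrime) (hP : P.IsPrime) (h : p < P) : ∃ q : Ideal R, q.IsPrime ∧ p ≤ q ∧ Imm q P := by
  obtain ⟨q, ⟨hq, hpq, hqP⟩, hmax⟩ := (wellFounded_gt (α := Ideal R)).has_min
    {a : Ideal R | a.IsPrime ∧ p ≤ a ∧ a < P} ⟨p, hp, le_rfl, h⟩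
  refine ⟨q, hq, hpq, hqP, fun r hr hqr hrP => ?_⟩
  by_contra hne
  exact hmax r ⟨hr, hpq.trans hqr.le, lt_of_le_of_ne hrP hne⟩ hqr

variable [IsAdicComplete (maximalIdeal R) R]

lemma final_aux {I p1 Q : Ideal R} (hI : I ≤ maximalIdeal R) {e : ℕ} (hp1 : p1.IsPrime) (hd : dm p1 = e + 3) (hV : V I p1 2) 
    (hQ : Q.IsPrime) (hle : p1 ≤ Q) (hIQ : dm (I ⊔ Q) ≤ e) {x : R} (hx : x ∈ Q) (hmin : ∀ Q' : Ideal R, Q'.IsPrime → p1 ≤ Q' → 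
      x ∈ Q' → Q' ≤ Q → Q' = Q) : False := by
  have h1 := dim_ineq hI e Q 1 hQ (hV.mono hp1 hQ hle) hIQ
  rcases eq_or_lt_of_le hle with h | h
  · rw [h] at hd; omega
  · have hm : Q ∈ (p1 ⊔ Ideal.span {x}).minimalPrimes := 
      ⟨⟨hQ, span_le hle hx⟩, fun Q' hQ' hQQ => (hmin Q' hQ'.1 (le_sup_left.trans hQ'.2) (mem_of_span hQ'.2) hQQ).ge⟩
    have him : Imm p1 Q := ⟨h, fun r hr hpr hrQ => by
      by_contra hne
      exact krull1 hp1 hr x hm hpr (lt_of_le_of_ne hrQ hne)⟩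
    have := cat hp1 hQ him
    omega

theorem final {I : Ideal R} (hI : I ≤ maximalIdeal R) (hc : Cls I) {p0 : Ideal R} (hp0 : p0.IsPrime) (hIp : ¬ I ≤ p0) 
    (he : 2 ≤ dm (I ⊔ p0)) : V I p0 2 := by
  by_contra hno
  obtain ⟨e, hee⟩ : ∃ e, dm (I ⊔ p0) = e + 2 := ⟨_, (Nat.sub_add_cancel he).symm⟩
  have hIp0 : I ⊔ p0 ≤ maximalIdeal R := sup_le hI (prime_le hp0)
  obtain ⟨P, hP, hPle, hPd⟩ := exists_prime_dm hIp0
  have hIP : I ≤ P := le_sup_left.trans hPle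
  have hVP : V I P 1 := V_self hIP
  have hlt0 : p0 < P := lt_of_le_of_ne (le_sup_right.trans hPle) fun h => hIp (h ▸ hIP)
  obtain ⟨ps, hps, h0s, hims⟩ := exists_below hp0 hP hlt0
  have hlts : p0 < ps := lt_of_le_of_ne h0s fun h => hno (by rw [h]; exact cousin hI hc ps P hps hP hims 1 hVP)
  obtain ⟨p, hp, h0p, himp⟩ := exists_below hp0 hps hlts
  have hVps := cousin hI hc ps P hps hP hims 1 hVP
  have hd1 := cat hps hP hims
  have hd2 := cat hp hps himp
  have hd3 := dm_lt hps hP hims.1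
  have hd4 := dm_lt hp hps himp.1
  have hpm := prime_le hp
  have hIpd : dm (I ⊔ p) ≤ e + 2 := by
    rw [← hee]; exact dm_anti (sup_le_sup_left h0p I) (sup_le hI hpm)
  obtain ⟨u1, hu1, hk1⟩ := cut hI hpm (t := e+3) (by omega) (by omega)
  have ha1 := span_le hpm (hI hu1)
  obtain ⟨u2, hu2, hk2⟩ := cut hI ha1 (t := e+2) ((dm_anti (sup_le_sup_left le_sup_left I) (sup_le hI ha1)).trans hIpd) hk1
  have ha2 := span_le ha1 (hI hu2)
  have hmz : ∀ a : Ideal R, a ≤ maximalIdeal R → dm (maximalIdeal R ⊔ a) = 0 := fun a ha => by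
    rw [sup_eq_left.2 ha]; exact (dm_eq_zero (maximalIdeal.isMaximal R).isPrime).2 rfl
  obtain ⟨x1, hx1, hk3⟩ := cut le_rfl ha2 (t := e+1) (by rw [hmz _ ha2]; omega) hk2
  have ha3 := span_le ha2 hx1
  obtain ⟨x2, hx2, hk4⟩ := cut le_rfl ha3 (t := e) (by rw [hmz _ ha3]; omega) hk3
  have ha4 := span_le ha3 hx2
  have hg : u1 * x1 - u2 * x2 ∈ P := hIP (I.sub_mem (I.mul_mem_right _ hu1) (I.mul_mem_right _ hu2))
  obtain ⟨p1, hp1, hpp1, hp1P, hgp1⟩ : ∃ p1 : Ideal R, p1.IsPrime ∧ p < p1 ∧ p1 < P ∧ u1 * x1 - u2 * x2 ∈ p1 := by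
    by_cases hgp : u1 * x1 - u2 * x2 ∈ p
    · exact ⟨ps, hps, himp.1, hims.1, himp.1.le hgp⟩
    · obtain ⟨p1, hp1, hle⟩ := Ideal.exists_minimalPrimes_le (span_le (himp.1.le.trans hims.1.le) hg)
      have hgm := mem_of_span hp1.1.2
      refine ⟨p1, hp1.1.1, lt_of_le_of_ne (le_sup_left.trans hp1.1.2) fun h => hgp (by rw [h]; exact hgm), lt_of_le_of_ne hle fun h => ?_, hgm⟩
      rw [h] at hp1
      exact krull1 hp hps _ hp1 himp.1 hims.1
  have hd5 := dm_lt hp hp1 hpp1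
  have hd6 := dm_lt hp1 hP hp1P
  have him1 : Imm p1 P := ⟨hp1P, fun r hr h1 h2 => by
    by_contra hne
    have := dm_lt hp1 hr h1
    have := dm_lt hr hP (lt_of_le_of_ne h2 hne)
    omega⟩
  have hV1 := cousin hI hc p1 P hp1 hP him1 1 hVP
  have hp1m := prime_le hp1
  have hb1 := dm_le_succ hp1m hx1
  have hb1m := span_le hp1m hx1
  have hb2 := dm_le_succ hb1m hx2
  obtain ⟨Q, hQ, hQle, hQd⟩ := exists_prime_dm (span_le hb1m hx2)
  have hQp1 : p1 ≤ Q := le_sup_left.trans (le_sup_left.trans hQle)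
  have hQx1 : x1 ∈ Q := mem_of_span (le_sup_left.trans hQle)
  have hQx2 : x2 ∈ Q := mem_of_span hQle
  have hQmin : ∀ Q' : Ideal R, Q'.IsPrime → p1 ≤ Q' → x1 ∈ Q' → x2 ∈ Q' → Q' ≤ Q → Q' = Q := fun Q' hQ' h1 h2 h3 h4 => by
    by_contra hne
    have := dm_lt hQ' hQ (lt_of_le_of_ne h4 hne)
    have := dm_anti (span_le (span_le h1 h2) h3) (prime_le hQ')
    omega
  have hbig : ∀ Q' : Ideal R, Q' ≤ maximalIdeal R → p ≤ Q' → u1 ∈ Q' → u2 ∈ Q' → x1 ∈ Q' → x2 ∈ Q' → dm Q' ≤ e := fun Q' hm h1 h2 h3 h4 h5 =>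
    (dm_anti (span_le (span_le (span_le (span_le h1 h2) h3) h4) h5) hm).trans hk4
  have hIQ : dm (I ⊔ Q) ≤ e := hbig _ (sup_le hI (prime_le hQ)) ((hpp1.le.trans hQp1).trans le_sup_right) (Ideal.mem_sup_left hu1)
    (Ideal.mem_sup_left hu2) (Ideal.mem_sup_right hQx1) (Ideal.mem_sup_right hQx2)
  have hp1d : dm p1 = e + 3 := by omega
  by_cases hu1Q : u1 ∈ Q
  · have hu2Q : u2 ∉ Q := fun h => by
      have := hbig Q (prime_le hQ) (hpp1.le.trans hQp1) hu1Q h hQx1 hQx2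
      omega
    refine final_aux hI hp1 hp1d hV1 hQ hQp1 hIQ hQx1 fun Q' hQ' h1 h2 h3 => hQmin Q' hQ' h1 h2 ?_ h3
    have : u2 * x2 ∈ Q' := by
      have := Q'.sub_mem (Q'.mul_mem_left u1 h2) (h1 hgp1)
      rwa [sub_sub_cancel] at this
    exact (hQ'.mem_or_mem this).resolve_left fun h => hu2Q (h3 h)
  · refine final_aux hI hp1 hp1d hV1 hQ hQp1 hIQ hQx2 fun Q' hQ' h1 h2 h3 => hQmin Q' hQ' h1 ?_ h2 h3
    have : u1 * x1 ∈ Q' := by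
      have := Q'.add_mem (Q'.mul_mem_left u2 h2) (h1 hgp1)
      rwa [add_sub_cancel] at this
    exact (hQ'.mem_or_mem this).resolve_left fun h => hu1Q (h3 h)

end F3
end CLC

namespace CLC
section G1
variable {R : Type u} [CommRing R] [IsNoetherianRing R]
open IsLocalRing

lemma isCofinite_iff (I : Ideal R) (L : ModuleCat.{u} R) : IsCofinite I L ↔ Cof I L := by
  have h : ∀ i : ℕ, Module.Finite R
      (((Ext R (ModuleCat.{u} R) i).obj (Opposite.op (ModuleCat.of R (R ⧸ I)))).obj L) ↔ Module.Finite R (EX R (R ⧸ I) L i) := by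
    intro i
    obtain ⟨e⟩ := exists_extEquiv (ModuleCat.of R (R ⧸ I)) L i
    exact ⟨fun h => Module.Finite.equiv e, fun h => by
      have h' : Module.Finite R (Abelian.Ext (ModuleCat.of R (R ⧸ I)) L i) := h
      exact Module.Finite.equiv e.symm⟩
  exact and_congr (support_iff_tors I) (forall_congr' h)

lemma mem_iff_cls (I : Ideal R) : MemCofiniteClass R I ↔ Cls I := by
  constructor
  · intro h M _ _ hM i
    obtain ⟨e⟩ := lc_equiv I i (ModuleCat.of R M)
    exact ((isCofinite_iff I _).1 (h (ModuleCat.of R M) hM i)).congr e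
  · intro h M hM i
    obtain ⟨e⟩ := lc_equiv I i M
    exact (isCofinite_iff I _).2 ((h M hM i).congr e.symm)

lemma mAss_eq : minimalAssociatedPrimes R = minimalPrimes R := by
  have hsub : minimalPrimes R ⊆ associatedPrimes R R := by
    have := Module.associatedPrimes.minimalPrimes_annihilator_subset_associatedPrimes R R
    rwa [Module.annihilator_eq_bot.2 inferInstance] at this
  ext p
  constructor
  · rintro ⟨hp, hmin⟩
    have hpp : p.IsPrime := hp.isPrime
    obtain ⟨q, hq, hqp⟩ := Ideal.exists_minimalPrimes_le (bot_le : (⊥ : Ideal R) ≤ p)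
    rw [← hmin q (hsub hq) hqp]
    exact hq
  · intro hp
    refine ⟨hsub hp, fun q hq hqp => le_antisymm hqp (hp.2 ⟨hq.isPrime, bot_le⟩ hqp)⟩

lemma nt_iff (I p : Ideal R) (i : ℕ) : Nontrivial ((localCohomology I i).obj (ModuleCat.of R (R ⧸ p))) ↔ 
    ¬ Subsingleton (LC I i (R ⧸ p)) := by
  obtain ⟨e⟩ := lc_equiv I i (ModuleCat.of R (R ⧸ p))
  rw [not_subsingleton_iff_nontrivial]
  exact e.toEquiv.nontrivial_congr

variable [IsLocalRing R]

lemma V_of_cd {I p : Ideal R} (h : cohomologicalDim I (ModuleCat.of R (R ⧸ p)) = 1) : V I p 2 := fun i hi => by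
  by_contra hn
  have h1 : ((i : ℕ∞) : WithBot ℕ∞) ≤ cohomologicalDim I (ModuleCat.of R (R ⧸ p)) := le_sSup ⟨i, (nt_iff I p i).2 hn, rfl⟩
  rw [h] at h1
  have : i ≤ 1 := by exact_mod_cast h1
  omega

lemma cd_of_V {I p : Ideal R} (h : V I p 2) (h1 : ¬ V I p 1) : cohomologicalDim I (ModuleCat.of R (R ⧸ p)) = 1 := by
  refine le_antisymm (sSup_le ?_) (le_sSup ⟨1, (nt_iff I p 1).2 fun hs => h1 fun i hi => ?_, by norm_num⟩)
  · rintro _ ⟨i, hi, rfl⟩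
    have hn := (nt_iff I p i).1 hi
    have : i ≤ 1 := by
      by_contra hlt
      exact hn (h i (by omega))
    show ((i : ℕ∞) : WithBot ℕ∞) ≤ 1
    exact_mod_cast this
  · rcases eq_or_lt_of_le hi with h' | h'
    · rw [← h']; exact hs
    · exact h i h'

lemma dim_iff {I p : Ideal R} (h : I ⊔ p ≤ maximalIdeal R) : 
    (0 ≤ ringKrullDim (R ⧸ (I + p)) ∧ ringKrullDim (R ⧸ (I + p)) ≤ 1) ↔ dm (I ⊔ p) ≤ 1 := by
  have e : ringKrullDim (R ⧸ (I + p)) = ((dm (I ⊔ p) : ℕ∞) : WithBot ℕ∞) := dm_eq h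
  rw [e]
  constructor
  · rintro ⟨-, h⟩; exact_mod_cast h
  · intro h; exact ⟨by exact_mod_cast Nat.zero_le _, by exact_mod_cast h⟩

lemma cls_top : Cls (⊤ : Ideal R) := fun M _ _ _ i => Cof.of_sub (subsingleton_of_forall_eq 0 fun x => by
  obtain ⟨n, hn⟩ := LC.torsion (⊤ : Ideal R) i x
  have := hn 1 (by rw [Ideal.top_pow]; trivial)
  rwa [one_smul] at this)

end G1
end CLC

/-- Let `(R, m)` be a Noetherian complete local ring and `I` an ideal of `R`.
Then `I ∈ 𝓘(R)` if and only if `mAss_R R = 𝔄(I,R) ∪ 𝔅(I,R) ∪ 𝔇(I,R)`. -/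
theorem memCofiniteClass_iff {R : Type u} [CommRing R] [IsNoetherianRing R] [IsLocalRing R]
    [IsAdicComplete (IsLocalRing.maximalIdeal R) R] (I : Ideal R) :
    MemCofiniteClass R I ↔
      minimalAssociatedPrimes R = frakA I ∪ frakB I ∪ frakD I := by
  have hsubset : frakA I ∪ frakB I ∪ frakD I ⊆ minimalAssociatedPrimes R := by
    rintro p ((h | h) | h) <;> exact h.1
  rw [CLC.mem_iff_cls]
  by_cases hI : I = ⊤
  · subst hI
    refine ⟨fun _ => Set.Subset.antisymm (fun p hp => Or.inl (Or.inl ⟨hp, Or.inl ?_⟩)) hsubset, fun _ => CLC.cls_top⟩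
    exact top_sup_eq p
  have hIm := IsLocalRing.le_maximalIdeal hI
  constructor
  · intro hc
    refine Set.Subset.antisymm (fun p hp => ?_) hsubset
    have hpp : p.IsPrime := hp.1.isPrime
    have hIp : I ⊔ p ≤ IsLocalRing.maximalIdeal R := sup_le hIm (CLC.prime_le hpp)
    by_cases h1 : I ≤ p
    · exact Or.inl (Or.inl ⟨hp, Or.inr h1⟩)
    by_cases h2 : CLC.dm (I ⊔ p) ≤ 1
    · exact Or.inr ⟨hp, (CLC.dim_iff hIp).2 h2⟩
    refine Or.inl (Or.inr ⟨hp, CLC.cd_of_V (CLC.final hIm hc hpp h1 (by omega)) fun hV => ?_⟩)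
    have h3 := CLC.dim_ineq hIm _ p 0 hpp hV le_rfl
    obtain ⟨Q, hQ, hle, hd⟩ := CLC.exists_prime_dm hIp
    rcases eq_or_lt_of_le (le_sup_right.trans hle) with h | h
    · exact h1 (by rw [h]; exact le_sup_left.trans hle)
    · have := CLC.dm_lt hpp hQ h
      omega
  · intro h
    refine CLC.cls_of I hIm fun p hp => ?_
    have hpp : p.IsPrime := hp.1.1
    have hIp : I ⊔ p ≤ IsLocalRing.maximalIdeal R := sup_le hIm (CLC.prime_le hpp)
    have hp' : p ∈ minimalAssociatedPrimes R := by rw [CLC.mAss_eq]; exact hp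
    rw [h] at hp'
    rcases hp' with (h' | h') | h'
    · rcases h'.2 with h2 | h2
      · exact absurd (top_le_iff.1 (h2 ▸ hIp)) (IsLocalRing.maximalIdeal.isMaximal R).ne_top
      · exact Or.inl ((CLC.V_self h2).mono_k (by omega))
    · exact Or.inl (CLC.V_of_cd h'.2)
    · exact Or.inr ((CLC.dim_iff hIp).1 h'.2)
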